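/- arXiv:1205.5200 — 3 statements merged into one kernel-verified Lean document; each statement's English description precedes it below -/
import Mathlib

section
/- Let μ ∈ Δ_s⁺ be a short positive root with sl₂-triple (e_μ, h_μ, e_{−μ}) and let v_{±μ} be nonzero vectors in the one-dimensional weight spaces V_{θ_s}^{±μ}. Then: H_μ = H_{−μ}; the lines spanned by e_μ·v_{−μ} and by e_{−μ}·v_μ in V_{θ_s}^0 coincide; this line is non-isotropic for the invariant form (·,·)_s and is the orthogonal complement of H_μ in V_{θ_s}^0; and the restriction of (·,·)_s to H_μ is nondegenerate. -/
open scoped RealInnerProductSpace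

/-- The orthogonal reflection of a Euclidean space in the hyperplane orthogonal to `α`. -/
noncomputable def rrefl {E : Type} [NormedAddCommGroup E] [InnerProductSpace ℝ E]
    [FiniteDimensional ℝ E] (α : E) : E ≃ₗᵢ[ℝ] E :=
  Submodule.reflection ((ℝ ∙ α)ᗮ)

/-- The `χ`-weight space of the `L`-module `M` with respect to the subalgebra `H`:
`{v : M | ∀ x ∈ H, x · v = χ(x) • v}`.  With `M := L` (adjoint action) and `χ = e μ` this is
the root space `𝔤^μ`. -/
def hwt {L : Type} [LieRing L] [LieAlgebra ℂ L] (H : LieSubalgebra ℂ L)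
    (M : Type) [AddCommGroup M] [Module ℂ M] [LieRingModule L M] [LieModule ℂ L M]
    (χ : H → ℂ) : Submodule ℂ M where
  carrier := {v | ∀ x : H, ⁅(x : L), v⁆ = χ x • v}
  add_mem' := by
    intro a b ha hb x
    rw [lie_add, ha x, hb x, smul_add]
  zero_mem' := by
    intro x
    rw [lie_zero, smul_zero]
  smul_mem' := by
    intro c v hv x
    rw [lie_smul, hv x, smul_comm]

/-- The action of `x ∈ L` on the module `M`, as a linear map `M →ₗ M`. -/
def adm (L : Type) [LieRing L] [LieAlgebra ℂ L]
    (M : Type) [AddCommGroup M] [Module ℂ M] [LieRingModule L M] [LieModule ℂ L M]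
    (x : L) : M →ₗ[ℂ] M where
  toFun v := ⁅x, v⁆
  map_add' a b := lie_add x a b
  map_smul' c v := lie_smul c x v

/-- For `v ∈ M`, the linear map `L → M`, `y ↦ y · v`; its range is `𝔤·v` and its kernel is
the stabiliser of `v` in `L`. -/
def actOn (L : Type) [LieRing L] [LieAlgebra ℂ L]
    (M : Type) [AddCommGroup M] [Module ℂ M] [LieRingModule L M] [LieModule ℂ L M]
    (v : M) : L →ₗ[ℂ] M where
  toFun y := ⁅y, v⁆
  map_add' a b := add_lie a b v
  map_smul' c y := smul_lie c y v

lemma hwt_lie_aux {L : Type} [LieRing L] [LieAlgebra ℂ L] (H : LieSubalgebra ℂ L)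
    (M : Type) [AddCommGroup M] [Module ℂ M] [LieRingModule L M] [LieModule ℂ L M]
    (χ ψ : H → ℂ) (x : L) (v : M) (hx : x ∈ hwt H L χ) (hv : v ∈ hwt H M ψ) :
    ⁅x, v⁆ ∈ hwt H M (χ + ψ) := by
  intro y
  have h1 : ⁅(y : L), x⁆ = χ y • x := hx y
  have h2 : ⁅(y : L), v⁆ = ψ y • v := hv y
  rw [leibniz_lie, h1, h2, smul_lie, lie_smul, Pi.add_apply, add_smul]

lemma hwt_L_top {L : Type} [LieRing L] [LieAlgebra ℂ L] [FiniteDimensional ℂ L]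
    [LieAlgebra.IsSimple ℂ L] (H : LieSubalgebra ℂ L) [H.IsCartanSubalgebra] (x : L) :
    x ∈ ⨆ χ : H → ℂ, hwt H L χ := by
  have h : x ∈ ⨆ χ : H → ℂ, (LieAlgebra.rootSpace H χ).toSubmodule := by
    rw [← LieSubmodule.iSup_toSubmodule,
      LieModule.iSup_genWeightSpace_eq_top (K := ℂ) (L := H) (M := L)]
    trivial
  refine (iSup_mono fun χ => ?_ : _ ≤ ⨆ χ : H → ℂ, hwt H L χ) h
  intro y hy z
  exact LieAlgebra.IsKilling.lie_eq_smul_of_mem_rootSpace hy z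

lemma hwt_M_top {L : Type} [LieRing L] [LieAlgebra ℂ L] [FiniteDimensional ℂ L]
    [LieAlgebra.IsSimple ℂ L] (H : LieSubalgebra ℂ L) [H.IsCartanSubalgebra]
    (M : Type) [AddCommGroup M] [Module ℂ M] [LieRingModule L M] [LieModule ℂ L M]
    (hMsimple : ∀ N : LieSubmodule ℂ L M, N = ⊥ ∨ N = ⊤)
    (χ : H → ℂ) (v : M) (hv : v ∈ hwt H M χ) (hv0 : v ≠ 0) :
    ⨆ χ : H → ℂ, hwt H M χ = ⊤ := by
  let N : LieSubmodule ℂ L M :=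
    { (⨆ χ : H → ℂ, hwt H M χ : Submodule ℂ M) with
      lie_mem := by
        intro x m hm
        change m ∈ ⨆ χ : H → ℂ, hwt H M χ at hm
        change ⁅x, m⁆ ∈ ⨆ χ : H → ℂ, hwt H M χ
        induction hm using Submodule.iSup_induction' with
        | mem ψ m hm =>
          induction hwt_L_top H x using Submodule.iSup_induction' with
          | mem φ x hx =>
            exact Submodule.mem_iSup_of_mem (φ + ψ) (hwt_lie_aux H M φ ψ x m hx hm)
          | zero => rw [zero_lie]; exact Submodule.zero_mem _
          | add a b _ _ ha hb => rw [add_lie]; exact Submodule.add_mem _ ha hb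
        | zero => rw [lie_zero]; exact Submodule.zero_mem _
        | add a b _ _ ha hb => rw [lie_add]; exact Submodule.add_mem _ ha hb }
  have hvN : v ∈ N := (Submodule.mem_iSup_of_mem χ hv : v ∈ ⨆ χ : H → ℂ, hwt H M χ)
  have hN : N = ⊤ := by
    rcases hMsimple N with h | h
    · rw [h] at hvN
      exact absurd hvN hv0
    · exact h
  rw [eq_top_iff]
  intro m _
  have : m ∈ N := by rw [hN]; trivial
  exact this

lemma rad_zero {L : Type} [LieRing L] [LieAlgebra ℂ L]
    (M : Type) [AddCommGroup M] [Module ℂ M] [LieRingModule L M] [LieModule ℂ L M]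
    (hMsimple : ∀ N : LieSubmodule ℂ L M, N = ⊥ ∨ N = ⊤)
    (B : M →ₗ[ℂ] M →ₗ[ℂ] ℂ) (hBne : B ≠ 0)
    (hBinv : ∀ (x : L) (v w : M), B ⁅x, v⁆ w + B v ⁅x, w⁆ = 0)
    (u : M) (hu : ∀ w, B u w = 0) : u = 0 := by
  let N : LieSubmodule ℂ L M :=
    { LinearMap.ker B with
      lie_mem := by
        intro x m hm
        change B m = 0 at hm
        change B ⁅x, m⁆ = 0
        ext w
        have := hBinv x m w
        rw [hm] at this
        simpa using this }
  have huN : u ∈ N := by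
    change B u = 0
    ext w
    exact hu w
  rcases hMsimple N with h | h
  · rw [h] at huN
    exact huN
  · exfalso
    apply hBne
    refine LinearMap.ext fun m => ?_
    have : m ∈ N := by rw [h]; trivial
    exact this

lemma hwt_orth {L : Type} [LieRing L] [LieAlgebra ℂ L] (H : LieSubalgebra ℂ L)
    (M : Type) [AddCommGroup M] [Module ℂ M] [LieRingModule L M] [LieModule ℂ L M]
    (B : M →ₗ[ℂ] M →ₗ[ℂ] ℂ)
    (hBinv : ∀ (x : L) (v w : M), B ⁅x, v⁆ w + B v ⁅x, w⁆ = 0)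
    (χ ψ : H → ℂ) (v w : M) (hv : v ∈ hwt H M χ) (hw : w ∈ hwt H M ψ)
    (hne : ψ ≠ -χ) : B v w = 0 := by
  by_contra hB
  apply hne
  funext x
  have h1 : ⁅(x : L), v⁆ = χ x • v := hv x
  have h2 : ⁅(x : L), w⁆ = ψ x • w := hw x
  have := hBinv x v w
  rw [h1, h2] at this
  simp only [map_smul, LinearMap.smul_apply, smul_eq_mul, ← add_mul] at this
  have := (mul_eq_zero.mp this).resolve_right hB
  simp only [Pi.neg_apply]
  linear_combination this

lemma hwt_nondeg {L : Type} [LieRing L] [LieAlgebra ℂ L] [FiniteDimensional ℂ L]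
    [LieAlgebra.IsSimple ℂ L] (H : LieSubalgebra ℂ L) [H.IsCartanSubalgebra]
    (M : Type) [AddCommGroup M] [Module ℂ M] [LieRingModule L M] [LieModule ℂ L M]
    (hMsimple : ∀ N : LieSubmodule ℂ L M, N = ⊥ ∨ N = ⊤)
    (B : M →ₗ[ℂ] M →ₗ[ℂ] ℂ) (hBne : B ≠ 0)
    (hBinv : ∀ (x : L) (v w : M), B ⁅x, v⁆ w + B v ⁅x, w⁆ = 0)
    (χ : H → ℂ) (u : M) (hu : u ∈ hwt H M χ) (h : ∀ w ∈ hwt H M (-χ), B u w = 0) : u = 0 := by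
  by_contra hu0
  apply hu0
  refine rad_zero M hMsimple B hBne hBinv u fun w => ?_
  have hw : w ∈ ⨆ χ : H → ℂ, hwt H M χ := by
    rw [hwt_M_top H M hMsimple χ u hu hu0]; trivial
  induction hw using Submodule.iSup_induction' with
  | mem ψ w hw =>
    by_cases hψ : ψ = -χ
    · subst hψ; exact h w hw
    · exact hwt_orth H M B hBinv χ ψ u w hu hw hψ
  | zero => simp
  | add a b _ _ ha hb => rw [map_add, ha, hb, add_zero]

/-- Let `μ` be a short positive root with `sl₂`-triple `(Eμ, hμ, Fμ)` and
`v₊, v₋` nonzero vectors in the one-dimensional weight spaces `V^{±μ}`.  Then `H_μ = H_{−μ}`;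
the lines spanned by `Eμ·v₋` and `Fμ·v₊` in `V⁰` coincide; this line is non-isotropic for the
invariant form and is the orthogonal complement of `H_μ` in `V⁰`; and the restriction of the
form to `H_μ` is nondegenerate. -/
theorem statement13
    {E : Type} [NormedAddCommGroup E] [InnerProductSpace ℝ E] [FiniteDimensional ℝ E]
    (Δ Δs Δl Δp Φ Φs : Set E)
    -- `Δ` is a reduced crystallographic root system in `E`
    (hfin : Δ.Finite) (h0 : (0 : E) ∉ Δ)
    (hspan : Submodule.span ℝ Δ = ⊤)
    (hrefl : ∀ α ∈ Δ, ∀ β ∈ Δ, rrefl α β ∈ Δ)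
    (hcrys : ∀ α ∈ Δ, ∀ β ∈ Δ, ∃ n : ℤ, 2 * ⟪β, α⟫ / ⟪α, α⟫ = (n : ℝ))
    (hred : ∀ α ∈ Δ, ∀ t : ℝ, t • α ∈ Δ → t = 1 ∨ t = -1)
    -- irreducible
    (hirr : ∀ A B : Set E, A ∪ B = Δ → (∀ a ∈ A, ∀ b ∈ B, ⟪a, b⟫ = 0) → A = ∅ ∨ B = ∅)
    -- two root lengths: `Δs` are the short roots, `Δl` the long ones
    (ls ll : ℝ) (h0ls : 0 < ls) (hlsll : ls < ll)
    (hΔs : Δs = {α ∈ Δ | ‖α‖ = ls}) (hΔl : Δl = {α ∈ Δ | ‖α‖ = ll})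
    (hcover : Δ = Δs ∪ Δl) (hsne : Δs.Nonempty) (hlne : Δl.Nonempty)
    -- `Δp` is a positive system with simple roots `Φ`; `Φs = Φ ∩ Δs`
    (hΔpΔ : Δp ⊆ Δ) (hpm : ∀ α ∈ Δ, α ∈ Δp ↔ -α ∉ Δp)
    (hΦp : Φ ⊆ Δp)
    (hΦind : LinearIndependent ℝ (fun a : Φ => (a : E)))
    (hΦdec : ∀ γ ∈ Δp, ∃ c : E →₀ ℕ, ↑c.support ⊆ Φ ∧ γ = c.sum fun α n => (n : ℝ) • α)
    (hΦs : Φs = Φ ∩ Δs)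
    -- `θs` is the highest short root
    (θs : E) (hθsmem : θs ∈ Δs ∩ Δp)
    (hθshigh : ∀ γ ∈ Δs, ∃ c : E →₀ ℝ, ↑c.support ⊆ Φ ∧ (∀ α, 0 ≤ c α) ∧
      θs - γ = c.sum fun α t => t • α)
    -- `L` is a complex simple Lie algebra with Cartan subalgebra `H`, whose root system
    -- is identified with `Δ` via `e`
    (L : Type) [LieRing L] [LieAlgebra ℂ L] [FiniteDimensional ℂ L]
    [LieAlgebra.IsSimple ℂ L]
    (H : LieSubalgebra ℂ L) [H.IsCartanSubalgebra]
    (e : E → H → ℂ)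
    (headd : ∀ a b : E, e (a + b) = e a + e b)
    (heinj : Function.Injective e)
    (hroots1 : ∀ μ ∈ Δ, hwt H L (e μ) ≠ ⊥)
    (hroots2 : ∀ χ : H → ℂ, χ ≠ 0 → hwt H L χ ≠ ⊥ → ∃ μ ∈ Δ, χ = e μ)
    -- `M` is the little adjoint module `V_{θs}`: the (finite-dimensional) simple
    -- `L`-module with highest weight `θs`
    (M : Type) [AddCommGroup M] [Module ℂ M] [LieRingModule L M] [LieModule ℂ L M]
    [FiniteDimensional ℂ M] [Nontrivial M]
    (hMsimple : ∀ N : LieSubmodule ℂ L M, N = ⊥ ∨ N = ⊤)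
    (hhw : ∃ v : M, v ≠ 0 ∧ v ∈ hwt H M (e θs) ∧
      ∀ γ ∈ Δp, ∀ x ∈ hwt H L (e γ), ⁅x, v⁆ = 0)
    -- the weights of `M` are `Δs ∪ {0}`, and each nonzero weight has multiplicity one
    (hwts : ∀ χ : H → ℂ, hwt H M χ ≠ ⊥ → χ = 0 ∨ ∃ μ ∈ Δs, χ = e μ)
    (hmult1 : ∀ μ ∈ Δs, Module.finrank ℂ ↥(hwt H M (e μ)) = 1)
    -- a nonzero invariant symmetric bilinear form `(·,·)_s` on `M`
    (B : M →ₗ[ℂ] M →ₗ[ℂ] ℂ) (hBne : B ≠ 0)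
    (hBsymm : ∀ v w : M, B v w = B w v)
    (hBinv : ∀ (x : L) (v w : M), B ⁅x, v⁆ w + B v ⁅x, w⁆ = 0)
    -- a short positive root `μ` and an `sl₂`-triple `(Eμ, hμ, Fμ)` for it
    (μ : E) (hμΔ : μ ∈ Δs ∩ Δp)
    (Eμ Fμ : L) (hμ : H)
    (hE : Eμ ∈ hwt H L (e μ)) (hF : Fμ ∈ hwt H L (e (-μ)))
    (hEF : ⁅Eμ, Fμ⁆ = (hμ : L))
    (hHE : ⁅(hμ : L), Eμ⁆ = (2 : ℂ) • Eμ) (hHF : ⁅(hμ : L), Fμ⁆ = (-2 : ℂ) • Fμ)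
    (hpair : e μ hμ = 2)
    -- nonzero weight vectors `v₊ ∈ V^μ` and `v₋ ∈ V^{−μ}`
    (vp vn : M) (hvp : vp ∈ hwt H M (e μ)) (hvp0 : vp ≠ 0)
    (hvn : vn ∈ hwt H M (e (-μ))) (hvn0 : vn ≠ 0) :
    hwt H M (0 : H → ℂ) ⊓ LinearMap.ker (adm L M Eμ) =
        hwt H M (0 : H → ℂ) ⊓ LinearMap.ker (adm L M Fμ) ∧
    Submodule.span ℂ {⁅Eμ, vn⁆} = Submodule.span ℂ {⁅Fμ, vp⁆} ∧
    B ⁅Eμ, vn⁆ ⁅Eμ, vn⁆ ≠ 0 ∧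
    (Submodule.span ℂ {⁅Eμ, vn⁆} : Set M) =
      {u : M | u ∈ hwt H M (0 : H → ℂ) ∧
        ∀ z ∈ hwt H M (0 : H → ℂ) ⊓ LinearMap.ker (adm L M Eμ), B u z = 0} ∧
    (∀ u ∈ hwt H M (0 : H → ℂ) ⊓ LinearMap.ker (adm L M Eμ),
      (∀ z ∈ hwt H M (0 : H → ℂ) ⊓ LinearMap.ker (adm L M Eμ), B u z = 0) → u = 0) := by
  have he0 : e 0 = 0 := by
    have := headd 0 0
    rw [add_zero] at this
    exact left_eq_add.mp this
  have heneg : e (-μ) = -e μ := by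
    have := headd μ (-μ)
    rw [add_neg_cancel, he0] at this
    exact (neg_eq_of_add_eq_zero_right this.symm).symm
  have hμs : μ ∈ Δs := hμΔ.1
  have hμ' : μ ∈ Δ ∧ ‖μ‖ = ls := by rw [hΔs] at hμs; exact hμs
  have hnegs : -μ ∈ Δs := by
    rw [hΔs]
    refine ⟨?_, by rw [norm_neg]; exact hμ'.2⟩
    have h := hrefl μ hμ'.1 μ hμ'.1
    have h2 : rrefl μ μ = -μ := by
      unfold rrefl
      exact Submodule.reflection_orthogonalComplement_singleton_eq_neg μ
    rwa [h2] at h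
  have hsub : Δs ⊆ Δ := by rw [hΔs]; exact fun _ h => h.1
  have hbot : ∀ t : ℝ, t ≠ 1 → t ≠ -1 → e (t • μ) ≠ 0 → hwt H M (e (t • μ)) = ⊥ := by
    intro t h1 h2 h3
    by_contra hne
    rcases hwts _ hne with h | ⟨ν, hν, h⟩
    · exact h3 h
    · have := heinj h
      rw [← this] at hν
      rcases hred μ hμ'.1 t (hsub hν) with h | h
      · exact h1 h
      · exact h2 h
  have hμμ : e ((2 : ℝ) • μ) = e μ + e μ := by rw [two_smul, headd]
  have hμn0 : μ ≠ 0 := fun h => h0 (h ▸ hμ'.1)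
  have hnn : e ((-2 : ℝ) • μ) = e (-μ) + e (-μ) := by
    rw [← headd]; congr 1; rw [neg_smul, two_smul]; abel
  have hEvp : ⁅Eμ, vp⁆ = 0 := by
    have h := hwt_lie_aux H M _ _ Eμ vp hE hvp
    rw [← hμμ, hbot 2 (by norm_num) (by norm_num) (by
      rw [← he0]; intro h; have := heinj h; simp [hμn0] at this)] at h
    exact h
  have hFvn : ⁅Fμ, vn⁆ = 0 := by
    have h := hwt_lie_aux H M _ _ Fμ vn hF hvn
    rw [← hnn, hbot (-2) (by norm_num) (by norm_num) (by
      rw [← he0]; intro h; have := heinj h; simp [hμn0] at this)] at h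
    exact h
  have hline : ∀ ν ∈ Δs, ∀ v ∈ hwt H M (e ν), v ≠ 0 → ∀ w ∈ hwt H M (e ν),
      ∃ c : ℂ, w = c • v := by
    intro ν hν v hv hv0 w hw
    obtain ⟨c, hc⟩ := exists_smul_eq_of_finrank_eq_one (hmult1 ν hν)
      (x := ⟨v, hv⟩) (by simpa [Subtype.ext_iff] using hv0) ⟨w, hw⟩
    exact ⟨c, (congrArg Subtype.val hc).symm⟩
  have hEz : ∀ z ∈ hwt H M (0 : H → ℂ), ∃ a : ℂ, ⁅Eμ, z⁆ = a • vp := by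
    intro z hz
    have h := hwt_lie_aux H M _ _ Eμ z hE hz
    rw [add_zero] at h
    exact hline μ hμs vp hvp hvp0 _ h
  have hFz : ∀ z ∈ hwt H M (0 : H → ℂ), ∃ b : ℂ, ⁅Fμ, z⁆ = b • vn := by
    intro z hz
    have h := hwt_lie_aux H M _ _ Fμ z hF hz
    rw [add_zero] at h
    exact hline (-μ) hnegs vn hvn hvn0 _ h
  have hhp : ⁅(hμ : L), vp⁆ = (2 : ℂ) • vp := by
    have : ⁅(hμ : L), vp⁆ = e μ hμ • vp := hvp hμ
    rw [this, hpair]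
  have hhn : ⁅(hμ : L), vn⁆ = (-2 : ℂ) • vn := by
    have : ⁅(hμ : L), vn⁆ = e (-μ) hμ • vn := hvn hμ
    rw [this, heneg, Pi.neg_apply, hpair]
  have hEFvp : ⁅Eμ, ⁅Fμ, vp⁆⁆ = (2 : ℂ) • vp := by
    rw [leibniz_lie, hEF, hhp, hEvp, lie_zero, add_zero]
  have hFEvn : ⁅Fμ, ⁅Eμ, vn⁆⁆ = (2 : ℂ) • vn := by
    have h := leibniz_lie Eμ Fμ vn
    rw [hEF, hhn, hFvn, lie_zero, neg_smul] at h
    exact (neg_add_eq_zero.mp h.symm).symm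
  have hFvp0 : ⁅Fμ, vp⁆ ≠ 0 := by
    intro h; rw [h, lie_zero] at hEFvp
    exact hvp0 (by simpa using hEFvp.symm)
  have hEvn0 : ⁅Eμ, vn⁆ ≠ 0 := by
    intro h; rw [h, lie_zero] at hFEvn
    exact hvn0 (by simpa using hFEvn.symm)
  have hEvnz : ⁅Eμ, vn⁆ ∈ hwt H M (0 : H → ℂ) := by
    have h := hwt_lie_aux H M _ _ Eμ vn hE hvn
    rwa [heneg, add_neg_cancel] at h
  have hcomm : ∀ z ∈ hwt H M (0 : H → ℂ), ⁅Eμ, ⁅Fμ, z⁆⁆ = ⁅Fμ, ⁅Eμ, z⁆⁆ := by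
    intro z hz
    have h1 : ⁅(hμ : L), z⁆ = (0 : H → ℂ) hμ • z := hz hμ
    rw [leibniz_lie, hEF, h1, Pi.zero_apply, zero_smul, zero_add]
  obtain ⟨a, ha⟩ := hEz _ hEvnz
  have hrel : (2 : ℂ) • ⁅Eμ, vn⁆ = a • ⁅Fμ, vp⁆ := by
    have h := hcomm _ hEvnz
    rwa [hFEvn, ha, lie_smul, lie_smul] at h
  have ha0 : a ≠ 0 := by
    rintro rfl
    rw [zero_smul] at hrel
    exact hEvn0 (by simpa using hrel)
  have hBpn : B vp vn ≠ 0 := by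
    intro h
    apply hvp0
    refine hwt_nondeg H M hMsimple B hBne hBinv (e μ) vp hvp fun w hw => ?_
    rw [← heneg] at hw
    obtain ⟨c, rfl⟩ := hline (-μ) hnegs vn hvn hvn0 w hw
    rw [map_smul, h, smul_zero]
  have hadmE : ∀ z, z ∈ LinearMap.ker (adm L M Eμ) ↔ ⁅Eμ, z⁆ = 0 := fun z => Iff.rfl
  have hadmF : ∀ z, z ∈ LinearMap.ker (adm L M Fμ) ↔ ⁅Fμ, z⁆ = 0 := fun z => Iff.rfl
  have hiso : B ⁅Eμ, vn⁆ ⁅Eμ, vn⁆ ≠ 0 := by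
    have h := hBinv Eμ vn ⁅Eμ, vn⁆
    rw [ha, map_smul, smul_eq_mul, hBsymm vn vp] at h
    intro h'
    rw [h', zero_add] at h
    exact (mul_ne_zero ha0 hBpn) h
  have horth : ∀ z, ⁅Eμ, z⁆ = 0 → B ⁅Eμ, vn⁆ z = 0 := by
    intro z hz
    have h := hBinv Eμ vn z
    rwa [hz, map_zero, add_zero] at h
  have hdec : ∀ u ∈ hwt H M (0 : H → ℂ), ∃ c : ℂ, u - c • ⁅Eμ, vn⁆ ∈
      hwt H M (0 : H → ℂ) ⊓ LinearMap.ker (adm L M Eμ) := by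
    intro u hu
    obtain ⟨b, hb⟩ := hEz u hu
    refine ⟨b / a, Submodule.sub_mem _ hu (Submodule.smul_mem _ _ hEvnz), ?_⟩
    rw [SetLike.mem_coe, hadmE, lie_sub, lie_smul, hb, ha, smul_smul, div_mul_cancel₀ _ ha0,
      sub_self]
  have hnd : ∀ u ∈ hwt H M (0 : H → ℂ) ⊓ LinearMap.ker (adm L M Eμ),
      (∀ z ∈ hwt H M (0 : H → ℂ) ⊓ LinearMap.ker (adm L M Eμ), B u z = 0) → u = 0 := by
    intro u hu hz
    refine hwt_nondeg H M hMsimple B hBne hBinv 0 u hu.1 fun w hw => ?_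
    rw [neg_zero] at hw
    obtain ⟨c, hc⟩ := hdec w hw
    have h1 := hz _ hc
    rw [map_sub, map_smul, hBsymm u ⁅Eμ, vn⁆, horth u ((hadmE u).1 hu.2), smul_zero, sub_zero] at h1
    exact h1
  refine ⟨?_, ?_, hiso, ?_, hnd⟩
  · ext z
    simp only [Submodule.mem_inf, hadmE, hadmF]
    refine and_congr_right fun hz => ?_
    obtain ⟨b, hb⟩ := hFz z hz
    obtain ⟨c, hc⟩ := hEz z hz
    have h := hcomm z hz
    constructor
    · intro h0
      rw [h0, lie_zero, hb, lie_smul] at h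
      rw [hb, (smul_eq_zero.mp h).resolve_right hEvn0, zero_smul]
    · intro h0
      rw [h0, lie_zero, hc, lie_smul] at h
      rw [hc, (smul_eq_zero.mp h.symm).resolve_right hFvp0, zero_smul]
  · have h2 : ⁅Eμ, vn⁆ = (a / 2) • ⁅Fμ, vp⁆ := by
      rw [div_eq_inv_mul, mul_smul, ← hrel, smul_smul]; norm_num
    rw [h2]
    exact Submodule.span_singleton_smul_eq (IsUnit.mk0 _ (div_ne_zero ha0 two_ne_zero)) _
  · ext u
    simp only [SetLike.mem_coe, Set.mem_ofPred_eq, Submodule.mem_span_singleton]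
    constructor
    · rintro ⟨c, rfl⟩
      refine ⟨Submodule.smul_mem _ _ hEvnz, fun z hz => ?_⟩
      rw [map_smul, LinearMap.smul_apply, horth z ((hadmE z).1 hz.2), smul_zero]
    · rintro ⟨hu, hz⟩
      obtain ⟨c, hc⟩ := hdec u hu
      refine ⟨c, (sub_eq_zero.mp (hnd _ hc fun z hzz => ?_)).symm⟩
      rw [map_sub, LinearMap.sub_apply, hz z hzz, map_smul, LinearMap.smul_apply,
        horth z ((hadmE z).1 hzz.2), smul_zero, sub_zero]
end

section
/- If γ and μ are short roots such that γ − μ is a long root, then the hyperplanes H_γ and H_μ in V_{θ_s}^0 coincide. -/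
open scoped RealInnerProductSpace

namespace St14
open LieModule LieAlgebra LieAlgebra.IsKilling

section Euc
variable {E : Type} [NormedAddCommGroup E] [InnerProductSpace ℝ E] [FiniteDimensional ℝ E]

lemma rrefl_apply (α β : E) : rrefl α β = β - (2 * ⟪β, α⟫ / ⟪α, α⟫) • α := by
  rw [rrefl, Submodule.reflection_orthogonal_apply, Submodule.reflection_singleton_apply,
    real_inner_self_eq_norm_sq, real_inner_comm, neg_sub, ← Nat.cast_smul_eq_nsmul ℝ, smul_smul]
  congr 2
  simp
  ring

lemma coroot_unique (Δ : Set E) (hfin : Δ.Finite)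
    (hrefl : ∀ α ∈ Δ, ∀ β ∈ Δ, rrefl α β ∈ Δ)
    (hcrys : ∀ α ∈ Δ, ∀ β ∈ Δ, ∃ n : ℤ, 2 * ⟪β, α⟫ / ⟪α, α⟫ = (n : ℝ))
    (α : E) (hα : α ∈ Δ) (hα0 : α ≠ 0) (φ : E →+ ℂ) (h2 : φ α = 2)
    (hφ : ∀ β ∈ Δ, ∃ n : ℤ, φ β = n ∧ β - n • α ∈ Δ) (β : E) (hβ : β ∈ Δ) :
    ∃ n : ℤ, φ β = n ∧ 2 * ⟪β, α⟫ / ⟪α, α⟫ = (n : ℝ) := by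
  obtain ⟨n, hn, -⟩ := hφ β hβ
  obtain ⟨m, hm⟩ := hcrys α hα β hβ
  have hαα : ⟪α, α⟫ ≠ (0 : ℝ) := by simpa using hα0
  have key : ∀ k : ℕ, β + ((k : ℤ) * (n - m)) • α ∈ Δ := by
    intro k
    induction k with
    | zero => simpa using hβ
    | succ k ih =>
      obtain ⟨p, hp, hp'⟩ := hφ _ ih
      rw [map_add, map_zsmul, hn, h2] at hp
      have hp2 : p = n + 2 * (k * (n - m)) := by
        have : (p : ℂ) = ((n + 2 * (k * (n - m)) : ℤ) : ℂ) := by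
          rw [← hp, zsmul_eq_mul]; push_cast; ring
        exact_mod_cast this
      have h3 := hrefl α hα _ hp'
      rw [rrefl_apply] at h3
      have h4 : 2 * ⟪β + ((k : ℤ) * (n - m)) • α - p • α, α⟫ / ⟪α, α⟫
          = ((m + 2 * (k * (n - m) - p) : ℤ) : ℝ) := by
        rw [← Int.cast_smul_eq_zsmul ℝ, ← Int.cast_smul_eq_zsmul ℝ, inner_sub_left, inner_add_left,
          inner_smul_left, inner_smul_left]
        push_cast
        rw [← hm]
        simp only [conj_trivial]
        field_simp
        ring
      rw [h4, Int.cast_smul_eq_zsmul, hp2] at h3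
      convert h3 using 1
      push_cast
      module
  by_cases hnm : n = m
  · exact ⟨n, hn, by rw [hm, hnm]⟩
  · exfalso
    refine Set.infinite_of_injective_forall_mem (f := fun k : ℕ => β + ((k : ℤ) * (n - m)) • α)
      ?_ key hfin
    intro a b hab
    have h5 : (((a : ℤ) * (n - m)) • α : E) = ((b : ℤ) * (n - m)) • α := add_left_cancel hab
    rw [← Int.cast_smul_eq_zsmul ℝ, ← Int.cast_smul_eq_zsmul ℝ] at h5
    have h6 := smul_left_injective ℝ hα0 h5
    have h7 : (a : ℤ) * (n - m) = b * (n - m) := by exact_mod_cast h6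
    have := mul_right_cancel₀ (sub_ne_zero.mpr hnm) h7
    exact_mod_cast this
end Euc

section Lie
variable {L : Type} [LieRing L] [LieAlgebra ℂ L] {H : LieSubalgebra ℂ L}
  {M : Type} [AddCommGroup M] [Module ℂ M] [LieRingModule L M] [LieModule ℂ L M]

lemma lie_mem_hwt {χ ψ : H → ℂ} {x : L} {w : M} (hx : x ∈ hwt H L χ) (hw : w ∈ hwt H M ψ) :
    ⁅x, w⁆ ∈ hwt H M (χ + ψ) := by
  intro h
  rw [leibniz_lie, hx h, hw h, smul_lie, lie_smul, ← add_smul]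
  rfl

lemma pow_mem_hwt {χ ψ : H → ℂ} {x : L} {w : M} (hx : x ∈ hwt H L χ) (hw : w ∈ hwt H M ψ)
    (n : ℕ) : ((toEnd ℂ L M x) ^ n) w ∈ hwt H M (n • χ + ψ) := by
  induction n with
  | zero => simpa using hw
  | succ n ih =>
    rw [pow_succ', Module.End.mul_apply, toEnd_apply_apply]
    have := lie_mem_hwt hx ih
    convert this using 1
    rw [succ_nsmul]; abel_nf

lemma sl2_refl [FiniteDimensional ℂ M] {h e f : L} (t : IsSl2Triple h e f) {w : M} (hw : w ≠ 0)
    (n : ℕ) (hh : ⁅h, w⁆ = (-(n : ℂ)) • w) :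
    ∃ k : ℕ, ((toEnd ℂ L M e) ^ (n + k)) (((toEnd ℂ L M f) ^ k) w) ≠ 0 := by
  have hh' : ⁅-h, w⁆ = (n : ℂ) • w := by rw [neg_lie, hh, neg_smul, neg_neg]
  have hE := t.symm.lie_h_pow_toEnd_e hh'
  have hex : ∃ k : ℕ, ((toEnd ℂ L M f) ^ k) w = 0 := by
    have hs : (Set.range <| fun (k : ℕ) ↦ (n : ℂ) + 2 * k).Infinite := by
      rw [Set.infinite_range_iff (fun n m ↦ by simp)]; infer_instance
    by_contra! contra
    exact hs ((toEnd ℂ L M (-h)).eigenvectors_linearIndependent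
      (Set.range <| fun (k : ℕ) ↦ (n : ℂ) + 2 * k)
      (fun s ↦ ((toEnd ℂ L M f) ^ (Classical.choose s.2)) w)
      (fun s ↦ by
        have h1 := hE (Classical.choose s.2)
        have h2 := Classical.choose_spec s.2
        simp only at h2
        rw [h2] at h1
        exact Module.End.hasEigenvector_iff.mpr
          ⟨Module.End.mem_eigenspace_iff.mpr h1, contra _⟩)).finite
  obtain ⟨k, hk1, hk2⟩ := Nat.exists_not_and_succ_of_not_zero_of_exists
    (p := fun k => ((toEnd ℂ L M f) ^ k) w = 0) (by simpa using hw) hex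
  refine ⟨k, ?_⟩
  have P : t.symm.HasPrimitiveVectorWith (((toEnd ℂ L M f) ^ k) w) ((n + 2 * k : ℕ) : ℂ) :=
    { ne_zero := hk1
      lie_h := by rw [hE k]; push_cast; rfl
      lie_e := by simpa [pow_succ'] using hk2 }
  exact P.pow_toEnd_f_ne_zero_of_eq_nat rfl (by omega)

lemma hwt_indep [LieRing.IsNilpotent H] : iSupIndep (fun χ : H → ℂ => hwt H M χ) := by
  have h1 := iSupIndep_genWeightSpace ℂ H M
  rw [← LieSubmodule.iSupIndep_toSubmodule] at h1
  refine h1.mono fun χ => ?_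
  intro w hw
  refine weightSpace_le_genWeightSpace M χ ?_
  rw [mem_weightSpace]
  intro x
  exact hw x

variable [FiniteDimensional ℂ L] [LieAlgebra.IsSimple ℂ L] [H.IsCartanSubalgebra]

lemma hwt_eq (χ : H → ℂ) : hwt H L χ = (rootSpace H χ).toSubmodule := by
  ext w
  constructor
  · intro hw
    refine weightSpace_le_genWeightSpace L χ ?_
    rw [mem_weightSpace]
    intro x
    exact hw x
  · intro hw x
    exact lie_eq_smul_of_mem_rootSpace hw x

lemma hwt_zero (x : L) (hx : x ∈ hwt H L 0) : x ∈ H := by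
  rw [hwt_eq] at hx
  have := rootSpace_zero_eq ℂ L H
  rw [this] at hx
  simpa using hx

lemma hwt_top : (⨆ χ : H → ℂ, hwt H L χ) = ⊤ := by
  simp_rw [hwt_eq]
  rw [← LieSubmodule.iSup_toSubmodule, iSup_genWeightSpace_eq_top ℂ H L]
  rfl

lemma hwt_ne_bot {χ : H → ℂ} (h : hwt H L χ ≠ ⊥) : rootSpace H χ ≠ ⊥ := by
  intro h'
  rw [hwt_eq, h'] at h
  exact h rfl

lemma hwt_one {χ : H → ℂ} (hχ : χ ≠ 0) {x y : L} (hx : x ∈ hwt H L χ) (hx0 : x ≠ 0)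
    (hy : y ∈ hwt H L χ) : ∃ c : ℂ, c • x = y := by
  have hb : hwt H L χ ≠ ⊥ := fun h => hx0 (by rw [h] at hx; simpa using hx)
  let W : Weight ℂ H L := ⟨χ, hwt_ne_bot hb⟩
  have h1 := finrank_rootSpace_eq_one W (fun h => hχ h)
  rw [hwt_eq] at hx hy
  obtain ⟨c, hc⟩ := exists_smul_eq_of_finrank_eq_one h1 (x := ⟨x, hx⟩)
    (fun h => hx0 (congrArg Subtype.val h)) ⟨y, hy⟩
  exact ⟨c, congrArg Subtype.val hc⟩

/-- sl2 data attached to a root. -/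
lemma root_data {χ : H → ℂ} (hχ : χ ≠ 0) (hb : hwt H L χ ≠ ⊥) :
    ∃ (h : H) (e f : L), IsSl2Triple (h : L) e f ∧ e ∈ hwt H L χ ∧ f ∈ hwt H L (-χ) ∧
      χ h = 2 ∧ ∀ ψ : H → ℂ, ψ ≠ 0 → hwt H L ψ ≠ ⊥ → ∃ n : ℤ, ψ h = n ∧ ψ - n • χ ≠ 0 ∧
        hwt H L (ψ - n • χ) ≠ ⊥ := by
  let W : Weight ℂ H L := ⟨χ, hwt_ne_bot hb⟩
  have hW : W.IsNonZero := fun h => hχ h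
  obtain ⟨h, e, f, t, he, hf⟩ := exists_isSl2Triple_of_weight_isNonZero hW
  have hh := IsSl2Triple.h_eq_coroot hW t he hf
  subst hh
  refine ⟨coroot W, e, f, t, ?_, ?_, root_apply_coroot hW, ?_⟩
  · rw [hwt_eq]; exact he
  · rw [hwt_eq]; exact hf
  · intro ψ hψ hψb
    let V : Weight ℂ H L := ⟨ψ, hwt_ne_bot hψb⟩
    have hV : V.IsNonZero := fun h => hψ h
    have hc := apply_coroot_eq_cast W V
    have hcoe : ((reflectRoot W V : Weight ℂ H L) : H → ℂ)
        = ψ - (chainBotCoeff W V - chainTopCoeff W V : ℤ) • χ := by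
      rw [← Int.cast_smul_eq_zsmul ℂ, ← hc]; rfl
    refine ⟨_, hc, ?_, ?_⟩
    · rw [← hcoe]; exact fun h => reflectRoot_isNonZero W V hV h
    · rw [← hcoe, hwt_eq]
      intro h
      exact (reflectRoot W V).genWeightSpace_ne_bot' ((LieSubmodule.toSubmodule_eq_bot _).mp h)
end Lie

section Main
variable {E : Type} [NormedAddCommGroup E] [InnerProductSpace ℝ E] [FiniteDimensional ℝ E]
  {L : Type} [LieRing L] [LieAlgebra ℂ L] {H : LieSubalgebra ℂ L}
  {M : Type} [AddCommGroup M] [Module ℂ M] [LieRingModule L M] [LieModule ℂ L M]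

/-- Words in negative root vectors applied to `v`. -/
inductive Wd (H : LieSubalgebra ℂ L) (e : E →+ (H → ℂ)) (Δp : Set E) (v : M) : M → Prop
  | base : Wd H e Δp v v
  | step (w : M) (α : E) (f : L) : Wd H e Δp v w → α ∈ Δp → f ∈ hwt H L (e (-α)) →
      Wd H e Δp v ⁅f, w⁆

lemma Wd.weight {e : E →+ (H → ℂ)} {Δp : Set E} {v : M} {θ : E} (hv : v ∈ hwt H M (e θ))
    {w : M} (hw : Wd H e Δp v w) :
    ∃ c ∈ AddSubmonoid.closure Δp, w ∈ hwt H M (e (θ - c)) := by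
  induction hw with
  | base => exact ⟨0, zero_mem _, by simpa using hv⟩
  | step w α f _ hα hf ih =>
    obtain ⟨c, hc, hw⟩ := ih
    refine ⟨α + c, add_mem (AddSubmonoid.subset_closure hα) hc, ?_⟩
    have := lie_mem_hwt hf hw
    rw [← map_add] at this
    convert this using 3
    abel

variable [FiniteDimensional ℂ L] [LieAlgebra.IsSimple ℂ L] [H.IsCartanSubalgebra]

lemma weights_cone (Δ Δp : Set E) (hpm : ∀ α ∈ Δ, α ∈ Δp ↔ -α ∉ Δp) (e : E →+ (H → ℂ))
    (heinj : Function.Injective e)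
    (hroots2 : ∀ χ : H → ℂ, χ ≠ 0 → hwt H L χ ≠ ⊥ → ∃ μ ∈ Δ, χ = e μ)
    (hMsimple : ∀ N : LieSubmodule ℂ L M, N = ⊥ ∨ N = ⊤)
    (θ : E) (v : M) (hv0 : v ≠ 0) (hv : v ∈ hwt H M (e θ))
    (hvp : ∀ γ ∈ Δp, ∀ x ∈ hwt H L (e γ), ⁅x, v⁆ = 0)
    (β : E) (hβ : hwt H M (e β) ≠ ⊥) :
    ∃ c ∈ AddSubmonoid.closure Δp, β = θ - c := by
  set S : Submodule ℂ M := Submodule.span ℂ {w | Wd H e Δp v w} with hS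
  have hfS : ∀ α ∈ Δp, ∀ f ∈ hwt H L (e (-α)), ∀ m ∈ S, ⁅f, m⁆ ∈ S := by
    intro α hα f hf m hm
    induction hm using Submodule.span_induction with
    | mem w hw => exact Submodule.subset_span (Wd.step w α f hw hα hf)
    | zero => simp
    | add a b _ _ ha hb => rw [lie_add]; exact add_mem ha hb
    | smul c a _ ha => rw [lie_smul]; exact S.smul_mem c ha
  have hvS : v ∈ S := Submodule.subset_span Wd.base
  have hbase : ∀ x : L, ⁅x, v⁆ ∈ S := by
    intro x
    have hx : x ∈ ⨆ χ : H → ℂ, hwt H L χ := by rw [hwt_top]; trivial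
    induction hx using Submodule.iSup_induction' with
    | mem χ x hx =>
      by_cases hχ : χ = 0
      · subst hχ
        have hxH := hwt_zero x hx
        rw [hv ⟨x, hxH⟩]
        exact S.smul_mem _ hvS
      · by_cases hx0 : x = 0
        · simp [hx0]
        · obtain ⟨μ, hμ, rfl⟩ := hroots2 χ hχ
            (fun h => hx0 (by rw [h] at hx; simpa using hx))
          by_cases hp : μ ∈ Δp
          · rw [hvp μ hp x hx]; exact zero_mem _
          · have hn : -μ ∈ Δp := by
              by_contra hn; exact hp ((hpm μ hμ).mpr hn)
            exact hfS (-μ) hn x (by simpa using hx) v hvS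
    | zero => simp
    | add a b _ _ ha hb => rw [add_lie]; exact add_mem ha hb
  have hall : ∀ w, Wd H e Δp v w → ∀ x : L, ⁅x, w⁆ ∈ S := by
    intro w hw
    induction hw with
    | base => exact hbase
    | step w α f _ hα hf ih =>
      intro x
      rw [leibniz_lie]
      exact add_mem (ih _) (hfS α hα f hf _ (ih x))
  let N : LieSubmodule ℂ L M :=
    { S with
      lie_mem := by
        intro x m hm
        change m ∈ S at hm
        change ⁅x, m⁆ ∈ S
        induction hm using Submodule.span_induction with
        | mem w hw => exact hall w hw x
        | zero => simp
        | add a b _ _ ha hb => rw [lie_add]; exact add_mem ha hb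
        | smul c a _ ha => rw [lie_smul]; exact S.smul_mem c ha }
  have hN : N = ⊤ := by
    rcases hMsimple N with h | h
    · exfalso
      have : v ∈ N := hvS
      rw [h] at this
      exact hv0 (by simpa using this)
    · exact h
  have hST : S = ⊤ := by
    rw [eq_top_iff]
    intro m _
    have : m ∈ N := by rw [hN]; trivial
    exact this
  by_contra hcon
  push Not at hcon
  have hd := hwt_indep (H := H) (M := M) (e β)
  have htop : (⨆ χ, ⨆ (_ : χ ≠ e β), hwt H M χ) = ⊤ := by
    rw [eq_top_iff, ← hST, hS, Submodule.span_le]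
    intro w hw
    obtain ⟨c, hc, hwc⟩ := Wd.weight hv hw
    have hne : e (θ - c) ≠ e β := fun h => hcon c hc (heinj h).symm
    exact (le_iSup₂_of_le (f := fun χ (_ : χ ≠ e β) => hwt H M χ) (e (θ - c)) hne le_rfl) hwc
  rw [htop] at hd
  exact hβ (disjoint_top.mp hd)

lemma pairing (Δ : Set E) (hfin : Δ.Finite) (h0 : (0 : E) ∉ Δ)
    (hrefl : ∀ α ∈ Δ, ∀ β ∈ Δ, rrefl α β ∈ Δ)
    (hcrys : ∀ α ∈ Δ, ∀ β ∈ Δ, ∃ n : ℤ, 2 * ⟪β, α⟫ / ⟪α, α⟫ = (n : ℝ))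
    (e : E →+ (H → ℂ)) (heinj : Function.Injective e)
    (hroots1 : ∀ μ ∈ Δ, hwt H L (e μ) ≠ ⊥)
    (hroots2 : ∀ χ : H → ℂ, χ ≠ 0 → hwt H L χ ≠ ⊥ → ∃ μ ∈ Δ, χ = e μ)
    (α : E) (hα : α ∈ Δ) :
    ∃ (h : H) (x f : L), IsSl2Triple (h : L) x f ∧ x ∈ hwt H L (e α) ∧ f ∈ hwt H L (e (-α)) ∧
      ∀ β ∈ Δ, ∃ n : ℤ, e β h = n ∧ 2 * ⟪β, α⟫ / ⟪α, α⟫ = (n : ℝ) := by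
  have hne : ∀ β ∈ Δ, e β ≠ 0 := by
    intro β hβ h
    rw [← map_zero e] at h
    exact h0 (heinj h ▸ hβ)
  obtain ⟨h, x, f, t, hx, hf, h2, hr⟩ := root_data (hne α hα) (hroots1 α hα)
  refine ⟨h, x, f, t, hx, by simpa using hf, ?_⟩
  let φ : E →+ ℂ := (Pi.evalAddMonoidHom (fun _ : H => ℂ) h).comp e
  refine coroot_unique Δ hfin hrefl hcrys α hα (fun h => h0 (h ▸ hα)) φ h2 ?_
  intro β hβ
  obtain ⟨n, hn, hn0, hnb⟩ := hr (e β) (hne β hβ) (hroots1 β hβ)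
  obtain ⟨ν, hν, hν'⟩ := hroots2 _ hn0 hnb
  refine ⟨n, hn, ?_⟩
  rw [← map_zsmul, ← map_sub] at hν'
  rw [heinj hν']
  exact hν

lemma exists_height (Δp Φ : Set E) (h0 : (0 : E) ∉ Δp)
    (hΦind : LinearIndependent ℝ (fun a : Φ => (a : E)))
    (hΦdec : ∀ γ ∈ Δp, ∃ c : E →₀ ℕ, ↑c.support ⊆ Φ ∧ γ = c.sum fun α n => (n : ℝ) • α) :
    ∃ ht : E →ₗ[ℝ] ℝ, ∀ α ∈ Δp, 0 < ht α := by
  have hli : LinearIndepOn ℝ id Φ := hΦind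
  let b := Module.Basis.extend hli
  let ht : E →ₗ[ℝ] ℝ := b.constr ℝ (fun _ => (1 : ℝ))
  have h1 : ∀ a ∈ Φ, ht a = 1 := by
    intro a ha
    have := b.constr_basis ℝ (fun _ => (1 : ℝ)) ⟨a, hli.subset_extend _ ha⟩
    simpa [b, ht] using this
  refine ⟨ht, fun γ hγ => ?_⟩
  obtain ⟨c, hc, hγc⟩ := hΦdec γ hγ
  have hval : ht γ = ∑ a ∈ c.support, (c a : ℝ) := by
    rw [hγc, Finsupp.sum, map_sum]
    refine Finset.sum_congr rfl fun a ha => ?_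
    rw [map_smul, h1 a (hc ha), smul_eq_mul, mul_one]
  rw [hval]
  refine Finset.sum_pos (fun a ha => ?_) ?_
  · exact_mod_cast Nat.pos_of_ne_zero (Finsupp.mem_support_iff.mp ha)
  · rw [Finset.nonempty_iff_ne_empty]
    intro hemp
    rw [Finsupp.support_eq_empty] at hemp
    rw [hemp, Finsupp.sum_zero_index] at hγc
    exact h0 (hγc ▸ hγ)

lemma no_long [FiniteDimensional ℂ M] (Δ Δp Φ : Set E) (hfin : Δ.Finite) (h0 : (0 : E) ∉ Δ)
    (hrefl : ∀ α ∈ Δ, ∀ β ∈ Δ, rrefl α β ∈ Δ)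
    (hcrys : ∀ α ∈ Δ, ∀ β ∈ Δ, ∃ n : ℤ, 2 * ⟪β, α⟫ / ⟪α, α⟫ = (n : ℝ))
    (ls ll : ℝ) (h0ls : 0 < ls) (hlsll : ls < ll)
    (hΔpΔ : Δp ⊆ Δ) (hpm : ∀ α ∈ Δ, α ∈ Δp ↔ -α ∉ Δp)
    (hΦind : LinearIndependent ℝ (fun a : Φ => (a : E)))
    (hΦdec : ∀ γ ∈ Δp, ∃ c : E →₀ ℕ, ↑c.support ⊆ Φ ∧ γ = c.sum fun α n => (n : ℝ) • α)
    (e : E →+ (H → ℂ)) (heinj : Function.Injective e)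
    (hroots1 : ∀ μ ∈ Δ, hwt H L (e μ) ≠ ⊥)
    (hroots2 : ∀ χ : H → ℂ, χ ≠ 0 → hwt H L χ ≠ ⊥ → ∃ μ ∈ Δ, χ = e μ)
    (hMsimple : ∀ N : LieSubmodule ℂ L M, N = ⊥ ∨ N = ⊤)
    (θ : E) (hθ : ‖θ‖ = ls) (v : M) (hv0 : v ≠ 0) (hv : v ∈ hwt H M (e θ))
    (hvp : ∀ γ ∈ Δp, ∀ x ∈ hwt H L (e γ), ⁅x, v⁆ = 0)
    (β : E) (hβ : β ∈ Δ) (hβl : ‖β‖ = ll) : hwt H M (e β) = ⊥ := by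
  by_contra hβb
  obtain ⟨ht, hht⟩ := exists_height Δp Φ (fun h => h0 (hΔpΔ h)) hΦind hΦdec
  let B : Set E := {β | β ∈ Δ ∧ ‖β‖ = ll ∧ hwt H M (e β) ≠ ⊥}
  have hBfin : B.Finite := hfin.subset fun β hβ => hβ.1
  obtain ⟨β, ⟨hβ, hβl, hβb⟩, hmax⟩ := Set.exists_max_image B ht hBfin ⟨β, hβ, hβl, hβb⟩
  have hdom : ∀ α ∈ Δp, 0 ≤ ⟪α, β⟫ := by
    intro α hα
    by_contra hneg
    push Not at hneg
    have hαΔ := hΔpΔ hα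
    obtain ⟨h, x, f, t, hx, hf, hpair⟩ :=
      pairing Δ hfin h0 hrefl hcrys e heinj hroots1 hroots2 α hαΔ
    obtain ⟨n, hn1, hn2⟩ := hpair β hβ
    have hαα : 0 < ⟪α, α⟫ := real_inner_self_pos.mpr fun h => h0 (h ▸ hαΔ)
    have hnneg : (n : ℝ) < 0 := by
      rw [← hn2, real_inner_comm]
      exact div_neg_of_neg_of_pos (by linarith) hαα
    have hnneg' : n < 0 := by exact_mod_cast hnneg
    obtain ⟨m, hm⟩ : ∃ m : ℕ, n = -(m : ℤ) := ⟨n.natAbs, by omega⟩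
    have hmpos : 0 < m := by omega
    obtain ⟨w, hw, hw0⟩ := (Submodule.ne_bot_iff _).mp hβb
    obtain ⟨k, hk⟩ := sl2_refl t hw0 m (by rw [hw h, hn1, hm]; push_cast; rfl)
    have hmem := pow_mem_hwt hx (pow_mem_hwt hf hw k) (m + k)
    rw [← map_nsmul, ← map_nsmul, ← map_add, ← map_add] at hmem
    have heq : (m + k) • α + (k • (-α) + β) = rrefl α β := by
      rw [rrefl_apply, hn2, hm, Int.cast_smul_eq_zsmul]
      module
    rw [heq] at hmem
    have hB : rrefl α β ∈ B := ⟨hrefl α hαΔ β hβ, by rw [LinearIsometryEquiv.norm_map, hβl],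
      (Submodule.ne_bot_iff _).mpr ⟨_, hmem, hk⟩⟩
    have h1 := hmax _ hB
    rw [rrefl_apply, hn2, map_sub, map_smul, smul_eq_mul] at h1
    have := mul_neg_of_neg_of_pos hnneg (hht α hα)
    linarith
  obtain ⟨c, hc, hβc⟩ := weights_cone Δ Δp hpm e heinj hroots2 hMsimple θ v hv0 hv hvp β hβb
  have hcβ : 0 ≤ ⟪c, β⟫ := by
    clear hβc
    induction hc using AddSubmonoid.closure_induction with
    | mem a ha => exact hdom a ha
    | zero => simp
    | add a b _ _ ha hb => rw [inner_add_left]; exact add_nonneg ha hb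
  have h1 : c = θ - β := by rw [hβc]; abel
  rw [h1, inner_sub_left, real_inner_self_eq_norm_sq, hβl] at hcβ
  have h2 := real_inner_le_norm θ β
  rw [hθ, hβl] at h2
  nlinarith

lemma half [FiniteDimensional ℂ M] (Δ : Set E) (hfin : Δ.Finite) (h0 : (0 : E) ∉ Δ)
    (hrefl : ∀ α ∈ Δ, ∀ β ∈ Δ, rrefl α β ∈ Δ)
    (hcrys : ∀ α ∈ Δ, ∀ β ∈ Δ, ∃ n : ℤ, 2 * ⟪β, α⟫ / ⟪α, α⟫ = (n : ℝ))
    (ls ll : ℝ) (h0ls : 0 < ls) (hlsll : ls < ll) (hle : ∀ α ∈ Δ, ‖α‖ ≤ ll)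
    (e : E →+ (H → ℂ)) (heinj : Function.Injective e)
    (hroots1 : ∀ μ ∈ Δ, hwt H L (e μ) ≠ ⊥)
    (hroots2 : ∀ χ : H → ℂ, χ ≠ 0 → hwt H L χ ≠ ⊥ → ∃ μ ∈ Δ, χ = e μ)
    (hlong : ∀ β ∈ Δ, ‖β‖ = ll → hwt H M (e β) = ⊥)
    (γ μ : E) (hγ : γ ∈ Δ) (hγs : ‖γ‖ = ls) (hμ : μ ∈ Δ) (hμs : ‖μ‖ = ls)
    (hd : γ - μ ∈ Δ) (hdl : ‖γ - μ‖ = ll)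
    (x y : L) (hx : x ∈ hwt H L (e γ))
    (hy : y ∈ hwt H L (e μ)) (hy0 : y ≠ 0) (v : M) (hv : v ∈ hwt H M 0) (hyv : ⁅y, v⁆ = 0) :
    ⁅x, v⁆ = 0 := by
  obtain ⟨h, p, f, t, hp, hf, hpair⟩ :=
    pairing Δ hfin h0 hrefl hcrys e heinj hroots1 hroots2 (γ - μ) hd
  obtain ⟨n, hn1, hn2⟩ := hpair γ hγ
  have hin : 2 * ⟪γ, γ - μ⟫ = ll ^ 2 := by
    have h1 := norm_sub_sq_real γ (γ - μ)
    rw [sub_sub_cancel, hγs, hμs, hdl] at h1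
    linarith
  have hn0 : (n : ℂ) ≠ 0 := by
    have : (n : ℝ) ≠ 0 := by
      rw [← hn2, hin, real_inner_self_eq_norm_sq, hdl]
      have : ll ≠ 0 := by linarith
      positivity
    exact_mod_cast this
  have hbig : ll < ‖(γ - μ) + γ‖ := by
    have h1 := norm_add_sq_real (γ - μ) γ
    rw [real_inner_comm, hin, hγs, hdl] at h1
    refine lt_of_pow_lt_pow_left₀ 2 (norm_nonneg _) ?_
    nlinarith
  have hpx : ⁅p, x⁆ = 0 := by
    by_contra hne
    have hmem := lie_mem_hwt hp hx
    rw [← map_add] at hmem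
    obtain ⟨ν, hν, hν'⟩ := hroots2 _ (fun h => by
      rw [← map_zero e] at h
      rw [heinj h, norm_zero] at hbig
      linarith) ((Submodule.ne_bot_iff _).mpr ⟨_, hmem, hne⟩)
    rw [heinj hν'] at hbig
    exact absurd (hle ν hν) (not_le.mpr hbig)
  have hfx := lie_mem_hwt hf hx
  rw [← map_add, neg_sub, sub_add_cancel] at hfx
  obtain ⟨c, hc⟩ := hwt_one (fun h => by
      rw [← map_zero e] at h
      exact h0 (heinj h ▸ hμ)) hy hy0 hfx
  have hpv : ⁅p, v⁆ = 0 := by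
    have := lie_mem_hwt hp hv
    rw [add_zero, hlong _ hd hdl] at this
    simpa using this
  have hkey : ⁅p, ⁅f, x⁆⁆ = (n : ℂ) • x := by
    rw [leibniz_lie, t.lie_e_f, hpx, lie_zero, add_zero, hx h, hn1]
  have hfin : (n : ℂ) • ⁅x, v⁆ = 0 := by
    rw [← smul_lie, ← hkey, ← hc, lie_lie, hpv, smul_lie, hyv]
    simp
  exact (smul_eq_zero.mp hfin).resolve_left hn0
end Main
end St14

/-- If `γ` and `μ` are short roots such that `γ − μ` is a long root, then
the hyperplanes `H_γ` and `H_μ` in `V⁰` coincide. -/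
theorem statement14
    {E : Type} [NormedAddCommGroup E] [InnerProductSpace ℝ E] [FiniteDimensional ℝ E]
    (Δ Δs Δl Δp Φ Φs : Set E)
    -- `Δ` is a reduced crystallographic root system in `E`
    (hfin : Δ.Finite) (h0 : (0 : E) ∉ Δ)
    (hspan : Submodule.span ℝ Δ = ⊤)
    (hrefl : ∀ α ∈ Δ, ∀ β ∈ Δ, rrefl α β ∈ Δ)
    (hcrys : ∀ α ∈ Δ, ∀ β ∈ Δ, ∃ n : ℤ, 2 * ⟪β, α⟫ / ⟪α, α⟫ = (n : ℝ))
    (hred : ∀ α ∈ Δ, ∀ t : ℝ, t • α ∈ Δ → t = 1 ∨ t = -1)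
    -- irreducible
    (hirr : ∀ A B : Set E, A ∪ B = Δ → (∀ a ∈ A, ∀ b ∈ B, ⟪a, b⟫ = 0) → A = ∅ ∨ B = ∅)
    -- two root lengths: `Δs` are the short roots, `Δl` the long ones
    (ls ll : ℝ) (h0ls : 0 < ls) (hlsll : ls < ll)
    (hΔs : Δs = {α ∈ Δ | ‖α‖ = ls}) (hΔl : Δl = {α ∈ Δ | ‖α‖ = ll})
    (hcover : Δ = Δs ∪ Δl) (hsne : Δs.Nonempty) (hlne : Δl.Nonempty)
    -- `Δp` is a positive system with simple roots `Φ`; `Φs = Φ ∩ Δs`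
    (hΔpΔ : Δp ⊆ Δ) (hpm : ∀ α ∈ Δ, α ∈ Δp ↔ -α ∉ Δp)
    (hΦp : Φ ⊆ Δp)
    (hΦind : LinearIndependent ℝ (fun a : Φ => (a : E)))
    (hΦdec : ∀ γ ∈ Δp, ∃ c : E →₀ ℕ, ↑c.support ⊆ Φ ∧ γ = c.sum fun α n => (n : ℝ) • α)
    (hΦs : Φs = Φ ∩ Δs)
    -- `θs` is the highest short root
    (θs : E) (hθsmem : θs ∈ Δs ∩ Δp)
    (hθshigh : ∀ γ ∈ Δs, ∃ c : E →₀ ℝ, ↑c.support ⊆ Φ ∧ (∀ α, 0 ≤ c α) ∧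
      θs - γ = c.sum fun α t => t • α)
    -- `L` is a complex simple Lie algebra with Cartan subalgebra `H`, whose root system
    -- is identified with `Δ` via `e`
    (L : Type) [LieRing L] [LieAlgebra ℂ L] [FiniteDimensional ℂ L]
    [LieAlgebra.IsSimple ℂ L]
    (H : LieSubalgebra ℂ L) [H.IsCartanSubalgebra]
    (e : E → H → ℂ)
    (headd : ∀ a b : E, e (a + b) = e a + e b)
    (heinj : Function.Injective e)
    (hroots1 : ∀ μ ∈ Δ, hwt H L (e μ) ≠ ⊥)
    (hroots2 : ∀ χ : H → ℂ, χ ≠ 0 → hwt H L χ ≠ ⊥ → ∃ μ ∈ Δ, χ = e μ)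
    -- `M` is the little adjoint module `V_{θs}`: the (finite-dimensional) simple
    -- `L`-module with highest weight `θs`
    (M : Type) [AddCommGroup M] [Module ℂ M] [LieRingModule L M] [LieModule ℂ L M]
    [FiniteDimensional ℂ M] [Nontrivial M]
    (hMsimple : ∀ N : LieSubmodule ℂ L M, N = ⊥ ∨ N = ⊤)
    (hhw : ∃ v : M, v ≠ 0 ∧ v ∈ hwt H M (e θs) ∧
      ∀ γ ∈ Δp, ∀ x ∈ hwt H L (e γ), ⁅x, v⁆ = 0)
    (γ μ : E) (hγ : γ ∈ Δs) (hμ : μ ∈ Δs) (hdiff : γ - μ ∈ Δl)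
    (x y : L) (hx : x ∈ hwt H L (e γ)) (hx0 : x ≠ 0)
    (hy : y ∈ hwt H L (e μ)) (hy0 : y ≠ 0) :
    hwt H M (0 : H → ℂ) ⊓ LinearMap.ker (adm L M x) =
      hwt H M (0 : H → ℂ) ⊓ LinearMap.ker (adm L M y) := by
  subst hΔs hΔl
  let e' : E →+ (H → ℂ) := AddMonoidHom.mk' e headd
  obtain ⟨v, hv0, hv, hvp⟩ := hhw
  have hle : ∀ α ∈ Δ, ‖α‖ ≤ ll := by
    intro α hα
    rw [hcover] at hα
    rcases hα with h | h
    · rw [h.2]; exact hlsll.le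
    · rw [h.2]
  have hlong : ∀ β ∈ Δ, ‖β‖ = ll → hwt H M (e' β) = ⊥ := fun β hβ hβl =>
    St14.no_long Δ Δp Φ hfin h0 hrefl hcrys ls ll h0ls hlsll hΔpΔ hpm hΦind hΦdec e' heinj
      hroots1 hroots2 hMsimple θs hθsmem.1.2 v hv0 hv hvp β hβ hβl
  have hneg : μ - γ ∈ Δ := by
    have h1 := hrefl _ hdiff.1 _ hdiff.1
    rwa [rrefl, Submodule.reflection_orthogonalComplement_singleton_eq_neg, neg_sub] at h1
  ext w
  constructor
  · rintro ⟨hw, hk⟩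
    exact ⟨hw, St14.half Δ hfin h0 hrefl hcrys ls ll h0ls hlsll hle e' heinj hroots1 hroots2 hlong
      μ γ hμ.1 hμ.2 hγ.1 hγ.2 hneg (by rw [norm_sub_rev]; exact hdiff.2) y x hy hx hx0 w hw hk⟩
  · rintro ⟨hw, hk⟩
    exact ⟨hw, St14.half Δ hfin h0 hrefl hcrys ls ll h0ls hlsll hle e' heinj hroots1 hroots2 hlong
      γ μ hγ.1 hγ.2 hμ.1 hμ.2 hdiff.1 hdiff.2 x y hx hy hy0 w hw hk⟩
end

section
/- The subspace V_{θ_s}^0 ⊕ (⊕_{μ ∈ Δ(Π_s)} V_{θ_s}^μ) of the little adjoint module is a 𝔤(Π_s)-submodule isomorphic to the adjoint module of 𝔤(Π_s); moreover, any other simple 𝔤(Π_s)-submodule of V_{θ_s} intersects V_{θ_s}^0 trivially. -/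
open scoped RealInnerProductSpace

/-- Cartan number. -/
noncomputable def crn {E : Type} [NormedAddCommGroup E] [InnerProductSpace ℝ E] (β α : E) : ℝ :=
  2 * ⟪β, α⟫ / ⟪α, α⟫

/-- Reflection by formula. -/
noncomputable def srf {E : Type} [NormedAddCommGroup E] [InnerProductSpace ℝ E] (α β : E) : E :=
  β - crn β α • α

lemma rrefl_eq_srf {E : Type} [NormedAddCommGroup E] [InnerProductSpace ℝ E]
    [FiniteDimensional ℝ E] (α β : E) : rrefl α β = srf α β := by
  unfold rrefl srf crn
  rw [Submodule.reflection_orthogonal_apply, Submodule.reflection_singleton_apply]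
  rw [real_inner_comm, real_inner_self_eq_norm_sq, neg_sub]
  congr 1
  rw [mul_div_assoc, ← smul_smul, two_smul, two_smul]
  rfl

/-- The bundled hypotheses on the root system. -/
structure RSys {E : Type} [NormedAddCommGroup E] [InnerProductSpace ℝ E] [FiniteDimensional ℝ E]
    (Δ Δs Δl Δp Φ Φs : Set E) (ls ll : ℝ) (θs : E) : Prop where
  fin : Δ.Finite
  h0 : (0 : E) ∉ Δ
  span : Submodule.span ℝ Δ = ⊤
  refl : ∀ α ∈ Δ, ∀ β ∈ Δ, srf α β ∈ Δ
  crys : ∀ α ∈ Δ, ∀ β ∈ Δ, ∃ n : ℤ, crn β α = (n : ℝ)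
  red : ∀ α ∈ Δ, ∀ t : ℝ, t • α ∈ Δ → t = 1 ∨ t = -1
  irr : ∀ A B : Set E, A ∪ B = Δ → (∀ a ∈ A, ∀ b ∈ B, ⟪a, b⟫ = 0) → A = ∅ ∨ B = ∅
  h0ls : 0 < ls
  hlsll : ls < ll
  hΔs : Δs = {α ∈ Δ | ‖α‖ = ls}
  hΔl : Δl = {α ∈ Δ | ‖α‖ = ll}
  cover : Δ = Δs ∪ Δl
  ΔpΔ : Δp ⊆ Δ
  pm : ∀ α ∈ Δ, α ∈ Δp ↔ -α ∉ Δp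
  Φp : Φ ⊆ Δp
  ind : LinearIndependent ℝ (fun a : Φ => (a : E))
  dec : ∀ γ ∈ Δp, ∃ c : E →₀ ℕ, ↑c.support ⊆ Φ ∧ γ = c.sum fun α n => (n : ℝ) • α
  hΦs : Φs = Φ ∩ Δs
  θmem : θs ∈ Δs ∩ Δp
  θhigh : ∀ γ ∈ Δs, ∃ c : E →₀ ℝ, ↑c.support ⊆ Φ ∧ (∀ α, 0 ≤ c α) ∧
      θs - γ = c.sum fun α t => t • α

section basic
variable {E : Type} [NormedAddCommGroup E] [InnerProductSpace ℝ E]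

lemma crn_add (a b α : E) : crn (a + b) α = crn a α + crn b α := by
  unfold crn; rw [inner_add_left]; ring
lemma crn_sub (a b α : E) : crn (a - b) α = crn a α - crn b α := by
  unfold crn; rw [inner_sub_left]; ring
lemma crn_neg (a α : E) : crn (-a) α = - crn a α := by
  unfold crn; rw [inner_neg_left]; ring
lemma crn_smul (t : ℝ) (a α : E) : crn (t • a) α = t * crn a α := by
  unfold crn; rw [real_inner_smul_left]; ring
lemma crn_zero (α : E) : crn 0 α = 0 := by simp [crn]
lemma crn_self {α : E} (h : α ≠ 0) : crn α α = 2 := by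
  unfold crn
  have : ⟪α, α⟫ ≠ 0 := inner_self_ne_zero.mpr h
  field_simp
lemma inner_pos {α : E} (h : α ≠ 0) : 0 < ⟪α, α⟫ := real_inner_self_pos.mpr h
lemma crn_mul {α : E} (h : α ≠ 0) (β : E) : crn β α * ⟪α, α⟫ = 2 * ⟪β, α⟫ := by
  unfold crn
  have : ⟪α, α⟫ ≠ 0 := inner_self_ne_zero.mpr h
  field_simp
lemma crn_neg_iff {α : E} (h : α ≠ 0) (β : E) : crn β α < 0 ↔ ⟪β, α⟫ < 0 := by
  have h1 := crn_mul h β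
  have h2 := inner_pos h
  constructor
  · intro h3; nlinarith
  · intro h3; by_contra h4; push Not at h4; nlinarith
lemma crn_pos_iff {α : E} (h : α ≠ 0) (β : E) : 0 < crn β α ↔ 0 < ⟪β, α⟫ := by
  have h1 := crn_mul h β
  have h2 := inner_pos h
  constructor
  · intro h3; nlinarith
  · intro h3; by_contra h4; push Not at h4; nlinarith
lemma srf_neg (α β : E) : srf α (-β) = - srf α β := by
  unfold srf; rw [crn_neg]; module
lemma srf_self {α : E} (h : α ≠ 0) : srf α α = -α := by
  unfold srf; rw [crn_self h]; module
lemma srf_srf {α : E} (h : α ≠ 0) (β : E) : srf α (srf α β) = β := by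
  unfold srf; rw [crn_sub, crn_smul, crn_self h]; module
lemma inner_srf {α : E} (h : α ≠ 0) (β : E) : ⟪srf α β, srf α β⟫ = ⟪β, β⟫ := by
  unfold srf
  have h1 := crn_mul h β
  simp only [inner_sub_left, inner_sub_right, real_inner_smul_left, real_inner_smul_right]
  rw [real_inner_comm β α] 
  linear_combination (crn β α) * h1
lemma norm_srf {α : E} (h : α ≠ 0) (β : E) : ‖srf α β‖ = ‖β‖ := by
  have := inner_srf h β
  rw [real_inner_self_eq_norm_sq, real_inner_self_eq_norm_sq] at this
  exact (pow_left_inj₀ (norm_nonneg _) (norm_nonneg _) two_ne_zero).mp this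
end basic

namespace RSys
variable {E : Type} [NormedAddCommGroup E] [InnerProductSpace ℝ E] [FiniteDimensional ℝ E]
    {Δ Δs Δl Δp Φ Φs : Set E} {ls ll : ℝ} {θs : E} (R : RSys Δ Δs Δl Δp Φ Φs ls ll θs)
include R

lemma ne0 {α : E} (h : α ∈ Δ) : α ≠ 0 := fun h' => R.h0 (h' ▸ h)

lemma neg {α : E} (h : α ∈ Δ) : -α ∈ Δ := by
  have := R.refl α h α h
  rwa [srf_self (R.ne0 h)] at this

lemma ΦΔ : Φ ⊆ Δ := R.Φp.trans R.ΔpΔ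
lemma ΦsΦ : Φs ⊆ Φ := by rw [R.hΦs]; exact Set.inter_subset_left
lemma ΦsΔ : Φs ⊆ Δ := R.ΦsΦ.trans R.ΦΔ

lemma short_norm {a : E} (h : a ∈ Δs) : ‖a‖ = ls := by rw [R.hΔs] at h; exact h.2
lemma long_norm {a : E} (h : a ∈ Δl) : ‖a‖ = ll := by rw [R.hΔl] at h; exact h.2
lemma ΔsΔ : Δs ⊆ Δ := by rw [R.hΔs]; exact fun x hx => hx.1
lemma ΔlΔ : Δl ⊆ Δ := by rw [R.hΔl]; exact fun x hx => hx.1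
lemma norm_ge {a : E} (h : a ∈ Δ) : ls ≤ ‖a‖ := by
  rw [R.cover] at h
  rcases h with h | h
  · rw [R.short_norm h]
  · rw [R.long_norm h]; exact R.hlsll.le

lemma add_root {α β : E} (hα : α ∈ Δ) (hβ : β ∈ Δ) (h : ⟪α, β⟫ < 0) : α + β = 0 ∨ α + β ∈ Δ := by
  obtain ⟨n, hn⟩ := R.crys α hα β hβ
  obtain ⟨m, hm⟩ := R.crys β hβ α hα
  have hα0 := R.ne0 hα
  have hβ0 := R.ne0 hβ
  have n1 : crn β α < 0 := (crn_neg_iff hα0 β).2 (by rwa [real_inner_comm])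
  have m1 : crn α β < 0 := (crn_neg_iff hβ0 α).2 h
  have e1 := crn_mul hα0 β
  have e2 := crn_mul hβ0 α
  have pa := inner_pos hα0
  have pb := inner_pos hβ0
  have cs := real_inner_mul_inner_self_le α β
  rw [real_inner_comm α β] at e1
  have prod : crn β α * crn α β ≤ 4 := by
    have : (crn β α * crn α β) * (⟪α, α⟫ * ⟪β, β⟫) = 4 * (⟪α, β⟫ * ⟪α, β⟫) := by
      linear_combination crn α β * ⟪β, β⟫ * e1 + 2 * ⟪α, β⟫ * e2
    by_contra hc
    push Not at hc
    nlinarith [mul_pos pa pb]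
  have s1 := R.refl α hα β hβ
  have s2 := R.refl β hβ α hα
  unfold srf at s1 s2
  rw [hn] at n1 e1 prod s1
  rw [hm] at m1 e2 prod s2
  have n2 : n < 0 := by exact_mod_cast n1
  have m2 : m < 0 := by exact_mod_cast m1
  have p2 : n * m ≤ 4 := by exact_mod_cast prod
  by_cases hn1 : n = -1
  · right; rw [hn1] at s1; convert s1 using 1; push_cast; module
  by_cases hm1 : m = -1
  · right; rw [hm1] at s2; convert s2 using 1; push_cast; module
  left
  have hn3 : n = -2 := by nlinarith [show n ≤ -2 by omega, show m ≤ -2 by omega]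
  have hm3 : m = -2 := by nlinarith [show n ≤ -2 by omega, show m ≤ -2 by omega]
  rw [hn3] at e1; rw [hm3] at e2
  push_cast at e1 e2
  rw [← inner_self_eq_zero (𝕜 := ℝ), inner_add_left, inner_add_right, inner_add_right,
    real_inner_comm α β]
  linarith

lemma sub_root {α β : E} (hα : α ∈ Δ) (hβ : β ∈ Δ) (h : 0 < ⟪α, β⟫) : α = β ∨ α - β ∈ Δ := by
  have := R.add_root hα (R.neg hβ) (by rw [inner_neg_right]; linarith)
  rwa [← sub_eq_add_neg, sub_eq_zero] at this

/-- Sum-of-list of roots. -/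
lemma exists_list {x : E} (hx : x ∈ AddSubgroup.closure Δ) :
    ∃ l : List E, (∀ a ∈ l, a ∈ Δ) ∧ l.sum = x := by
  induction hx using AddSubgroup.closure_induction with
  | mem x hx => exact ⟨[x], by simpa using hx, by simp⟩
  | zero => exact ⟨[], by simp, rfl⟩
  | add x y _ _ h1 h2 =>
    obtain ⟨l1, a1, b1⟩ := h1
    obtain ⟨l2, a2, b2⟩ := h2
    refine ⟨l1 ++ l2, ?_, by simp [b1, b2]⟩
    intro a ha
    rcases List.mem_append.1 ha with h | h
    exacts [a1 a h, a2 a h]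
  | neg x _ h1 =>
    obtain ⟨l1, a1, b1⟩ := h1
    refine ⟨l1.map (fun a => -a), ?_, ?_⟩
    · intro a ha
      obtain ⟨b, hb, rfl⟩ := List.mem_map.1 ha
      exact R.neg (a1 b hb)
    · rw [← b1]; exact (List.sum_neg l1).symm

lemma list_norm (l : List E) (h1 : ∀ a ∈ l, a ∈ Δ) (h2 : l.Pairwise (fun a b => 0 ≤ ⟪a, b⟫)) :
    (l.length : ℝ) * ls ^ 2 ≤ ⟪l.sum, l.sum⟫ := by
  induction l with
  | nil => simp
  | cons a l ih =>
    rw [List.pairwise_cons] at h2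
    have ih' := ih (fun b hb => h1 b (List.mem_cons_of_mem _ hb)) h2.2
    have h3 : 0 ≤ ⟪a, l.sum⟫ := by
      have : ∀ l : List E, (∀ b ∈ l, 0 ≤ ⟪a, b⟫) → 0 ≤ ⟪a, l.sum⟫ := by
        intro l hl
        induction l with
        | nil => simp
        | cons b l ih2 =>
          rw [List.sum_cons, inner_add_right]
          have := hl b (by simp)
          have := ih2 (fun c hc => hl c (List.mem_cons_of_mem _ hc))
          linarith
      exact this l h2.1
    have h4 := R.norm_ge (h1 a (by simp))
    rw [List.sum_cons, inner_add_left, inner_add_right, inner_add_right, real_inner_comm a l.sum,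
      real_inner_self_eq_norm_sq a]
    have := R.h0ls
    simp only [List.length_cons]; push_cast
    nlinarith

lemma short_lattice {x : E} (hx : x ∈ AddSubgroup.closure Δ) (hn : ‖x‖ ≤ ls) :
    x = 0 ∨ x ∈ Δs := by
  classical
  let P : ℕ → Prop := fun n => ∃ l : List E, (∀ a ∈ l, a ∈ Δ) ∧ l.sum = x ∧ l.length = n
  have hP : ∃ n, P n := by
    obtain ⟨l, h1, h2⟩ := R.exists_list hx
    exact ⟨_, l, h1, h2, rfl⟩
  obtain ⟨l, h1, h2, h3⟩ := Nat.find_spec hP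
  have hmin : ∀ l' : List E, (∀ a ∈ l', a ∈ Δ) → l'.sum = x → l.length ≤ l'.length := by
    intro l' a b
    rw [h3]
    exact Nat.find_min' hP ⟨l', a, b, rfl⟩
  have hpw : l.Pairwise (fun a b => 0 ≤ ⟪a, b⟫) := by
    rw [List.pairwise_iff_forall_sublist]
    intro a b hab
    by_contra hc
    push Not at hc
    obtain ⟨l', hl'⟩ := hab.exists_perm_append
    have hl'' : ∀ c ∈ l', c ∈ Δ := fun c hc => h1 c (hl'.symm.subset (by simp [hc]))
    have hs : a + b + l'.sum = x := by rw [← h2, hl'.sum_eq]; simp [add_assoc]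
    have hlen := hl'.length_eq
    simp at hlen
    rcases R.add_root (h1 a (hab.subset (by simp))) (h1 b (hab.subset (by simp))) hc with h | h
    · have := hmin l' hl'' (by rw [← hs, h, zero_add])
      omega
    · have := hmin ((a + b) :: l') (by
        intro c hc
        rcases List.mem_cons.1 hc with h | h
        · rw [h]; assumption
        · exact hl'' c h) (by rw [List.sum_cons, hs])
      simp at this
      omega
  have key := R.list_norm l h1 hpw
  rw [h2, real_inner_self_eq_norm_sq] at key
  have hl := R.h0ls
  have : (l.length : ℝ) ≤ 1 := by
    by_contra hc; push Not at hc
    nlinarith [norm_nonneg x, mul_pos hl hl]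
  have : l.length ≤ 1 := by exact_mod_cast this
  match l, h1, h2, this with
  | [], _, h2, _ => left; simpa using h2.symm
  | [a], h1, h2, _ =>
    right
    simp at h1 h2
    subst h2
    rw [R.hΔs]
    exact ⟨h1, le_antisymm hn (R.norm_ge h1)⟩
end RSys


namespace RSys
variable {E : Type} [NormedAddCommGroup E] [InnerProductSpace ℝ E] [FiniteDimensional ℝ E]
    {Δ Δs Δl Δp Φ Φs : Set E} {ls ll : ℝ} {θs : E} (R : RSys Δ Δs Δl Δp Φ Φs ls ll θs)
include R

lemma Δ_cases {γ : E} (h : γ ∈ Δ) : γ ∈ Δp ∨ -γ ∈ Δp := by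
  by_cases h1 : γ ∈ Δp
  · exact Or.inl h1
  · right
    have := R.pm (-γ) (R.neg h)
    rw [neg_neg] at this
    exact this.2 h1

lemma spanΦ : ⊤ ≤ Submodule.span ℝ (Set.range (fun a : Φ => (a : E))) := by
  rw [← R.span, Subtype.range_coe, Submodule.span_le]
  have key : ∀ γ ∈ Δp, γ ∈ Submodule.span ℝ Φ := by
    intro γ hγ
    obtain ⟨c, h1, h2⟩ := R.dec γ hγ
    rw [h2]
    refine Submodule.sum_mem _ fun a ha => Submodule.smul_mem _ _ (Submodule.subset_span (h1 ha))
  intro γ hγ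
  rcases R.Δ_cases hγ with h | h
  · exact key _ h
  · have := Submodule.neg_mem _ (key _ h)
    rwa [neg_neg] at this

/-- The basis of simple roots. -/
noncomputable def bas : Module.Basis Φ ℝ E := Module.Basis.mk R.ind R.spanΦ

/-- Coordinates. -/
noncomputable def co (a : Φ) : E →ₗ[ℝ] ℝ := R.bas.coord a

lemma bas_apply (a : Φ) : R.bas a = (a : E) := by simp [bas]

lemma co_self (a : Φ) : R.co a a = 1 := by
  rw [← R.bas_apply a]; simp [co]

lemma co_ne (a : Φ) {b : E} (hb : b ∈ Φ) (h : b ≠ a) : R.co a b = 0 := by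
  have := R.bas_apply ⟨b, hb⟩
  simp only at this
  rw [← this]
  simp only [co, Module.Basis.coord_apply, Module.Basis.repr_self]
  rw [Finsupp.single_eq_of_ne]
  intro h'; apply h; rw [h']

lemma finΦ : Finite Φ := (R.fin.subset R.ΦΔ).to_subtype

lemma co_sum (x : E) : ∃ s : Finset Φ, x = ∑ a ∈ s, R.co a x • (a : E) := by
  have := R.finΦ
  have := Fintype.ofFinite Φ
  refine ⟨Finset.univ, ?_⟩
  conv_lhs => rw [← R.bas.sum_repr x]
  refine Finset.sum_congr rfl fun a _ => ?_
  rw [R.bas_apply]; rfl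

lemma co_ext {x : E} (h : ∀ a, R.co a x = 0) : x = 0 := by
  obtain ⟨s, hs⟩ := R.co_sum x
  rw [hs]
  exact Finset.sum_eq_zero fun a _ => by rw [h a, zero_smul]

/-- Height. -/
noncomputable def ht : E →ₗ[ℝ] ℝ := R.bas.constr ℝ (fun _ => (1 : ℝ))

lemma ht_simple {a : E} (h : a ∈ Φ) : R.ht a = 1 := by
  have := R.bas_apply ⟨a, h⟩
  simp only at this
  rw [← this]; simp [ht]

lemma co_nonneg {γ : E} (h : γ ∈ Δp) (a : Φ) : 0 ≤ R.co a γ := by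
  obtain ⟨c, h1, h2⟩ := R.dec γ h
  rw [h2, Finsupp.sum, map_sum]
  refine Finset.sum_nonneg fun b hb => ?_
  rw [map_smul, smul_eq_mul]
  refine mul_nonneg (Nat.cast_nonneg _) ?_
  by_cases hba : b = a
  · rw [hba, co_self]; exact zero_le_one
  · rw [R.co_ne a (h1 hb) hba]

lemma mem_closure {γ : E} (h : γ ∈ Δ) : γ ∈ AddSubgroup.closure Φ := by
  have key : ∀ γ ∈ Δp, γ ∈ AddSubgroup.closure Φ := by
    intro γ hγ
    obtain ⟨c, h1, h2⟩ := R.dec γ hγ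
    rw [h2]
    refine AddSubgroup.sum_mem _ fun a ha => ?_
    simp only [Nat.cast_smul_eq_nsmul]
    exact AddSubgroup.nsmul_mem _ (AddSubgroup.subset_closure (h1 ha)) _
  rcases R.Δ_cases h with h | h
  · exact key _ h
  · have := AddSubgroup.neg_mem _ (key _ h)
    rwa [neg_neg] at this

lemma co_zero {Ψ : Set E} (hΨ : Ψ ⊆ Φ) {x : E} (hx : x ∈ AddSubgroup.closure Ψ) (a : Φ)
    (ha : (a : E) ∉ Ψ) : R.co a x = 0 := by
  induction hx using AddSubgroup.closure_induction with
  | mem x hx => exact R.co_ne a (hΨ hx) (fun h => ha (h ▸ hx))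
  | zero => simp
  | add x y _ _ h1 h2 => rw [map_add, h1, h2, add_zero]
  | neg x _ h => rw [map_neg, h, neg_zero]

lemma exists_pos {Ψ : Set E} (hΨ : Ψ ⊆ Φ) {γ : E} (h : γ ∈ Δp) (hc : γ ∈ AddSubgroup.closure Ψ) :
    ∃ α ∈ Ψ, 0 < ⟪γ, α⟫ := by
  by_contra hcon
  push Not at hcon
  have h1 := inner_pos (R.ne0 (R.ΔpΔ h))
  obtain ⟨s, hs⟩ := R.co_sum γ
  have : ⟪γ, γ⟫ ≤ 0 := by
    conv_lhs => rw [hs, sum_inner]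
    refine Finset.sum_nonpos fun a _ => ?_
    rw [real_inner_smul_left]
    by_cases ha : (a : E) ∈ Ψ
    · refine mul_nonpos_of_nonneg_of_nonpos (R.co_nonneg h a) ?_
      rw [← hs, real_inner_comm]; exact hcon a ha
    · rw [R.co_zero hΨ hc a ha, zero_mul]
  linarith

lemma srf_pos {γ α : E} (hγ : γ ∈ Δp) (hα : α ∈ Φ) (hne : γ ≠ α) : srf α γ ∈ Δp := by
  have hΔ := R.refl α (R.ΦΔ hα) γ (R.ΔpΔ hγ)
  rcases R.Δ_cases hΔ with h | h
  · exact h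
  exfalso
  have hz : ∀ b : Φ, (b : E) ≠ α → R.co b γ = 0 := by
    intro b hb
    have h1 := R.co_nonneg h b
    have h2 := R.co_nonneg hγ b
    rw [map_neg] at h1
    unfold srf at h1
    rw [map_sub, map_smul, R.co_ne b hα (Ne.symm hb), smul_zero, sub_zero] at h1
    linarith
  have hg : γ = R.co ⟨α, hα⟩ γ • α := by
    rw [← sub_eq_zero]
    apply R.co_ext
    intro b
    rw [map_sub, map_smul]
    by_cases hb : (b : E) = α
    · have : b = ⟨α, hα⟩ := Subtype.ext hb
      rw [this]
      have := R.co_self ⟨α, hα⟩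
      simp only at this
      rw [this]; simp
    · rw [hz b hb, R.co_ne b hα (Ne.symm hb)]; simp
  have hg' := R.ΔpΔ hγ
  rw [hg] at hg'
  rcases R.red α (R.ΦΔ hα) _ hg' with h1 | h1
  · rw [h1, one_smul] at hg; exact hne hg
  · have := R.co_nonneg hγ ⟨α, hα⟩
    linarith

lemma ht_pos {γ : E} (h : γ ∈ Δp) : 0 < R.ht γ := by
  obtain ⟨c, h1, h2⟩ := R.dec γ h
  have h3 : R.ht γ = ∑ a ∈ c.support, (c a : ℝ) := by
    rw [h2, Finsupp.sum, map_sum]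
    refine Finset.sum_congr rfl fun a ha => ?_
    rw [map_smul, R.ht_simple (h1 ha), smul_eq_mul, mul_one]
  rw [h3]
  refine Finset.sum_pos (fun a ha => ?_) ?_
  · have := Finsupp.mem_support_iff.1 ha
    positivity
  · by_contra hc
    rw [Finset.not_nonempty_iff_eq_empty] at hc
    apply R.ne0 (R.ΔpΔ h)
    rw [h2, Finsupp.sum, hc, Finset.sum_empty]

lemma link {Ψ : Set E} (hΨ : Ψ ⊆ Φ) (Q : E → Prop) (hQ : ∀ α ∈ Ψ, Q α)
    (hs : ∀ α ∈ Ψ, ∀ γ ∈ Δ, γ ∈ AddSubgroup.closure Ψ → Q γ → Q (srf α γ)) :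
    ∀ γ ∈ Δ, γ ∈ AddSubgroup.closure Ψ → Q γ := by
  have key : ∀ n : ℕ, ∀ γ ∈ Δp, γ ∈ AddSubgroup.closure Ψ → R.ht γ ≤ n → Q γ ∧ Q (-γ) := by
    intro n
    induction n with
    | zero =>
      intro γ h _ h2
      have := R.ht_pos h
      simp at h2; linarith
    | succ n ih =>
      intro γ h hc hh
      obtain ⟨α, hα, hp⟩ := R.exists_pos hΨ h hc
      have hαΔ := R.ΦΔ (hΨ hα)
      have hα0 := R.ne0 hαΔ
      have hαc : α ∈ AddSubgroup.closure Ψ := AddSubgroup.subset_closure hα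
      by_cases hγα : γ = α
      · subst hγα
        refine ⟨hQ _ hα, ?_⟩
        have := hs _ hα _ hαΔ hαc (hQ _ hα)
        rwa [srf_self hα0] at this
      · have h1 := R.srf_pos h (hΨ hα) hγα
        obtain ⟨m, hm⟩ := R.crys α hαΔ γ (R.ΔpΔ h)
        have hm1 : 0 < crn γ α := (crn_pos_iff hα0 γ).2 hp
        have hm2 : (1 : ℝ) ≤ m := by
          rw [hm] at hm1
          have : 0 < m := by exact_mod_cast hm1
          exact_mod_cast this
        have h2 : srf α γ ∈ AddSubgroup.closure Ψ := by
          unfold srf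
          rw [hm, Int.cast_smul_eq_zsmul]
          exact AddSubgroup.sub_mem _ hc (AddSubgroup.zsmul_mem _ hαc _)
        have h3 : R.ht (srf α γ) ≤ n := by
          unfold srf
          rw [map_sub, map_smul, R.ht_simple (hΨ hα), hm, smul_eq_mul]
          push_cast at hh
          linarith
        obtain ⟨q1, q2⟩ := ih _ h1 h2 h3
        have r1 := hs α hα _ (R.ΔpΔ h1) h2 q1
        have r2 := hs α hα _ (R.neg (R.ΔpΔ h1)) (AddSubgroup.neg_mem _ h2) q2
        rw [srf_neg] at r2
        rw [srf_srf hα0] at r1 r2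
        exact ⟨r1, r2⟩
  intro γ hγ hc
  rcases R.Δ_cases hγ with h | h
  · obtain ⟨n, hn⟩ := exists_nat_ge (R.ht γ)
    exact (key n γ h hc hn).1
  · obtain ⟨n, hn⟩ := exists_nat_ge (R.ht (-γ))
    have := (key n (-γ) h (AddSubgroup.neg_mem _ hc) hn).2
    rwa [neg_neg] at this

lemma irrΦ (X Y : Set E) (h : X ∪ Y = Φ) (ho : ∀ a ∈ X, ∀ b ∈ Y, ⟪a, b⟫ = 0) : X = ∅ ∨ Y = ∅ := by
  have hX : X ⊆ Φ := h ▸ Set.subset_union_left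
  have hY : Y ⊆ Φ := h ▸ Set.subset_union_right
  have ho2 : ∀ a ∈ Submodule.span ℝ X, ∀ b ∈ Submodule.span ℝ Y, ⟪a, b⟫ = 0 := by
    intro a ha b hb
    induction ha using Submodule.span_induction with
    | mem a ha =>
      induction hb using Submodule.span_induction with
      | mem b hb => exact ho a ha b hb
      | zero => simp
      | add b c _ _ h1 h2 => rw [inner_add_right, h1, h2, add_zero]
      | smul t b _ h1 => rw [real_inner_smul_right, h1, mul_zero]
    | zero => simp
    | add b c _ _ h1 h2 => rw [inner_add_left, h1, h2, add_zero]
    | smul t b _ h1 => rw [real_inner_smul_left, h1, mul_zero]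
  have key := R.link (Ψ := Φ) subset_rfl
    (fun γ => γ ∈ Submodule.span ℝ X ∨ γ ∈ Submodule.span ℝ Y)
    (by
      intro α hα
      rw [← h] at hα
      rcases hα with h | h
      · exact Or.inl (Submodule.subset_span h)
      · exact Or.inr (Submodule.subset_span h))
    (by
      intro α hα γ _ _ hγ
      rw [← h] at hα
      unfold srf
      rcases hα with h1 | h1 <;> rcases hγ with h2 | h2
      · exact Or.inl (Submodule.sub_mem _ h2 (Submodule.smul_mem _ _ (Submodule.subset_span h1)))
      · right
        have : crn γ α = 0 := by
          unfold crn
          rw [real_inner_comm, ho2 α (Submodule.subset_span h1) γ h2]; simp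
        rw [this, zero_smul, sub_zero]; exact h2
      · left
        have : crn γ α = 0 := by
          unfold crn
          rw [ho2 γ h2 α (Submodule.subset_span h1)]; simp
        rw [this, zero_smul, sub_zero]; exact h2
      · exact Or.inr (Submodule.sub_mem _ h2 (Submodule.smul_mem _ _ (Submodule.subset_span h1))))
  rcases R.irr (Δ ∩ Submodule.span ℝ X) (Δ ∩ Submodule.span ℝ Y) (by
    ext γ
    constructor
    · rintro (h | h) <;> exact h.1
    · intro hγ
      rcases key γ hγ (R.mem_closure hγ) with h | h
      exacts [Or.inl ⟨hγ, h⟩, Or.inr ⟨hγ, h⟩]) (fun a ha b hb => ho2 a ha.2 b hb.2) with h1 | h1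
  · left
    rw [Set.eq_empty_iff_forall_notMem] at h1 ⊢
    exact fun x hx => h1 x ⟨R.ΦΔ (hX hx), Submodule.subset_span hx⟩
  · right
    rw [Set.eq_empty_iff_forall_notMem] at h1 ⊢
    exact fun x hx => h1 x ⟨R.ΦΔ (hY hx), Submodule.subset_span hx⟩

lemma simple_le {a b : E} (ha : a ∈ Φ) (hb : b ∈ Φ) (h : a ≠ b) : ⟪a, b⟫ ≤ 0 := by
  by_contra hc
  push Not at hc
  rcases R.sub_root (R.ΦΔ ha) (R.ΦΔ hb) hc with h1 | h1
  · exact h h1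
  have e1 := R.co_self ⟨a, ha⟩
  have e2 := R.co_self ⟨b, hb⟩
  have e3 := R.co_ne ⟨a, ha⟩ hb (Ne.symm h)
  have e4 := R.co_ne ⟨b, hb⟩ ha h
  simp only at e1 e2
  rcases R.Δ_cases h1 with h2 | h2
  · have := R.co_nonneg h2 ⟨b, hb⟩
    rw [map_sub] at this; linarith
  · have := R.co_nonneg h2 ⟨a, ha⟩
    rw [neg_sub, map_sub] at this; linarith

lemma conn (A B : Set E) (h : A ∪ B = Φs) (hd : ∀ a ∈ A, ∀ b ∈ B, ⟪a, b⟫ = 0) :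
    A = ∅ ∨ B = ∅ := by
  by_cases hAe : A = ∅
  · exact Or.inl hAe
  by_cases hBe : B = ∅
  · exact Or.inr hBe
  exfalso
  have hA : A ⊆ Φs := h ▸ Set.subset_union_left
  have hB : B ⊆ Φs := h ▸ Set.subset_union_right
  have hsn : ∀ a ∈ Φs, ‖a‖ = ls := fun a ha => R.short_norm (by rw [R.hΦs] at ha; exact ha.2)
  -- long positive roots, combos of long simple roots, hit negatively by some a in A
  let T : Set E := {l | l ∈ Δp ∧ l ∈ Δl ∧ (∀ a : Φ, (a : E) ∈ Φs → R.co a l = 0) ∧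
    ∃ a ∈ A, ⟪l, a⟫ < 0}
  have Tco : ∀ l ∈ T, ∀ c ∈ Φ, (∀ a : Φ, (a : E) = c → R.co a l = 0) → ⟪l, c⟫ ≤ 0 ∧
      (⟪l, c⟫ = 0 → ∀ a : Φ, R.co a l ≠ 0 → ⟪(a : E), c⟫ = 0) := by
    intro l hl c hc h0
    have hfin := R.finΦ
    have := Fintype.ofFinite Φ
    have hs : l = ∑ a : Φ, R.co a l • (a : E) := by
      conv_lhs => rw [← R.bas.sum_repr l]
      refine Finset.sum_congr rfl fun a _ => ?_
      rw [R.bas_apply]; rfl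
    have hterm : ∀ a ∈ Finset.univ, R.co a l * ⟪(a : E), c⟫ ≤ 0 := by
      intro a _
      by_cases hac : (a : E) = c
      · rw [h0 a hac, zero_mul]
      · exact mul_nonpos_of_nonneg_of_nonpos (R.co_nonneg hl.1 a) (R.simple_le a.2 hc hac)
    have hsum : ⟪l, c⟫ = ∑ a : Φ, R.co a l * ⟪(a : E), c⟫ := by
      conv_lhs => rw [hs, sum_inner]
      exact Finset.sum_congr rfl fun a _ => by rw [real_inner_smul_left]
    refine ⟨hsum ▸ Finset.sum_nonpos hterm, fun h1 a ha => ?_⟩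
    rw [hsum] at h1
    have := (Finset.sum_eq_zero_iff_of_nonpos hterm).1 h1 a (Finset.mem_univ _)
    exact (mul_eq_zero.1 this).resolve_left ha
  have TB : ∀ l ∈ T, ∀ b ∈ B, ⟪l, b⟫ = 0 := by
    intro l hl b hb
    have h1 := (Tco l hl b (R.ΦsΦ (hB hb)) (fun a hab => hl.2.2.1 a (hab ▸ hB hb))).1
    refine le_antisymm h1 ?_
    by_contra hc
    push Not at hc
    obtain ⟨a, ha, hla⟩ := hl.2.2.2
    have hlΔ := R.ΔlΔ hl.2.1
    have hl0 := R.ne0 hlΔ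
    have hll := R.long_norm hl.2.1
    have ls0 := R.h0ls
    have lsll := R.hlsll
    have aux : ∀ x ∈ Φs, ⟪l, x⟫ < 0 → ⟪l, x⟫ ≤ - ll ^ 2 / 2 ∧ 2 * ls ^ 2 ≤ ll ^ 2 := by
      intro x hx hlx
      have hxΔ := R.ΦsΔ hx
      have hx0 := R.ne0 hxΔ
      obtain ⟨m, hm⟩ := R.crys l hlΔ x hxΔ
      obtain ⟨n, hn⟩ := R.crys x hxΔ l hlΔ
      have e1 := crn_mul hl0 x
      have e2 := crn_mul hx0 l
      have m1 := (crn_neg_iff hl0 x).2 (by rwa [real_inner_comm])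
      rw [hm] at e1 m1
      rw [hn] at e2
      rw [real_inner_comm l x, real_inner_self_eq_norm_sq, hll] at e1
      rw [real_inner_self_eq_norm_sq, hsn x hx] at e2
      have m2 : m < 0 := by exact_mod_cast m1
      have m3 : (m : ℝ) ≤ -1 := by exact_mod_cast (show m ≤ -1 by omega)
      have k1 : ⟪l, x⟫ ≤ - ll ^ 2 / 2 := by nlinarith
      refine ⟨k1, ?_⟩
      have hlt : ls ^ 2 < ll ^ 2 := by nlinarith
      have n1 : (n : ℝ) < -1 := by
        by_contra hcc; push Not at hcc
        nlinarith
      have n2 : n < -1 := by exact_mod_cast n1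
      have n3 : (n : ℝ) ≤ -2 := by exact_mod_cast (show n ≤ -2 by omega)
      by_cases hm1 : m = -1
      · rw [hm1] at e1; push_cast at e1
        nlinarith
      · exfalso
        have m4 : (m : ℝ) ≤ -2 := by exact_mod_cast (show m ≤ -2 by omega)
        have cs := real_inner_mul_inner_self_le l x
        rw [real_inner_self_eq_norm_sq, real_inner_self_eq_norm_sq, hll, hsn x hx] at cs
        have : ⟪l, x⟫ ≤ - ll ^ 2 := by nlinarith
        have : ll ^ 2 * ll ^ 2 ≤ ⟪l, x⟫ * ⟪l, x⟫ := by nlinarith [sq_nonneg ll]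
        nlinarith [sq_nonneg ll, mul_pos (ls0.trans lsll) (ls0.trans lsll)]
    obtain ⟨p1, q1⟩ := aux a (hA ha) hla
    obtain ⟨p2, -⟩ := aux b (hB hb) hc
    have hne : l + a + b ≠ 0 := by
      intro h0
      have := congrArg R.ht h0
      rw [map_add, map_add, R.ht_simple (R.ΦsΦ (hA ha)), R.ht_simple (R.ΦsΦ (hB hb)), map_zero] at this
      have := R.ht_pos hl.1
      linarith
    have hpos := inner_pos hne
    simp only [inner_add_left, inner_add_right] at hpos
    rw [real_inner_comm l a, real_inner_comm l b, real_inner_comm a b, hd a ha b hb,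
      real_inner_self_eq_norm_sq, real_inner_self_eq_norm_sq, real_inner_self_eq_norm_sq,
      hll, hsn a (hA ha), hsn b (hB hb)] at hpos
    linarith
  -- the partition
  let S : Set E := {c | ∃ h : c ∈ Φ, ∃ l ∈ T, R.co ⟨c, h⟩ l ≠ 0}
  let Y : Set E := B ∪ {c | c ∈ Φ ∧ c ∉ Φs ∧ c ∉ S}
  have hSΦ : S ⊆ Φ := fun c hc => hc.1
  have hSs : ∀ c ∈ S, c ∉ Φs := by
    rintro c ⟨hc, l, hl, hne⟩ hcs
    exact hne (hl.2.2.1 ⟨c, hc⟩ hcs)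
  have hlong : ∀ c ∈ Φ, c ∉ Φs → c ∈ Δl := by
    intro c hc hcs
    have := R.ΦΔ hc
    rw [R.cover] at this
    rcases this with h | h
    · exact absurd (by rw [R.hΦs]; exact ⟨hc, h⟩) hcs
    · exact h
  have hcov : (A ∪ S) ∪ Y = Φ := by
    ext c
    constructor
    · rintro ((h | h) | (h | h))
      · exact R.ΦsΦ (hA h)
      · exact hSΦ h
      · exact R.ΦsΦ (hB h)
      · exact h.1
    · intro hc
      by_cases h1 : c ∈ Φs
      · rw [← h] at h1
        rcases h1 with h1 | h1
        · exact Or.inl (Or.inl h1)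
        · exact Or.inr (Or.inl h1)
      · by_cases h2 : c ∈ S
        · exact Or.inl (Or.inr h2)
        · exact Or.inr (Or.inr ⟨hc, h1, h2⟩)
  have hort : ∀ a ∈ A ∪ S, ∀ b ∈ Y, ⟪a, b⟫ = 0 := by
    rintro a (ha | ha) b (hb | hb)
    · exact hd a ha b hb
    · obtain ⟨hb1, hb2, hb3⟩ := hb
      have haΦ := R.ΦsΦ (hA ha)
      have hne : a ≠ b := fun h => hb2 (h ▸ hA ha)
      refine le_antisymm (R.simple_le haΦ hb1 hne) ?_
      by_contra hc
      push Not at hc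
      apply hb3
      refine ⟨hb1, b, ⟨R.Φp hb1, hlong b hb1 hb2, ?_, a, ha, by rwa [real_inner_comm]⟩, ?_⟩
      · intro x hx
        exact R.co_ne x hb1 (fun h => hb2 (h ▸ hx))
      · have := R.co_self ⟨b, hb1⟩
        simp only at this
        rw [this]; exact one_ne_zero
    · obtain ⟨haΦ, l, hl, hne⟩ := ha
      exact (Tco l hl b (R.ΦsΦ (hB hb)) (fun x hx => hl.2.2.1 x (hx ▸ hB hb))).2
        (TB l hl b hb) ⟨a, haΦ⟩ hne
    · obtain ⟨haΦ, l, hl, hne⟩ := ha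
      obtain ⟨hb1, hb2, hb3⟩ := hb
      have h0 : ∀ x : Φ, (x : E) = b → R.co x l = 0 := by
        intro x hx
        by_contra hcc
        apply hb3
        refine ⟨hb1, l, hl, ?_⟩
        have : x = ⟨b, hb1⟩ := Subtype.ext hx
        rwa [← this]
      obtain ⟨k1, k2⟩ := Tco l hl b hb1 h0
      refine k2 (le_antisymm k1 ?_) ⟨a, haΦ⟩ hne
      by_contra hcc
      push Not at hcc
      apply hb3
      have hbl := hlong b hb1 hb2
      have hbΔ := R.ΦΔ hb1
      have hlΔ := R.ΔlΔ hl.2.1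
      have hb0 := R.ne0 hbΔ
      have hlb : l ≠ b := by
        intro h
        have := h0 ⟨b, hb1⟩ rfl
        have e := R.co_self ⟨b, hb1⟩
        simp only at e
        rw [h, e] at this
        exact one_ne_zero this
      have hpos := R.srf_pos hl.1 hb1 hlb
      have hcr := (crn_neg_iff hb0 l).2 hcc
      refine ⟨hb1, srf b l, ⟨hpos, ?_, ?_, ?_⟩, ?_⟩
      · rw [R.hΔl]
        exact ⟨R.ΔpΔ hpos, by rw [norm_srf hb0, R.long_norm hl.2.1]⟩
      · intro x hx
        unfold srf
        rw [map_sub, map_smul, hl.2.2.1 x hx, R.co_ne x hb1 (fun h => hb2 (h ▸ hx)), smul_zero, sub_zero]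
      · obtain ⟨y, hy, hly⟩ := hl.2.2.2
        refine ⟨y, hy, ?_⟩
        unfold srf
        rw [inner_sub_left, real_inner_smul_left]
        have := R.simple_le hb1 (R.ΦsΦ (hA hy)) (fun h => hb2 (h ▸ hA hy))
        nlinarith
      · unfold srf
        rw [map_sub, map_smul, h0 ⟨b, hb1⟩ rfl]
        have e := R.co_self ⟨b, hb1⟩
        simp only at e
        rw [e, smul_eq_mul, mul_one, zero_sub]
        intro h; linarith
  rcases R.irrΦ _ _ hcov hort with h1 | h1
  · exact hAe (Set.subset_eq_empty Set.subset_union_left h1)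
  · exact hBe (Set.subset_eq_empty Set.subset_union_left h1)

lemma D_short {γ : E} (h : γ ∈ Δ) (hc : γ ∈ AddSubgroup.closure Φs) : γ ∈ Δs := by
  have key := R.link R.ΦsΦ (fun γ => ‖γ‖ = ls)
    (fun α hα => R.short_norm (by rw [R.hΦs] at hα; exact hα.2))
    (fun α hα γ _ _ h => by rw [norm_srf (R.ne0 (R.ΦsΔ hα))]; exact h)
  rw [R.hΔs]
  exact ⟨h, key γ h hc⟩

lemma trans (X : E → Prop) {μ : E} (hμ : μ ∈ Δ) (hμc : μ ∈ AddSubgroup.closure Φs) (hX : X μ)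
    (hs : ∀ α ∈ Φs, ∀ γ ∈ Δ, γ ∈ AddSubgroup.closure Φs → X γ → X (srf α γ)) :
    ∀ γ ∈ Δ, γ ∈ AddSubgroup.closure Φs → X γ := by
  have hcl : ∀ α ∈ Φs, ∀ γ ∈ Δ, γ ∈ AddSubgroup.closure Φs → srf α γ ∈ AddSubgroup.closure Φs := by
    intro α hα γ hγ hc
    obtain ⟨m, hm⟩ := R.crys α (R.ΦsΔ hα) γ hγ
    unfold srf
    rw [hm, Int.cast_smul_eq_zsmul]
    exact AddSubgroup.sub_mem _ hc (AddSubgroup.zsmul_mem _ (AddSubgroup.subset_closure hα) _)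
  have h1 := R.link R.ΦsΦ (fun γ => X γ → ∃ α ∈ Φs, X α) (fun α hα h => ⟨α, hα, h⟩)
    (by
      intro α hα γ hγ hc h1 h2
      apply h1
      have := hs α hα _ (R.refl α (R.ΦsΔ hα) γ hγ) (hcl α hα γ hγ hc) h2
      rwa [srf_srf (R.ne0 (R.ΦsΔ hα))] at this)
  obtain ⟨α, hα, hXα⟩ := h1 μ hμ hμc hX
  have hc := R.conn {a | a ∈ Φs ∧ X a} {a | a ∈ Φs ∧ ¬ X a} (by ext x; simp; tauto) (by
    rintro a ⟨ha, hXa⟩ b ⟨hb, hXb⟩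
    have hne : a ≠ b := fun h => hXb (h ▸ hXa)
    have haΔ := R.ΦsΔ ha
    have hbΔ := R.ΦsΔ hb
    refine le_antisymm (R.simple_le (R.ΦsΦ ha) (R.ΦsΦ hb) hne) ?_
    by_contra hcc
    push Not at hcc
    apply hXb
    have hac : a ∈ AddSubgroup.closure Φs := AddSubgroup.subset_closure ha
    have k1 := hs b hb a haΔ hac hXa
    have k2 := hs a ha _ (R.refl b hbΔ a haΔ) (hcl b hb a haΔ hac) k1
    have a0 := R.ne0 haΔ
    have b0 := R.ne0 hbΔ
    have na : ⟪a, a⟫ = ls ^ 2 := by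
      rw [real_inner_self_eq_norm_sq, R.short_norm (by rw [R.hΦs] at ha; exact ha.2)]
    have nb : ⟪b, b⟫ = ls ^ 2 := by
      rw [real_inner_self_eq_norm_sq, R.short_norm (by rw [R.hΦs] at hb; exact hb.2)]
    have hcr : crn a b = -1 := by
      obtain ⟨m, hm⟩ := R.crys b hbΔ a haΔ
      have m1 := (crn_neg_iff b0 a).2 hcc
      have e := crn_mul b0 a
      rw [hm] at m1 e ⊢
      have m2 : m < 0 := by exact_mod_cast m1
      by_contra hne1
      have hne2 : m ≠ -1 := fun h => hne1 (by rw [h]; simp)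
      have m3 : (m : ℝ) ≤ -2 := by exact_mod_cast (show m ≤ -2 by omega)
      have hab : a + b ≠ 0 := by
        intro h0
        have := congrArg R.ht h0
        rw [map_add, R.ht_simple (R.ΦsΦ ha), R.ht_simple (R.ΦsΦ hb), map_zero] at this
        norm_num at this
      have hp := inner_pos hab
      simp only [inner_add_left, inner_add_right] at hp
      rw [real_inner_comm a b, na, nb] at hp
      rw [nb] at e
      nlinarith [sq_nonneg ls]
    have e1 : srf b a = a + b := by unfold srf; rw [hcr]; module
    have hcr2 : crn b a = -1 := by
      unfold crn at hcr ⊢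
      rw [real_inner_comm, na, ← nb]; exact hcr
    have e2 : srf a (a + b) = b := by
      unfold srf; rw [crn_add, crn_self a0, hcr2]; module
    rwa [e1, e2] at k2)
  have hall : ∀ a ∈ Φs, X a := by
    rcases hc with h | h
    · exact absurd (show α ∈ {a | a ∈ Φs ∧ X a} from ⟨hα, hXα⟩) (by rw [h]; simp)
    · intro a ha
      by_contra hcc
      exact absurd (show a ∈ {a | a ∈ Φs ∧ ¬ X a} from ⟨ha, hcc⟩) (by rw [h]; simp)
  exact R.link R.ΦsΦ X hall hs

lemma θΔ : θs ∈ Δ := R.ΔsΔ R.θmem.1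

lemma θdom {α : E} (hα : α ∈ Φ) : 0 ≤ ⟪θs, α⟫ := by
  by_contra hc
  push Not at hc
  have hαΔ := R.ΦΔ hα
  have a0 := R.ne0 hαΔ
  have hcr := (crn_neg_iff a0 θs).2 hc
  have hm : srf α θs ∈ Δs := by
    rw [R.hΔs]
    exact ⟨R.refl _ hαΔ _ R.θΔ, by rw [norm_srf a0, R.short_norm R.θmem.1]⟩
  obtain ⟨c, h1, h2, h3⟩ := R.θhigh _ hm
  have h4 := congrArg R.ht h3
  rw [Finsupp.sum, map_sum] at h4
  have h5 : 0 ≤ ∑ x ∈ c.support, R.ht (c x • x) := by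
    refine Finset.sum_nonneg fun x hx => ?_
    rw [map_smul, R.ht_simple (h1 hx), smul_eq_mul, mul_one]; exact h2 x
  rw [← h4] at h5
  unfold srf at h5
  rw [sub_sub_cancel, map_smul, R.ht_simple hα, smul_eq_mul] at h5
  linarith

/-- dominant and below θ implies norm bound. -/
lemma dom_eq {γ : E} (h : γ ∈ Δs) (hd : ∀ α ∈ Φ, 0 ≤ ⟪γ, α⟫) : γ = θs := by
  obtain ⟨c, h1, h2, h3⟩ := R.θhigh _ h
  have k : ∀ x : E, (∀ α ∈ Φ, 0 ≤ ⟪x, α⟫) → 0 ≤ ⟪x, θs - γ⟫ := by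
    intro x hx
    rw [h3, Finsupp.sum, inner_sum]
    refine Finset.sum_nonneg fun y hy => ?_
    rw [real_inner_smul_right]
    exact mul_nonneg (h2 y) (hx y (h1 hy))
  have k1 := k γ hd
  have k2 := k θs (fun α hα => R.θdom hα)
  have n1 : ⟪γ, γ⟫ = ⟪θs, θs⟫ := by
    rw [real_inner_self_eq_norm_sq, real_inner_self_eq_norm_sq, R.short_norm h,
      R.short_norm R.θmem.1]
  rw [inner_sub_right] at k1 k2
  rw [real_inner_comm θs γ] at k1
  symm
  rw [← sub_eq_zero, ← inner_self_eq_zero (𝕜 := ℝ)]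
  simp only [inner_sub_left, inner_sub_right]
  rw [real_inner_comm θs γ]
  linarith

lemma exists_neg {γ : E} (h : γ ∈ Δs) (hne : γ ≠ θs) : ∃ α ∈ Φ, ⟪γ, α⟫ < 0 := by
  by_contra hc
  push Not at hc
  exact hne (R.dom_eq h hc)

lemma ht_nonneg_closure {Ψ : Set E} (hΨ : Ψ ⊆ Φ) {δ : E} (h : δ ∈ AddSubmonoid.closure Ψ) :
    0 ≤ R.ht δ ∧ (R.ht δ = 0 → δ = 0) := by
  induction h using AddSubmonoid.closure_induction with
  | mem x hx => rw [R.ht_simple (hΨ hx)]; exact ⟨zero_le_one, fun h => absurd h one_ne_zero⟩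
  | zero => simp
  | add x y _ _ h1 h2 =>
    rw [map_add]
    refine ⟨add_nonneg h1.1 h2.1, fun h => ?_⟩
    rw [h1.2 (by linarith [h1.1, h2.1]), h2.2 (by linarith [h1.1, h2.1]), add_zero]

lemma inner_nonneg_closure {x : E} (hx : ∀ α ∈ Φ, 0 ≤ ⟪x, α⟫) {δ : E}
    (h : δ ∈ AddSubmonoid.closure Φ) : 0 ≤ ⟪x, δ⟫ := by
  induction h using AddSubmonoid.closure_induction with
  | mem y hy => exact hx y hy
  | zero => simp
  | add y z _ _ h1 h2 => rw [inner_add_right]; exact add_nonneg h1 h2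
end RSys


/-- Lie-theoretic interface. -/
structure LI {E : Type} [NormedAddCommGroup E] [InnerProductSpace ℝ E] (Δ : Set E)
    {L : Type} [LieRing L] [LieAlgebra ℂ L] (H : LieSubalgebra ℂ L)
    (e : E →+ (H → ℂ)) (hv : E → H) (xv yv : E → L) : Prop where
  inj : Function.Injective e
  abel : ∀ a b : H, ⁅(a : L), (b : L)⁆ = 0
  none : ∀ μ, μ ≠ 0 → μ ∉ Δ → hwt H L (e μ) = ⊥
  gen : ∀ S : Submodule ℂ L, H.toSubmodule ≤ S → (∀ μ ∈ Δ, hwt H L (e μ) ≤ S) → S = ⊤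
  sl2 : ∀ α ∈ Δ, IsSl2Triple (hv α : L) (xv α) (yv α)
  hx : ∀ α ∈ Δ, hwt H L (e α) = ℂ ∙ xv α
  hy : ∀ α ∈ Δ, hwt H L (e (-α)) = ℂ ∙ yv α
  ev : ∀ α ∈ Δ, ∀ μ ∈ AddSubgroup.closure Δ, e μ (hv α) = ((crn μ α : ℝ) : ℂ)

section build
open LieAlgebra LieAlgebra.IsKilling
variable {L : Type} [LieRing L] [LieAlgebra ℂ L] [FiniteDimensional ℂ L]
    [LieAlgebra.IsSimple ℂ L] (H : LieSubalgebra ℂ L) [H.IsCartanSubalgebra]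

lemma hwt_eq_root (χ : H → ℂ) : hwt H L χ = (rootSpace H χ).toSubmodule := by
  ext v
  constructor
  · intro hv
    have : v ∈ LieModule.weightSpace L χ := by
      rw [LieModule.mem_weightSpace]
      intro x; exact hv x
    exact LieModule.weightSpace_le_genWeightSpace L χ this
  · intro hv x
    exact lie_eq_smul_of_mem_rootSpace hv x

lemma span_of_finrank_one {V : Type} [AddCommGroup V] [Module ℂ V] (S : Submodule ℂ V)
    (h : Module.finrank ℂ S = 1) {x : V} (hx : x ∈ S) (h0 : x ≠ 0) : S = ℂ ∙ x := by
  have := (finrank_eq_one_iff_of_nonzero' (⟨x, hx⟩ : S) (by simpa using h0)).1 h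
  apply le_antisymm
  · intro w hw
    obtain ⟨c, hc⟩ := this ⟨w, hw⟩
    rw [Submodule.mem_span_singleton]
    exact ⟨c, by simpa using congrArg Subtype.val hc⟩
  · rwa [Submodule.span_singleton_le_iff_mem]

theorem exists_LI {E : Type} [NormedAddCommGroup E] [InnerProductSpace ℝ E]
    [FiniteDimensional ℝ E] {Δ Δs Δl Δp Φ Φs : Set E} {ls ll : ℝ} {θs : E}
    (R : RSys Δ Δs Δl Δp Φ Φs ls ll θs) (e : E →+ (H → ℂ)) (heinj : Function.Injective e)
    (hroots1 : ∀ μ ∈ Δ, hwt H L (e μ) ≠ ⊥)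
    (hroots2 : ∀ χ : H → ℂ, χ ≠ 0 → hwt H L χ ≠ ⊥ → ∃ μ ∈ Δ, χ = e μ) :
    ∃ hv xv yv, LI Δ H e hv xv yv := by
  have wt : ∀ μ ∈ Δ, ∃ w : LieModule.Weight ℂ H L, (w : H → ℂ) = e μ ∧ w.IsNonZero := by
    intro μ hμ
    have h1 : rootSpace H (e μ) ≠ ⊥ := by
      intro h; apply hroots1 μ hμ; rw [hwt_eq_root, h]; rfl
    refine ⟨⟨e μ, h1⟩, rfl, ?_⟩
    intro h
    have h2 : e μ = 0 := h
    rw [← map_zero e] at h2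
    exact R.ne0 hμ (heinj h2)
  have wt2 : ∀ w : LieModule.Weight ℂ H L, w.IsNonZero → ∃ μ ∈ Δ, (w : H → ℂ) = e μ := by
    intro w hw
    apply hroots2 _ hw
    rw [hwt_eq_root]
    intro h
    exact w.genWeightSpace_ne_bot' ((LieSubmodule.toSubmodule_eq_bot _).1 h)
  have main : ∀ α ∈ Δ, ∃ (h : H) (x y : L), IsSl2Triple (h : L) x y ∧ hwt H L (e α) = ℂ ∙ x ∧
      hwt H L (e (-α)) = ℂ ∙ y ∧
      ∀ μ ∈ AddSubgroup.closure Δ, e μ h = ((crn μ α : ℝ) : ℂ) := by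
    intro α hα
    obtain ⟨w, hw, hw0⟩ := wt α hα
    obtain ⟨h, x, y, ht, hx, hy⟩ := exists_isSl2Triple_of_weight_isNonZero hw0
    have hh := ht.h_eq_coroot hw0 hx hy
    refine ⟨coroot w, x, y, hh ▸ ht, ?_, ?_, ?_⟩
    · rw [hwt_eq_root, ← hw]
      exact span_of_finrank_one _ (finrank_rootSpace_eq_one w hw0) hx ht.e_ne_zero
    · rw [hwt_eq_root, map_neg, ← hw]
      have := finrank_rootSpace_eq_one (-w) (LieModule.Weight.IsNonZero.neg hw0)
      rw [LieModule.Weight.coe_neg] at this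
      exact span_of_finrank_one _ this hy ht.f_ne_zero
    · have T : ∀ β ∈ Δ, ∃ n : ℤ, e β (coroot w) = n ∧ β - n • α ∈ Δ := by
        intro β hβ
        obtain ⟨v, hv, hv0⟩ := wt β hβ
        obtain ⟨n, hn⟩ : ∃ n : ℤ, v (coroot w) = n := ⟨_, apply_coroot_eq_cast w v⟩
        refine ⟨n, by rw [← hv]; exact hn, ?_⟩
        obtain ⟨μ, hμ, hμe⟩ := wt2 (reflectRoot w v) (reflectRoot_isNonZero w v hv0)
        have : e μ = e (β - n • α) := by
          rw [← hμe, map_sub, map_zsmul, ← hv, ← hw]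
          change (v : H → ℂ) - v (coroot w) • (w : H → ℂ) = _
          rw [hn, Int.cast_smul_eq_zsmul]
        rw [← heinj this]; exact hμ
      have hα2 : e α (coroot w) = 2 := by rw [← hw]; exact root_apply_coroot hw0
      have key : ∀ β ∈ Δ, e β (coroot w) = ((crn β α : ℝ) : ℂ) := by
        intro β hβ
        obtain ⟨n, hn, _⟩ := T β hβ
        obtain ⟨m, hm⟩ := R.crys α hα β hβ
        have it : ∀ k : ℕ, β + ((k : ℤ) * (m - n)) • α ∈ Δ := by
          intro k
          induction k with
          | zero => simpa using hβ
          | succ k ih =>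
            set γ := β + ((k : ℤ) * (m - n)) • α with hγ
            have c1 : crn γ α = ((m + 2 * (k * (m - n)) : ℤ) : ℝ) := by
              rw [hγ, crn_add, ← Int.cast_smul_eq_zsmul ℝ, crn_smul, crn_self (R.ne0 hα), hm]
              push_cast; ring
            have c2 : e γ (coroot w) = ((n + 2 * (k * (m - n)) : ℤ) : ℂ) := by
              rw [hγ, map_add, map_zsmul, Pi.add_apply, Pi.smul_apply, hα2, hn]
              push_cast; simp; ring
            have s1 := R.refl α hα γ ih
            unfold srf at s1
            rw [c1, Int.cast_smul_eq_zsmul] at s1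
            obtain ⟨p, hp, hp2⟩ := T _ s1
            rw [map_sub, map_zsmul, Pi.sub_apply, Pi.smul_apply, hα2, c2] at hp
            have hp' : p = n + 2 * (k * (m - n)) - (m + 2 * (k * (m - n))) * 2 := by
              have : ((n + 2 * (k * (m - n)) - (m + 2 * (k * (m - n))) * 2 : ℤ) : ℂ) = p := by
                rw [← hp]; push_cast; simp
              exact_mod_cast this.symm
            rw [hp', hγ] at hp2
            convert hp2 using 1
            push_cast
            module
        have hmn : m - n = 0 := by
          by_contra hne
          have hinj : Function.Injective (fun k : ℕ => β + ((k : ℤ) * (m - n)) • α) := by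
            intro a b hab
            simp only [add_right_inj] at hab
            rw [← sub_eq_zero, ← sub_smul, ← Int.cast_smul_eq_zsmul ℝ, smul_eq_zero, Int.cast_eq_zero] at hab
            rcases hab with h | h
            · rw [← sub_mul, mul_eq_zero] at h
              rcases h with h | h
              · omega
              · exact absurd h hne
            · exact absurd h (R.ne0 hα)
          exact Set.infinite_of_injective_forall_mem hinj it R.fin
        rw [hn, hm, show m = n by omega]; simp
      intro μ hμ
      induction hμ using AddSubgroup.closure_induction with
      | mem x hx => exact key x hx
      | zero => simp [crn_zero]
      | add a b _ _ h1 h2 => rw [map_add, Pi.add_apply, h1, h2, crn_add]; push_cast; rfl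
      | neg a _ h1 => rw [map_neg, Pi.neg_apply, h1, crn_neg]; push_cast; rfl
  choose! hv xv yv h1 h2 h3 h4 using main
  refine ⟨hv, xv, yv, heinj, ?_, ?_, ?_, h1, h2, h3, h4⟩
  · intro a b
    have := LieModule.IsTrivial.trivial (L := H) (M := H) a b
    simpa using congrArg Subtype.val this
  · intro μ h0 hμ
    by_contra hc
    obtain ⟨ν, hν, hh⟩ := hroots2 (e μ) (fun h => h0 (heinj (by rw [h, map_zero]))) hc
    exact hμ (heinj hh ▸ hν)
  · intro S hH hS
    have := LieAlgebra.cartan_sup_iSup_rootSpace_eq_top (K := ℂ) (H := H)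
    have := congrArg LieSubmodule.toSubmodule this
    rw [LieSubmodule.sup_toSubmodule, LieSubmodule.iSup_toSubmodule, LieSubmodule.top_toSubmodule] at this
    rw [eq_top_iff, ← this]
    refine sup_le hH (iSup_le fun w => ?_)
    rw [LieSubmodule.iSup_toSubmodule]
    refine iSup_le fun hw => ?_
    obtain ⟨μ, hμ, hh⟩ := wt2 w hw
    rw [hh, ← hwt_eq_root]
    exact hS μ hμ
end build


section sl2
variable {L : Type} [LieRing L] [LieAlgebra ℂ L] {X : Type} [AddCommGroup X] [Module ℂ X]
  [LieRingModule L X] [LieModule ℂ L X] [FiniteDimensional ℂ X]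

open LieModule in
lemma sl2_prim {h x y : L} (t : IsSl2Triple h x y) {u : X} {z : ℂ} (hu : u ≠ 0)
    (hz : ⁅h, u⁆ = z • u) : ∃ q : ℕ,
      t.HasPrimitiveVectorWith (((toEnd ℂ L X x) ^ q) u) (z + 2 * (q : ℂ)) := by
  let evals (n : ℕ) : ℂ := z + 2 * (n : ℂ)
  let e_vecs (n : ℕ) : X := ((toEnd ℂ L X x) ^ n) u
  have h_exists_zero : ∃ k, e_vecs k = 0 := by
    by_contra! contra
    have h_inj : Function.Injective evals := fun a b hab ↦ by
      simpa [evals, add_right_inj, mul_eq_mul_left_iff, Nat.cast_inj] using hab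
    have aux (μ : Set.range evals) :
        (toEnd ℂ L X h).HasEigenvector μ (e_vecs μ.property.choose) := by
      set n := μ.property.choose
      refine ⟨?_, contra n⟩
      rw [Module.End.mem_eigenspace_iff, toEnd_apply_apply, ← μ.property.choose_spec]
      exact t.lie_h_pow_toEnd_e hz n
    have _i := ((toEnd ℂ L X h).eigenvectors_linearIndependent (Set.range evals) _ aux).finite
    exact (Set.infinite_range_of_injective h_inj) (Set.toFinite _)
  obtain ⟨n, hn_ne, hn_zero⟩ := Nat.exists_not_and_succ_of_not_zero_of_exists
    (p := fun k => e_vecs k = 0) (by simpa [e_vecs] using hu) h_exists_zero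
  exact ⟨n,
    { ne_zero := hn_ne
      lie_h := t.lie_h_pow_toEnd_e hz n
      lie_e := by rwa [IsSl2Triple.lie_e_pow_toEnd_e n] }⟩

open LieModule in
lemma sl2_low {h x y : L} (t : IsSl2Triple h x y) {u : X} {n : ℕ} (hu : u ≠ 0)
    (hz : ⁅h, u⁆ = (n : ℂ) • u) : ∃ q : ℕ, 
      ((toEnd ℂ L X y) ^ (n + q)) (((toEnd ℂ L X x) ^ q) u) ≠ 0 := by
  obtain ⟨q, hq⟩ := sl2_prim t hu hz
  refine ⟨q, hq.pow_toEnd_f_ne_zero_of_eq_nat (n := n + 2 * q) ?_ (by omega)⟩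
  push_cast; rfl
end sl2

section hw
variable {L : Type} [LieRing L] [LieAlgebra ℂ L] {H : LieSubalgebra ℂ L}
  {X : Type} [AddCommGroup X] [Module ℂ X] [LieRingModule L X] [LieModule ℂ L X]

lemma mem_hwt {χ : H → ℂ} {v : X} : v ∈ hwt H X χ ↔ ∀ x : H, ⁅(x : L), v⁆ = χ x • v := Iff.rfl

lemma hwt_lie {χ ψ : H → ℂ} {x : L} {u : X} (hx : x ∈ hwt H L χ) (hu : u ∈ hwt H X ψ) :
    ⁅x, u⁆ ∈ hwt H X (χ + ψ) := by
  intro h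
  rw [leibniz_lie, hx h, hu h, smul_lie, lie_smul, ← add_smul]; rfl

variable {E : Type} [AddCommGroup E] {e : E →+ (H → ℂ)}

lemma hwt_lie' {a b c : E} {x : L} {u : X} (hx : x ∈ hwt H L (e a)) (hu : u ∈ hwt H X (e b))
    (h : a + b = c) : ⁅x, u⁆ ∈ hwt H X (e c) := by
  rw [← h, map_add]; exact hwt_lie hx hu

lemma hwt_pow {a b : E} {x : L} {u : X} (hx : x ∈ hwt H L (e a)) (hu : u ∈ hwt H X (e b))
    (n : ℕ) : ((LieModule.toEnd ℂ L X x) ^ n) u ∈ hwt H X (e (b + n • a)) := by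
  induction n with
  | zero => simpa using hu
  | succ n ih =>
    rw [pow_succ', Module.End.mul_apply, LieModule.toEnd_apply_apply]
    exact hwt_lie' hx ih (by rw [succ_nsmul]; abel)

lemma pow_mem_stable (U : Submodule ℂ X) {x : L} (h : ∀ u ∈ U, ⁅x, u⁆ ∈ U) {u : X} (hu : u ∈ U)
    (n : ℕ) : ((LieModule.toEnd ℂ L X x) ^ n) u ∈ U := by
  induction n with
  | zero => simpa using hu
  | succ n ih =>
    rw [pow_succ', Module.End.mul_apply, LieModule.toEnd_apply_apply]
    exact h _ ih

lemma comp_mem (U : Submodule ℂ X) (A : Set H) (hA : ∀ h ∈ A, ∀ u ∈ U, ⁅(h : L), u⁆ ∈ U)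
    (T : Finset E) (hsep : ∀ s ∈ T, ∀ t ∈ T, s ≠ t → ∃ h ∈ A, e s h ≠ e t h) :
    ∀ (u : E → X), (∀ t ∈ T, u t ∈ hwt H X (e t)) → ∑ t ∈ T, u t ∈ U → ∀ t ∈ T, u t ∈ U := by
  classical
  induction T using Finset.induction_on with
  | empty => simp
  | insert s T hs ih =>
    intro u hu hsum
    have ih' := ih (fun a ha b hb => hsep a (Finset.mem_insert_of_mem ha) b
      (Finset.mem_insert_of_mem hb))
    have key : ∀ t ∈ T, u t ∈ U := by
      intro t ht
      obtain ⟨h, hh, hne⟩ := hsep t (Finset.mem_insert_of_mem ht) s (Finset.mem_insert_self _ _)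
        (fun h => hs (h ▸ ht))
      have h1 := ih' (fun t => (e t h - e s h) • u t)
        (fun t ht => Submodule.smul_mem _ _ (hu t (Finset.mem_insert_of_mem ht))) (by
          have h2 := U.sub_mem (hA h hh _ hsum) (U.smul_mem (e s h) hsum)
          rw [lie_sum, Finset.smul_sum, ← Finset.sum_sub_distrib, Finset.sum_insert hs,
            hu s (Finset.mem_insert_self _ _) h, sub_self, zero_add] at h2
          convert h2 using 1
          refine Finset.sum_congr rfl fun t ht => ?_
          rw [hu t (Finset.mem_insert_of_mem ht) h, sub_smul]) t ht
      exact (U.smul_mem_iff (sub_ne_zero.2 hne)).1 h1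
    intro t ht
    rcases Finset.mem_insert.1 ht with rfl | ht
    · rw [Finset.sum_insert hs] at hsum
      have := U.sub_mem hsum (U.sum_mem key)
      simpa using this
    · exact key t ht

lemma hwt_indep [LieRing.IsNilpotent H] : iSupIndep (fun χ : H → ℂ => hwt H X χ) := by
  have h := LieModule.iSupIndep_genWeightSpace ℂ H X
  have h' : iSupIndep (fun χ : H → ℂ => (LieModule.genWeightSpace X χ).toSubmodule) := by
    rw [← LieSubmodule.iSupIndep_toSubmodule] at h; exact h
  refine h'.mono fun χ v hv => ?_
  have : v ∈ LieModule.weightSpace X χ := by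
    rw [LieModule.mem_weightSpace]
    intro x; exact hv x
  exact LieModule.weightSpace_le_genWeightSpace X χ this

/-- The stabiliser of a subspace. -/
def stab (L : Type) [LieRing L] [LieAlgebra ℂ L] {X : Type} [AddCommGroup X] [Module ℂ X]
    [LieRingModule L X] [LieModule ℂ L X] (U : Submodule ℂ X) : LieSubalgebra ℂ L where
  carrier := {x | ∀ u ∈ U, ⁅x, u⁆ ∈ U}
  add_mem' := by
    intro a b ha hb u hu
    rw [add_lie]; exact U.add_mem (ha u hu) (hb u hu)
  zero_mem' := by intro u hu; rw [zero_lie]; exact U.zero_mem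
  smul_mem' := by intro c x hx u hu; rw [smul_lie]; exact U.smul_mem _ (hx u hu)
  lie_mem' := by
    intro a b ha hb u hu
    rw [lie_lie]; exact U.sub_mem (ha _ (hb u hu)) (hb _ (ha u hu))

lemma mem_stab {U : Submodule ℂ X} {x : L} : x ∈ stab L U ↔ ∀ u ∈ U, ⁅x, u⁆ ∈ U := Iff.rfl

lemma span_stab {U : Submodule ℂ X} {x : L} (h : x ∈ stab L U) : (ℂ ∙ x) ≤ (stab L U).toSubmodule :=
  (Submodule.span_singleton_le_iff_mem _ _).2 h
end hw

namespace LI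
variable {E : Type} [NormedAddCommGroup E] [InnerProductSpace ℝ E] [FiniteDimensional ℝ E]
    {Δ Δs Δl Δp Φ Φs : Set E} {ls ll : ℝ} {θs : E}
    {L : Type} [LieRing L] [LieAlgebra ℂ L] {H : LieSubalgebra ℂ L}
    {e : E →+ (H → ℂ)} {hv : E → H} {xv yv : E → L} (I : LI Δ H e hv xv yv)
    (R : RSys Δ Δs Δl Δp Φ Φs ls ll θs)
    {X : Type} [AddCommGroup X] [Module ℂ X] [LieRingModule L X] [LieModule ℂ L X]
include I

lemma xmem {α : E} (h : α ∈ Δ) : xv α ∈ hwt H L (e α) := by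
  rw [I.hx α h]; exact Submodule.mem_span_singleton_self _
lemma ymem {α : E} (h : α ∈ Δ) : yv α ∈ hwt H L (e (-α)) := by
  rw [I.hy α h]; exact Submodule.mem_span_singleton_self _

lemma hact {α : E} (h : α ∈ Δ) {μ : E} (hμ : μ ∈ AddSubgroup.closure Δ) {u : X}
    (hu : u ∈ hwt H X (e μ)) : ⁅(hv α : L), u⁆ = ((crn μ α : ℝ) : ℂ) • u := by
  rw [hu (hv α), I.ev α h μ hμ]

include R
lemma crn_int {α : E} (h : α ∈ Δ) {μ : E} (hμ : μ ∈ AddSubgroup.closure Δ) :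
    ∃ n : ℤ, crn μ α = n := by
  induction hμ using AddSubgroup.closure_induction with
  | mem x hx => exact R.crys α h x hx
  | zero => exact ⟨0, by simp [crn_zero]⟩
  | add a b _ _ h1 h2 =>
    obtain ⟨n, hn⟩ := h1
    obtain ⟨m, hm⟩ := h2
    exact ⟨n + m, by rw [crn_add, hn, hm]; push_cast; rfl⟩
  | neg a _ h1 =>
    obtain ⟨n, hn⟩ := h1
    exact ⟨-n, by rw [crn_neg, hn]; push_cast; rfl⟩

lemma reflect [FiniteDimensional ℂ X] {α : E} (hα : α ∈ Δ) (U : Submodule ℂ X)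
    (hx : ∀ u ∈ U, ⁅xv α, u⁆ ∈ U) (hy : ∀ u ∈ U, ⁅yv α, u⁆ ∈ U) {μ : E}
    (hμ : μ ∈ AddSubgroup.closure Δ) {u : X} (huU : u ∈ U) (hu : u ∈ hwt H X (e μ)) (h0 : u ≠ 0) :
    ∃ u' ∈ U, u' ∈ hwt H X (e (srf α μ)) ∧ u' ≠ 0 := by
  obtain ⟨n, hn⟩ := I.crn_int R hα hμ
  have ha := I.hact hα hμ hu
  have ht := I.sl2 α hα
  unfold srf
  rw [hn] at ha ⊢
  rw [Int.cast_smul_eq_zsmul]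
  rcases Int.eq_nat_or_neg n with ⟨k, rfl | rfl⟩
  · obtain ⟨q, hq⟩ := sl2_low ht (n := k) h0 (by rw [ha]; simp)
    refine ⟨_, pow_mem_stable U hy (pow_mem_stable U hx huU q) (k + q), ?_, hq⟩
    convert hwt_pow (I.ymem hα) (hwt_pow (I.xmem hα) hu q) (k + q) using 3
    rw [add_smul, smul_neg, smul_neg, natCast_zsmul]; abel
  · obtain ⟨q, hq⟩ := sl2_low ht.symm (n := k) h0 (by rw [neg_lie, ha]; simp)
    refine ⟨_, pow_mem_stable U hx (pow_mem_stable U hy huU q) (k + q), ?_, hq⟩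
    convert hwt_pow (I.xmem hα) (hwt_pow (I.ymem hα) hu q) (k + q) using 3
    rw [add_smul, neg_smul, smul_neg, natCast_zsmul]; abel

/-- `x_α^n` is injective when `y_α u = 0`. -/
lemma xpow_inj [FiniteDimensional ℂ X] {α : E} (hα : α ∈ Δ) {μ : E}
    (hμ : μ ∈ AddSubgroup.closure Δ) {n : ℕ} (hn : crn μ α = -(n : ℝ)) {u : X}
    (hu : u ∈ hwt H X (e μ)) (h0 : u ≠ 0) (hyu : ⁅yv α, u⁆ = 0) :
    ((LieModule.toEnd ℂ L X (xv α)) ^ n) u ∈ hwt H X (e (srf α μ)) ∧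
    ((LieModule.toEnd ℂ L X (xv α)) ^ n) u ≠ 0 := by
  have ha := I.hact hα hμ hu
  rw [hn] at ha
  constructor
  · convert hwt_pow (I.xmem hα) hu n using 3
    unfold srf; rw [hn, neg_smul, Nat.cast_smul_eq_nsmul]; abel
  · have P : (I.sl2 α hα).symm.HasPrimitiveVectorWith u (n : ℂ) :=
      ⟨h0, by rw [neg_lie, ha]; simp, hyu⟩
    exact P.pow_toEnd_f_ne_zero_of_eq_nat rfl le_rfl

/-- Subalgebras containing the simple root vectors and `H`. -/
lemma gen_top [FiniteDimensional ℂ L] (S : LieSubalgebra ℂ L) (hH : H ≤ S)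
    (hx : ∀ α ∈ Φ, xv α ∈ S) (hy : ∀ α ∈ Φ, yv α ∈ S) : S = ⊤ := by
  have key := R.link (Ψ := Φ) subset_rfl (fun γ => γ ∈ Δ → hwt H L (e γ) ≤ S.toSubmodule)
    (by
      intro α hα h
      rw [I.hx α h, Submodule.span_singleton_le_iff_mem]; exact hx α hα)
    (by
      intro α hα γ hγ _ h hs
      obtain ⟨u', h1, h2, h3⟩ := I.reflect R (R.ΦΔ hα) S.toSubmodule
        (fun u hu => S.lie_mem (hx α hα) hu) (fun u hu => S.lie_mem (hy α hα) hu)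
        (AddSubgroup.subset_closure hγ) (h hγ (I.xmem hγ)) (I.xmem hγ) (I.sl2 γ hγ).e_ne_zero
      rw [I.hx _ hs] at h2 ⊢
      rw [Submodule.span_singleton_le_iff_mem]
      obtain ⟨c, rfl⟩ := Submodule.mem_span_singleton.1 h2
      exact (S.toSubmodule.smul_mem_iff (fun h => h3 (by rw [h, zero_smul]))).1 h1)
  have := I.gen S.toSubmodule hH (fun μ hμ => key μ hμ (R.mem_closure hμ) hμ)
  exact (LieSubalgebra.toSubmodule_eq_top S).1 this

end LI


lemma RSys.simple_sub {E : Type} [NormedAddCommGroup E] [InnerProductSpace ℝ E]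
    [FiniteDimensional ℝ E] {Δ Δs Δl Δp Φ Φs : Set E} {ls ll : ℝ} {θs : E}
    (R : RSys Δ Δs Δl Δp Φ Φs ls ll θs) {a b : E} (ha : a ∈ Φ) (hb : b ∈ Φ) (h : a ≠ b) :
    a - b ∉ Δ := by
  intro h1
  have e1 := R.co_self ⟨a, ha⟩
  have e2 := R.co_self ⟨b, hb⟩
  have e3 := R.co_ne ⟨a, ha⟩ hb (Ne.symm h)
  have e4 := R.co_ne ⟨b, hb⟩ ha h
  simp only at e1 e2
  rcases R.Δ_cases h1 with h2 | h2
  · have := R.co_nonneg h2 ⟨b, hb⟩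
    rw [map_sub] at this; linarith
  · have := R.co_nonneg h2 ⟨a, ha⟩
    rw [neg_sub, map_sub] at this; linarith

/-- Smallest subspace containing `w` and stable under `y_α`, `α ∈ Ψ`. -/
def wsp {E L : Type} [LieRing L] [LieAlgebra ℂ L] (yv : E → L) (Ψ : Set E)
    {X : Type} [AddCommGroup X] [Module ℂ X] [LieRingModule L X] [LieModule ℂ L X] (w : X) :
    Submodule ℂ X :=
  sInf {S | w ∈ S ∧ ∀ α ∈ Ψ, ∀ u ∈ S, ⁅yv α, u⁆ ∈ S}

section wsp
variable {E L : Type} [LieRing L] [LieAlgebra ℂ L] {yv : E → L} {Ψ : Set E}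
    {X : Type} [AddCommGroup X] [Module ℂ X] [LieRingModule L X] [LieModule ℂ L X] {w : X}

lemma wsp_self : w ∈ wsp yv Ψ w := by
  rw [wsp, Submodule.mem_sInf]; exact fun S hS => hS.1

lemma wsp_y {α : E} (hα : α ∈ Ψ) {u : X} (hu : u ∈ wsp yv Ψ w) : ⁅yv α, u⁆ ∈ wsp yv Ψ w := by
  rw [wsp, Submodule.mem_sInf] at hu ⊢
  exact fun S hS => hS.2 α hα u (hu S hS)

lemma wsp_le {S : Submodule ℂ X} (h1 : w ∈ S) (h2 : ∀ α ∈ Ψ, ∀ u ∈ S, ⁅yv α, u⁆ ∈ S) :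
    wsp yv Ψ w ≤ S := sInf_le ⟨h1, h2⟩

lemma wsp_le' {S : Submodule ℂ X} (h1 : w ∈ S)
    (h2 : ∀ α ∈ Ψ, ∀ u ∈ S, u ∈ wsp yv Ψ w → ⁅yv α, u⁆ ∈ S) : wsp yv Ψ w ≤ S := by
  have : wsp yv Ψ w ≤ S ⊓ wsp yv Ψ w :=
    wsp_le ⟨h1, wsp_self⟩ fun α hα u hu => ⟨h2 α hα u hu.1 hu.2, wsp_y hα hu.2⟩
  exact this.trans inf_le_left
end wsp

namespace LI
variable {E : Type} [NormedAddCommGroup E] [InnerProductSpace ℝ E] [FiniteDimensional ℝ E]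
    {Δ Δs Δl Δp Φ Φs : Set E} {ls ll : ℝ} {θs : E}
    {L : Type} [LieRing L] [LieAlgebra ℂ L] {H : LieSubalgebra ℂ L}
    {e : E →+ (H → ℂ)} {hv : E → H} {xv yv : E → L} (I : LI Δ H e hv xv yv)
    (R : RSys Δ Δs Δl Δp Φ Φs ls ll θs)
    {X : Type} [AddCommGroup X] [Module ℂ X] [LieRingModule L X] [LieModule ℂ L X]
include I R

lemma wsp_h {Ψ : Set E} (hΨ : Ψ ⊆ Φ) {w : X} {μ : E} (hw : w ∈ hwt H X (e μ)) :
    H ≤ stab L (wsp yv Ψ w) := by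
  intro h hh
  have : wsp yv Ψ w ≤ (wsp yv Ψ w).comap (adm L X h) := by
    apply wsp_le'
    · change ⁅h, w⁆ ∈ wsp yv Ψ w
      rw [hw ⟨h, hh⟩]; exact Submodule.smul_mem _ _ wsp_self
    · intro α hα u hu hu2
      change ⁅h, ⁅yv α, u⁆⁆ ∈ wsp yv Ψ w
      have h1 : ⁅h, yv α⁆ = _ := I.ymem (R.ΦΔ (hΨ hα)) ⟨h, hh⟩
      rw [leibniz_lie, h1, smul_lie]
      exact Submodule.add_mem _ (Submodule.smul_mem _ _ (wsp_y hα hu2)) (wsp_y hα hu)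
  exact this

lemma xy_zero {α β : E} (hα : α ∈ Φ) (hβ : β ∈ Φ) (h : α ≠ β) : ⁅xv α, yv β⁆ = 0 := by
  have := hwt_lie' (I.xmem (R.ΦΔ hα)) (I.ymem (R.ΦΔ hβ)) (sub_eq_add_neg α β).symm
  rw [I.none _ (sub_ne_zero.2 h) (R.simple_sub hα hβ h)] at this
  exact this

lemma wsp_x {Ψ : Set E} (hΨ : Ψ ⊆ Φ) {w : X} {μ : E} (hw : w ∈ hwt H X (e μ))
    (hk : ∀ α ∈ Ψ, ⁅xv α, w⁆ = 0) {α : E} (hα : α ∈ Ψ) : xv α ∈ stab L (wsp yv Ψ w) := by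
  have : wsp yv Ψ w ≤ (wsp yv Ψ w).comap (adm L X (xv α)) := by
    apply wsp_le'
    · change ⁅xv α, w⁆ ∈ wsp yv Ψ w
      rw [hk α hα]; exact Submodule.zero_mem _
    · intro β hβ u hu hu2
      change ⁅xv α, ⁅yv β, u⁆⁆ ∈ wsp yv Ψ w
      rw [leibniz_lie]
      refine Submodule.add_mem _ ?_ (wsp_y hβ hu)
      by_cases hab : α = β
      · subst hab
        rw [(I.sl2 α (R.ΦΔ (hΨ hα))).lie_e_f]
        exact I.wsp_h R hΨ hw (hv α).2 u hu2
      · rw [I.xy_zero R (hΨ hα) (hΨ hβ) hab, zero_lie]; exact Submodule.zero_mem _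
  exact this

/-- sum of lower weight spaces -/
lemma wsp_wt {Ψ : Set E} (hΨ : Ψ ⊆ Φ) {w : X} {μ : E} (hw : w ∈ hwt H X (e μ)) :
    wsp yv Ψ w ≤ (ℂ ∙ w) ⊔ ⨆ ν ∈ {ν | ∃ δ ∈ AddSubmonoid.closure Ψ, δ ≠ 0 ∧ ν = μ - δ},
      hwt H X (e ν) := by
  apply wsp_le
  · exact Submodule.mem_sup_left (Submodule.mem_span_singleton_self _)
  · intro α hα u hu
    have hαΦ := hΨ hα
    set Q := ⨆ ν ∈ {ν | ∃ δ ∈ AddSubmonoid.closure Ψ, δ ≠ 0 ∧ ν = μ - δ}, hwt H X (e ν) with hQ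
    have hle : ∀ δ ∈ AddSubmonoid.closure Ψ, δ ≠ 0 → hwt H X (e (μ - δ)) ≤ Q := by
      intro δ h1 h2
      exact le_iSup₂_of_le (f := fun ν (_ : ν ∈ {ν | ∃ δ ∈ AddSubmonoid.closure Ψ, δ ≠ 0 ∧ ν = μ - δ}) => hwt H X (e ν)) (μ - δ) ⟨δ, h1, h2, rfl⟩ le_rfl
    have : (ℂ ∙ w) ⊔ Q ≤ Q.comap (adm L X (yv α)) := by
      refine sup_le ?_ (iSup₂_le ?_)
      · rw [Submodule.span_singleton_le_iff_mem]
        exact hle α (AddSubmonoid.subset_closure hα) (R.ne0 (R.ΦΔ hαΦ))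
          (hwt_lie' (I.ymem (R.ΦΔ hαΦ)) hw (by abel))
      · rintro ν ⟨δ, h1, h2, rfl⟩ v hv
        refine hle (δ + α) (AddSubmonoid.add_mem _ h1 (AddSubmonoid.subset_closure hα)) ?_
          (hwt_lie' (I.ymem (R.ΦΔ hαΦ)) hv (by abel))
        intro h
        have := congrArg R.ht h
        rw [map_add, R.ht_simple hαΦ, map_zero] at this
        have := (R.ht_nonneg_closure hΨ h1).1
        linarith
    exact Submodule.mem_sup_right (this hu)

/-- for a highest weight vector, the words span a submodule -/
lemma wsp_top [FiniteDimensional ℂ L] {w : X} {μ : E} (hw : w ∈ hwt H X (e μ))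
    (hk : ∀ α ∈ Φ, ⁅xv α, w⁆ = 0) : stab L (wsp yv Φ w) = ⊤ :=
  I.gen_top R _ (I.wsp_h R subset_rfl hw) (fun α hα => I.wsp_x R subset_rfl hw hk hα)
    (fun α hα => fun u hu => wsp_y hα hu)

/-- A submodule stable under everything. -/
lemma wsp_eq_top [FiniteDimensional ℂ L] (hs : ∀ N : LieSubmodule ℂ L X, N = ⊥ ∨ N = ⊤)
    {w : X} {μ : E} (hw : w ∈ hwt H X (e μ)) (h0 : w ≠ 0)
    (hk : ∀ α ∈ Φ, ⁅xv α, w⁆ = 0) : wsp yv Φ w = ⊤ := by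
  have h1 := I.wsp_top R hw hk
  let N : LieSubmodule ℂ L X := ⟨wsp yv Φ w, by
    intro x m hm
    have : x ∈ stab L (wsp yv Φ w) := by rw [h1]; trivial
    exact this m hm⟩
  rcases hs N with h | h
  · have : w ∈ N := wsp_self (Ψ := Φ) (yv := yv)
    rw [h] at this
    exact absurd this h0
  · exact congrArg LieSubmodule.toSubmodule h

end LI


lemma indep_zero {L : Type} [LieRing L] [LieAlgebra ℂ L] {H : LieSubalgebra ℂ L}
    [LieRing.IsNilpotent H]
    {X : Type} [AddCommGroup X] [Module ℂ X] [LieRingModule L X] [LieModule ℂ L X]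
    {χ : H → ℂ} {u : X} (hu : u ∈ hwt H X χ) {S : Submodule ℂ X} (hS : u ∈ S)
    (h : S ≤ ⨆ ψ, ⨆ (_ : ψ ≠ χ), hwt H X ψ) : u = 0 := by
  have := (hwt_indep (H := H) (X := X)) χ
  exact (Submodule.disjoint_def.1 this) u hu (h hS)

namespace LI
variable {E : Type} [NormedAddCommGroup E] [InnerProductSpace ℝ E] [FiniteDimensional ℝ E]
    {Δ Δs Δl Δp Φ Φs : Set E} {ls ll : ℝ} {θs : E}
    {L : Type} [LieRing L] [LieAlgebra ℂ L] [FiniteDimensional ℂ L] {H : LieSubalgebra ℂ L}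
    [LieRing.IsNilpotent H]
    {e : E →+ (H → ℂ)} {hv : E → H} {xv yv : E → L} (I : LI Δ H e hv xv yv)
    (R : RSys Δ Δs Δl Δp Φ Φs ls ll θs)
    {X : Type} [AddCommGroup X] [Module ℂ X] [LieRingModule L X] [LieModule ℂ L X]
    [FiniteDimensional ℂ X]
    (hs : ∀ N : LieSubmodule ℂ L X, N = ⊥ ∨ N = ⊤)
include I R hs

lemma wt_form {w : X} {μ : E} (hw : w ∈ hwt H X (e μ)) (h0 : w ≠ 0)
    (hk : ∀ α ∈ Φ, ⁅xv α, w⁆ = 0) {χ : H → ℂ} (hχ : hwt H X χ ≠ ⊥) :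
    ∃ δ ∈ AddSubmonoid.closure Φ, χ = e (μ - δ) := by
  by_contra hc
  push Not at hc
  apply hχ
  rw [Submodule.eq_bot_iff]
  intro u hu
  have h1 := I.wsp_wt R subset_rfl hw
  rw [I.wsp_eq_top R hs hw h0 hk] at h1
  refine indep_zero hu (h1 trivial) (sup_le ?_ (iSup₂_le ?_))
  · rw [Submodule.span_singleton_le_iff_mem]
    refine (le_iSup₂_of_le (f := fun ψ (_ : ψ ≠ χ) => hwt H X ψ) (e μ) ?_ le_rfl) hw
    intro h
    exact hc 0 (AddSubmonoid.zero_mem _) (by rw [sub_zero, h])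
  · rintro ν ⟨δ, h1, h2, rfl⟩
    exact le_iSup₂_of_le (f := fun ψ (_ : ψ ≠ χ) => hwt H X ψ) _ (fun h => hc δ h1 h.symm) le_rfl

lemma hw_one {w : X} {μ : E} (hw : w ∈ hwt H X (e μ)) (h0 : w ≠ 0)
    (hk : ∀ α ∈ Φ, ⁅xv α, w⁆ = 0) : hwt H X (e μ) ≤ ℂ ∙ w := by
  intro u hu
  have h1 := I.wsp_wt R subset_rfl hw
  rw [I.wsp_eq_top R hs hw h0 hk] at h1
  obtain ⟨a, ha, r, hr, hh⟩ := Submodule.mem_sup.1 (h1 (trivial : u ∈ (⊤ : Submodule ℂ X)))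
  obtain ⟨c, rfl⟩ := Submodule.mem_span_singleton.1 ha
  have hr2 : r ∈ hwt H X (e μ) := by
    rw [← eq_sub_iff_add_eq'] at hh
    rw [hh]; exact Submodule.sub_mem _ hu (Submodule.smul_mem _ _ hw)
  have : r = 0 := by
    refine indep_zero hr2 hr (iSup₂_le ?_)
    rintro ν ⟨δ, h1, h2, rfl⟩
    refine le_iSup₂_of_le (f := fun ψ (_ : ψ ≠ e μ) => hwt H X ψ) _ (fun h => h2 ?_) le_rfl
    simpa using I.inj h
  rw [← hh, this, add_zero]; exact ha

variable {v : X} (hv0 : v ≠ 0) (hvθ : v ∈ hwt H X (e θs)) (hvk : ∀ α ∈ Φ, ⁅xv α, v⁆ = 0)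
include hv0 hvθ hvk

lemma wt_latt {γ : E} (h : hwt H X (e γ) ≠ ⊥) : ∃ δ ∈ AddSubmonoid.closure Φ, γ = θs - δ := by
  obtain ⟨δ, h1, h2⟩ := I.wt_form R hs hvθ hv0 hvk h
  exact ⟨δ, h1, I.inj h2⟩

lemma wt_clos {γ : E} (h : hwt H X (e γ) ≠ ⊥) : γ ∈ AddSubgroup.closure Δ := by
  obtain ⟨δ, h1, rfl⟩ := I.wt_latt R hs hv0 hvθ hvk h
  refine AddSubgroup.sub_mem _ (AddSubgroup.subset_closure R.θΔ) ?_
  have : AddSubmonoid.closure Φ ≤ (AddSubgroup.closure Δ).toAddSubmonoid :=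
    AddSubmonoid.closure_le.2 fun x hx => AddSubgroup.subset_closure (R.ΦΔ hx)
  exact this h1

lemma wt_short {γ : E} (h : hwt H X (e γ) ≠ ⊥) : γ = 0 ∨ γ ∈ Δs := by
  apply R.short_lattice (I.wt_clos R hs hv0 hvθ hvk h)
  let Wt : Set E := {γ | hwt H X (e γ) ≠ ⊥}
  have hfin : Wt.Finite := by
    have h1 : iSupIndep (fun γ : E => hwt H X (e γ)) := (hwt_indep (H := H) (X := X)).comp I.inj
    exact WellFoundedGT.finite_ne_bot_of_iSupIndep h1
  obtain ⟨γ1, h1, hmax1⟩ := Set.exists_max_image Wt (fun γ => ‖γ‖) hfin ⟨γ, h⟩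
  let W2 : Set E := {γ ∈ Wt | ‖γ‖ = ‖γ1‖}
  obtain ⟨γ2, h2, hmax2⟩ := Set.exists_max_image W2 (fun γ => R.ht γ)
    (hfin.subset (fun x hx => hx.1)) ⟨γ1, h1, rfl⟩
  have hdom : ∀ α ∈ Φ, 0 ≤ ⟪γ2, α⟫ := by
    intro α hα
    by_contra hc
    push Not at hc
    have hαΔ := R.ΦΔ hα
    obtain ⟨u, hu, hu0⟩ := Submodule.exists_mem_ne_zero_of_ne_bot h2.1
    obtain ⟨u', _, h4, h5⟩ := I.reflect R hαΔ ⊤ (fun _ _ => trivial) (fun _ _ => trivial)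
      (I.wt_clos R hs hv0 hvθ hvk h2.1) (trivial : u ∈ ⊤) hu hu0
    have h6 : srf α γ2 ∈ W2 := by
      refine ⟨fun hb => ?_, by rw [norm_srf (R.ne0 hαΔ)]; exact h2.2⟩
      rw [hb] at h4; exact h5 h4
    have h7 := hmax2 _ h6
    simp only [srf] at h7
    rw [map_sub, map_smul, R.ht_simple hα] at h7
    have := (crn_neg_iff (R.ne0 hαΔ) γ2).2 hc
    simp at h7; linarith
  obtain ⟨δ, hδ, hh⟩ := I.wt_latt R hs hv0 hvθ hvk h2.1
  have k1 := R.inner_nonneg_closure hdom hδ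
  have k2 := R.inner_nonneg_closure (x := θs) (fun α hα => R.θdom hα) hδ
  have hδ' : δ = θs - γ2 := by rw [hh]; abel
  rw [hδ', inner_sub_right] at k1 k2
  rw [real_inner_self_eq_norm_sq] at k1 k2
  rw [real_inner_comm] at k1
  have hn : ‖θs‖ = ls := R.short_norm R.θmem.1
  have h3 : ‖γ‖ ≤ ‖γ2‖ := by rw [h2.2]; exact hmax1 γ h
  have : ‖γ2‖ ≤ ls := by
    rw [← hn]
    exact (pow_le_pow_iff_left₀ (norm_nonneg _) (norm_nonneg _) two_ne_zero).1 (by linarith)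
  exact h3.trans this

lemma wt_short' {χ : H → ℂ} (h : hwt H X χ ≠ ⊥) : ∃ γ, χ = e γ ∧ (γ = 0 ∨ γ ∈ Δs) := by
  obtain ⟨δ, h1, rfl⟩ := I.wt_form R hs hvθ hv0 hvk h
  exact ⟨_, rfl, I.wt_short R hs hv0 hvθ hvk h⟩

lemma wt_none {γ : E} (h0 : γ ≠ 0) (h : γ ∉ Δs) : hwt H X (e γ) = ⊥ := by
  by_contra hc
  rcases I.wt_short R hs hv0 hvθ hvk hc with h1 | h1
  exacts [h0 h1, h h1]

lemma wt_one {γ : E} (h : γ ∈ Δs) : hwt H X (e γ) ≠ ⊥ ∧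
    ∀ u ∈ hwt H X (e γ), u ≠ 0 → hwt H X (e γ) ≤ ℂ ∙ u := by
  have one_of : ∀ γ (w : X), hwt H X (e γ) ≤ ℂ ∙ w → 
      ∀ u ∈ hwt H X (e γ), u ≠ 0 → hwt H X (e γ) ≤ ℂ ∙ u := by
    intro γ w hw u hu hu0
    obtain ⟨c, rfl⟩ := Submodule.mem_span_singleton.1 (hw hu)
    have hc : c ≠ 0 := fun h => hu0 (by rw [h, zero_smul])
    rwa [Submodule.span_singleton_smul_eq (IsUnit.mk0 c hc)]
  obtain ⟨C, hC⟩ : ∃ C : ℝ, ∀ γ ∈ Δ, R.ht γ < C := by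
    obtain ⟨γ1, h1, hmax1⟩ := Set.exists_max_image Δ (fun γ => R.ht γ) R.fin ⟨θs, R.θΔ⟩
    exact ⟨R.ht γ1 + 1, fun γ hγ => by have := hmax1 γ hγ; linarith⟩
  have key : ∀ n : ℕ, ∀ γ ∈ Δs, C - n ≤ R.ht γ → (hwt H X (e γ) ≠ ⊥ ∧
    ∀ u ∈ hwt H X (e γ), u ≠ 0 → hwt H X (e γ) ≤ ℂ ∙ u) := by
    intro n
    induction n with
    | zero =>
      intro γ hγ hle
      have := hC γ (R.ΔsΔ hγ)
      simp at hle; linarith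
    | succ n ih =>
      intro γ hγ hle
      by_cases hne : γ = θs
      · subst hne
        refine ⟨fun h => ?_, one_of _ v (I.hw_one R hs hvθ hv0 hvk)⟩
        rw [h] at hvθ; exact hv0 hvθ
      obtain ⟨α, hα, hneg⟩ := R.exists_neg hγ hne
      have hαΔ := R.ΦΔ hα
      have hα0 := R.ne0 hαΔ
      have hγΔ := R.ΔsΔ hγ
      have hγc := AddSubgroup.subset_closure hγΔ
      have hcn := (crn_neg_iff hα0 γ).2 hneg
      obtain ⟨m, hm⟩ := R.crys α hαΔ γ hγΔ
      obtain ⟨k, hk⟩ : ∃ k : ℕ, m = -(k : ℤ) := by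
        have : m < 0 := by rw [hm] at hcn; exact_mod_cast hcn
        exact ⟨(-m).toNat, by omega⟩
      have hm2 : crn γ α = -(k : ℝ) := by rw [hm, hk]; push_cast; rfl
      have hk1 : (1 : ℝ) ≤ k := by
        have : (0 : ℝ) < k := by linarith
        have : 0 < k := by exact_mod_cast this
        exact_mod_cast this
      have hsΔ : srf α γ ∈ Δs := by
        rw [R.hΔs]
        exact ⟨R.refl α hαΔ γ hγΔ, by rw [norm_srf hα0]; exact R.short_norm hγ⟩
      have hht : R.ht (srf α γ) = R.ht γ + k := by
        unfold srf
        rw [hm2, map_sub, map_smul, R.ht_simple hα]; simp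
      obtain ⟨ih1, ih2⟩ := ih _ hsΔ (by rw [hht]; push_cast at hle; linarith)
      have hy0 : ∀ u ∈ hwt H X (e γ), ⁅yv α, u⁆ = 0 := by
        intro u hu
        have h1 := hwt_lie' (I.ymem hαΔ) hu (by abel : -α + γ = γ - α)
        have h2 : ls < ‖γ - α‖ := by
          have h3 := norm_sub_sq_real γ α
          rw [R.short_norm hγ] at h3
          have h4 := R.norm_ge hαΔ
          have h5 := R.h0ls
          by_contra hc
          push Not at hc
          nlinarith [norm_nonneg (γ - α)]
        rw [I.wt_none R hs hv0 hvθ hvk] at h1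
        · exact h1
        · intro h; rw [h, norm_zero] at h2; linarith [R.h0ls]
        · intro h; rw [R.short_norm h] at h2; exact lt_irrefl _ h2
      constructor
      · obtain ⟨u, hu, hu0⟩ := Submodule.exists_mem_ne_zero_of_ne_bot ih1
        obtain ⟨u', _, h4, h5⟩ := I.reflect R hαΔ ⊤ (fun _ _ => trivial) (fun _ _ => trivial)
          (AddSubgroup.subset_closure (R.ΔsΔ hsΔ)) (trivial : u ∈ ⊤) hu hu0
        rw [srf_srf hα0] at h4
        intro hb; rw [hb] at h4; exact h5 h4
      · intro u hu hu0 u2 hu2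
        obtain ⟨h1, h2⟩ := I.xpow_inj R hαΔ hγc hm2 hu hu0 (hy0 u hu)
        have hz : ∀ z ∈ hwt H X (e γ), ((LieModule.toEnd ℂ L X (xv α)) ^ k) z = 0 → z = 0 := by
          intro z hz hz0
          by_contra hc
          exact (I.xpow_inj R hαΔ hγc hm2 hz hc (hy0 z hz)).2 hz0
        have h3 : ((LieModule.toEnd ℂ L X (xv α)) ^ k) u2 ∈ hwt H X (e (srf α γ)) := by
          by_cases h : u2 = 0
          · rw [h, map_zero]; exact Submodule.zero_mem _
          · exact (I.xpow_inj R hαΔ hγc hm2 hu2 h (hy0 u2 hu2)).1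
        obtain ⟨c, hc⟩ := Submodule.mem_span_singleton.1 (ih2 _ h1 h2 h3)
        have := hz (c • u - u2) (Submodule.sub_mem _ (Submodule.smul_mem _ _ hu) hu2)
          (by rw [map_sub, map_smul, hc, sub_self])
        exact Submodule.mem_span_singleton.2 ⟨c, sub_eq_zero.1 this⟩
  obtain ⟨n, hn⟩ := exists_nat_ge (C - R.ht γ)
  exact key n γ h (by linarith)

omit hvk hv0 hvθ hs [LieRing.IsNilpotent H] [FiniteDimensional ℂ L] [FiniteDimensional ℂ X] I in
lemma _root_.RSys.not_short {α : E} (hα : α ∈ Φ) (h : α ∉ Φs) : α ∉ Δs := by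
  intro h'
  apply h
  rw [R.hΦs]
  exact ⟨hα, h'⟩

lemma zero_le : hwt H X (e 0) ≤ ⨆ α ∈ Φs, (hwt H X (e α)).map (adm L X (yv α)) := by
  set Z := ⨆ α ∈ Φs, (hwt H X (e α)).map (adm L X (yv α)) with hZ
  set Y := ⨆ ψ, ⨆ (_ : ψ ≠ e 0), hwt H X ψ with hY
  have hYle : ∀ ψ, ψ ≠ e 0 → hwt H X ψ ≤ Y := fun ψ h =>
    le_iSup₂_of_le (f := fun ψ (_ : ψ ≠ e 0) => hwt H X ψ) ψ h le_rfl
  have hZ0 : Z ≤ hwt H X (e 0) := by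
    refine iSup₂_le fun α hα => ?_
    rintro _ ⟨u, hu, rfl⟩
    exact hwt_lie' (I.ymem (R.ΦsΔ hα)) hu (by abel)
  have h1 : wsp yv Φ v ≤ Y ⊔ Z := by
    apply wsp_le
    · refine Submodule.mem_sup_left (hYle (e θs) ?_ hvθ)
      intro h; exact R.ne0 R.θΔ (I.inj h)
    · intro α hα
      have hαΔ := R.ΦΔ hα
      have : Y ⊔ Z ≤ (Y ⊔ Z).comap (adm L X (yv α)) := by
        refine sup_le (iSup₂_le fun ψ hψ u hu => ?_) fun u hu => ?_
        · by_cases h : ψ = e α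
          · subst h
            by_cases hs' : α ∈ Φs
            · refine Submodule.mem_sup_right ?_
              exact (le_iSup₂_of_le (f := fun α (_ : α ∈ Φs) => (hwt H X (e α)).map (adm L X (yv α)))
                α hs' le_rfl) ⟨u, hu, rfl⟩
            · rw [I.wt_none R hs hv0 hvθ hvk (R.ne0 hαΔ) (R.not_short hα hs')] at hu
              rw [(Submodule.mem_bot ℂ).1 hu]; exact Submodule.zero_mem _
          · refine Submodule.mem_sup_left (hYle (e (-α) + ψ) ?_ (hwt_lie (I.ymem hαΔ) hu))
            intro h'
            apply h
            rw [map_neg, map_zero] at h'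
            exact (neg_add_eq_zero.1 h').symm
        · refine Submodule.mem_sup_left (hYle (e (-α)) ?_
            (hwt_lie' (I.ymem hαΔ) (hZ0 hu) (by abel)))
          intro h; exact R.ne0 hαΔ (by simpa using I.inj h)
      exact fun u hu => this hu
  rw [I.wsp_eq_top R hs hvθ hv0 hvk] at h1
  intro u hu
  obtain ⟨a, ha, z, hz, hh⟩ := Submodule.mem_sup.1 (h1 (trivial : u ∈ (⊤ : Submodule ℂ X)))
  have ha2 : a ∈ hwt H X (e 0) := by
    rw [← eq_sub_iff_add_eq] at hh
    rw [hh]; exact Submodule.sub_mem _ hu (hZ0 hz)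
  have := indep_zero ha2 ha le_rfl
  rw [← hh, this, zero_add]; exact hz

lemma zero_kill {u : X} (hu : u ∈ hwt H X (e 0)) (hk : ∀ α ∈ Φs, ⁅xv α, u⁆ = 0) : u = 0 := by
  by_contra h0
  have hk' : ∀ α ∈ Φ, ⁅xv α, u⁆ = 0 := by
    intro α hα
    by_cases hs' : α ∈ Φs
    · exact hk α hs'
    · have := hwt_lie' (I.xmem (R.ΦΔ hα)) hu (add_zero α)
      rw [I.wt_none R hs hv0 hvθ hvk (R.ne0 (R.ΦΔ hα)) (R.not_short hα hs')] at this
      exact this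
  have hne : hwt H X (e θs) ≠ ⊥ := by
    intro h; rw [h] at hvθ; exact hv0 hvθ
  obtain ⟨δ, h1, h2⟩ := I.wt_form R hs hu h0 hk' hne
  have := congrArg R.ht (I.inj h2)
  rw [map_sub, map_zero] at this
  have h3 := (R.ht_nonneg_closure subset_rfl h1).1
  have h4 := R.ht_pos R.θmem.2
  linarith
end LI


/-- Hypotheses making `X0 ⊔ ⨆ hwt` a simple module. -/
structure SM {E : Type} [NormedAddCommGroup E] [InnerProductSpace ℝ E] (Δ Φs : Set E)
    {L : Type} [LieRing L] [LieAlgebra ℂ L] (H : LieSubalgebra ℂ L)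
    (e : E →+ (H → ℂ)) (xv yv : E → L)
    (X : Type) [AddCommGroup X] [Module ℂ X] [LieRingModule L X] [LieModule ℂ L X]
    (X0 : Submodule ℂ X) : Prop where
  le0 : X0 ≤ hwt H X (e 0)
  ne : ∀ μ ∈ Δ, μ ∈ AddSubgroup.closure Φs → hwt H X (e μ) ≠ ⊥
  one : ∀ μ ∈ Δ, μ ∈ AddSubgroup.closure Φs →
    ∀ u ∈ hwt H X (e μ), u ≠ 0 → hwt H X (e μ) ≤ ℂ ∙ u
  none : ∀ μ ∈ AddSubgroup.closure Φs, μ ≠ 0 → μ ∉ Δ → hwt H X (e μ) = ⊥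
  gen : X0 ≤ ⨆ α ∈ Φs, (hwt H X (e α)).map (adm L X (yv α))
  x0 : ∀ α ∈ Φs, ∀ u ∈ hwt H X (e (-α)), ⁅xv α, u⁆ ∈ X0
  y0 : ∀ α ∈ Φs, ∀ u ∈ hwt H X (e α), ⁅yv α, u⁆ ∈ X0
  kill : ∀ u ∈ X0, (∀ α ∈ Φs, ⁅xv α, u⁆ = 0) → u = 0

/-- the module itself -/
def spc {E : Type} [NormedAddCommGroup E] [InnerProductSpace ℝ E] (Δ Φs : Set E)
    {L : Type} [LieRing L] [LieAlgebra ℂ L] {H : LieSubalgebra ℂ L}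
    (e : E →+ (H → ℂ)) 
    {X : Type} [AddCommGroup X] [Module ℂ X] [LieRingModule L X] [LieModule ℂ L X]
    (X0 : Submodule ℂ X) : Submodule ℂ X :=
  X0 ⊔ ⨆ μ ∈ {γ ∈ Δ | γ ∈ AddSubgroup.closure Φs}, hwt H X (e μ)

namespace SM
variable {E : Type} [NormedAddCommGroup E] [InnerProductSpace ℝ E] [FiniteDimensional ℝ E]
    {Δ Δs Δl Δp Φ Φs : Set E} {ls ll : ℝ} {θs : E}
    {L : Type} [LieRing L] [LieAlgebra ℂ L] {H : LieSubalgebra ℂ L}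
    {e : E →+ (H → ℂ)} {hv : E → H} {xv yv : E → L} (I : LI Δ H e hv xv yv)
    (R : RSys Δ Δs Δl Δp Φ Φs ls ll θs)
    {X : Type} [AddCommGroup X] [Module ℂ X] [LieRingModule L X] [LieModule ℂ L X]
    {X0 : Submodule ℂ X} (S : SM Δ Φs H e xv yv X X0)

lemma le_spc {μ : E} (h : μ ∈ Δ) (h2 : μ ∈ AddSubgroup.closure Φs) :
    hwt H X (e μ) ≤ spc Δ Φs e X0 :=
  le_trans (le_iSup₂_of_le
    (f := fun μ (_ : μ ∈ {γ ∈ Δ | γ ∈ AddSubgroup.closure Φs}) => hwt H X (e μ)) μ ⟨h, h2⟩ le_rfl)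
    le_sup_right

include I R S

lemma x_stab {α : E} (hα : α ∈ Φs) : xv α ∈ stab L (spc Δ Φs e X0) := by
  have hαΔ := R.ΦsΔ hα
  have hαc := AddSubgroup.subset_closure hα
  have : spc Δ Φs e X0 ≤ (spc Δ Φs e X0).comap (adm L X (xv α)) := by
    refine sup_le (fun u hu => ?_) (iSup₂_le ?_)
    · exact le_spc hαΔ hαc (hwt_lie' (I.xmem hαΔ) (S.le0 hu) (add_zero α))
    · rintro μ ⟨h1, h2⟩ u hu
      change ⁅xv α, u⁆ ∈ spc Δ Φs e X0
      have h3 := hwt_lie' (I.xmem hαΔ) hu rfl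
      have h4 := AddSubgroup.add_mem _ hαc h2
      by_cases h5 : α + μ = 0
      · rw [show μ = -α from (neg_eq_of_add_eq_zero_right h5).symm] at hu
        exact Submodule.mem_sup_left (S.x0 α hα u hu)
      by_cases h6 : α + μ ∈ Δ
      · exact le_spc h6 h4 h3
      · rw [S.none _ h4 h5 h6] at h3
        rw [(Submodule.mem_bot ℂ).1 h3]; exact Submodule.zero_mem _
  exact this

lemma y_stab {α : E} (hα : α ∈ Φs) : yv α ∈ stab L (spc Δ Φs e X0) := by
  have hαΔ := R.ΦsΔ hα
  have hαc := AddSubgroup.neg_mem _ (AddSubgroup.subset_closure hα)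
  have : spc Δ Φs e X0 ≤ (spc Δ Φs e X0).comap (adm L X (yv α)) := by
    refine sup_le (fun u hu => ?_) (iSup₂_le ?_)
    · exact le_spc (R.neg hαΔ) hαc (hwt_lie' (I.ymem hαΔ) (S.le0 hu) (add_zero _))
    · rintro μ ⟨h1, h2⟩ u hu
      change ⁅yv α, u⁆ ∈ spc Δ Φs e X0
      have h3 := hwt_lie' (I.ymem hαΔ) hu rfl
      have h4 := AddSubgroup.add_mem _ hαc h2
      by_cases h5 : -α + μ = 0
      · rw [show μ = α from (neg_add_eq_zero.1 h5).symm] at hu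
        exact Submodule.mem_sup_left (S.y0 α hα u hu)
      by_cases h6 : -α + μ ∈ Δ
      · exact le_spc h6 h4 h3
      · rw [S.none _ h4 h5 h6] at h3
        rw [(Submodule.mem_bot ℂ).1 h3]; exact Submodule.zero_mem _
  exact this

omit S I in
lemma orth {x : E} (hx : x ∈ Submodule.span ℝ Φs) (h : ∀ α ∈ Φs, ⟪x, α⟫ = 0) : x = 0 := by
  have : ∀ y ∈ Submodule.span ℝ Φs, ⟪x, y⟫ = 0 := by
    intro y hy
    induction hy using Submodule.span_induction with
    | mem y hy => exact h y hy
    | zero => simp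
    | add a b _ _ h1 h2 => rw [inner_add_right, h1, h2, add_zero]
    | smul t a _ h1 => rw [real_inner_smul_right, h1, mul_zero]
  exact inner_self_eq_zero.1 (this x hx)

omit S I in
lemma clos_span {x : E} (hx : x ∈ AddSubgroup.closure Φs) : x ∈ Submodule.span ℝ Φs := by
  have : AddSubgroup.closure Φs ≤ (Submodule.span ℝ Φs).toAddSubgroup :=
    (AddSubgroup.closure_le _).2 Submodule.subset_span
  exact this hx

omit S I in
lemma clos_Δ {x : E} (hx : x ∈ AddSubgroup.closure Φs) : x ∈ AddSubgroup.closure Δ :=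
  AddSubgroup.closure_mono R.ΦsΔ hx

lemma simple [FiniteDimensional ℂ X] (U : Submodule ℂ X) (hU : U ≤ spc Δ Φs e X0)
    (hx : ∀ α ∈ Φs, xv α ∈ stab L U) (hy : ∀ α ∈ Φs, yv α ∈ stab L U) (h0 : U ≠ ⊥) :
    U = spc Δ Φs e X0 := by
  classical
  refine le_antisymm hU ?_
  have fin : {γ ∈ Δ | γ ∈ AddSubgroup.closure Φs}.Finite := R.fin.subset fun x hx => hx.1
  let T : Finset E := insert 0 fin.toFinset
  have hT : ∀ t ∈ T, t = 0 ∨ (t ∈ Δ ∧ t ∈ AddSubgroup.closure Φs) := by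
    intro t ht
    rcases Finset.mem_insert.1 ht with h | h
    · exact Or.inl h
    · exact Or.inr (fin.mem_toFinset.1 h)
  have hTc : ∀ t ∈ T, t ∈ AddSubgroup.closure Φs := by
    intro t ht
    rcases hT t ht with rfl | h
    exacts [AddSubgroup.zero_mem _, h.2]
  let p : E → Submodule ℂ X := fun t => if t = 0 then X0 else hwt H X (e t)
  have hp : ∀ t, p t ≤ hwt H X (e t) := by
    intro t
    by_cases h : t = 0
    · simp only [p, h, if_true]; exact S.le0
    · simp only [p, h, if_false]; exact le_rfl
  have hpt : spc Δ Φs e X0 ≤ ⨆ t ∈ T, p t := by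
    refine sup_le ?_ (iSup₂_le ?_)
    · refine le_iSup₂_of_le (f := fun t (_ : t ∈ T) => p t) 0 (Finset.mem_insert_self _ _) ?_
      simp [p]
    · rintro μ ⟨h1, h2⟩
      refine le_iSup₂_of_le (f := fun t (_ : t ∈ T) => p t) μ
        (Finset.mem_insert_of_mem (fin.mem_toFinset.2 ⟨h1, h2⟩)) ?_
      simp [p, R.ne0 h1]
  have hnz : ∃ μ ∈ Δ, μ ∈ AddSubgroup.closure Φs ∧ ∃ u ∈ U, u ∈ hwt H X (e μ) ∧ u ≠ 0 := by
    obtain ⟨u, huU, hu0⟩ := Submodule.exists_mem_ne_zero_of_ne_bot h0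
    obtain ⟨m, hm⟩ := (Submodule.mem_iSup_finset_iff_exists_sum p u).1 (hpt (hU huU))
    have hcomp := comp_mem (e := e) U (hv '' Φs) (by
      rintro _ ⟨α, hα, rfl⟩ u hu
      rw [← (I.sl2 α (R.ΦsΔ hα)).lie_e_f, lie_lie]
      exact U.sub_mem (hx α hα _ (hy α hα u hu)) (hy α hα _ (hx α hα u hu))) T (by
      intro s hs t ht hne
      by_contra hc
      push Not at hc
      apply hne
      rw [← sub_eq_zero]
      refine orth R (clos_span R (AddSubgroup.sub_mem _ (hTc s hs) (hTc t ht))) fun α hα => ?_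
      have h1 := hc (hv α) ⟨α, hα, rfl⟩
      rw [I.ev α (R.ΦsΔ hα) s (clos_Δ R (hTc s hs)), I.ev α (R.ΦsΔ hα) t (clos_Δ R (hTc t ht))] at h1
      have h2 : crn s α = crn t α := by exact_mod_cast h1
      have h3 := crn_mul (R.ne0 (R.ΦsΔ hα)) (s - t)
      rw [crn_sub, h2, sub_self, zero_mul] at h3
      linarith) (fun t => (m t : X)) (fun t _ => hp t (m t).2) (by rw [hm]; exact huU)
    obtain ⟨t, ht, ht0⟩ : ∃ t ∈ T, (m t : X) ≠ 0 := by
      by_contra hc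
      push Not at hc
      exact hu0 (by rw [← hm]; exact Finset.sum_eq_zero hc)
    rcases hT t ht with h | h
    · have hm0 : (m t : X) ∈ X0 := by
        have := (m t).2
        simpa [p, h] using this
      obtain ⟨α, hα, hne⟩ : ∃ α ∈ Φs, ⁅xv α, (m t : X)⁆ ≠ 0 := by
        by_contra hc
        push Not at hc
        exact ht0 (S.kill _ hm0 hc)
      exact ⟨α, R.ΦsΔ hα, AddSubgroup.subset_closure hα, _, hx α hα _ (hcomp t ht),
        hwt_lie' (I.xmem (R.ΦsΔ hα)) (S.le0 hm0) (add_zero _), hne⟩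
    · exact ⟨t, h.1, h.2, _, hcomp t ht, hp t (m t).2, ht0⟩
  obtain ⟨μ, hμ, hμc, hu⟩ := hnz
  have key := R.trans (fun γ => ∃ u ∈ U, u ∈ hwt H X (e γ) ∧ u ≠ 0) hμ hμc hu (by
    rintro α hα γ hγ hγc ⟨u, h1, h2, h3⟩
    exact I.reflect R (R.ΦsΔ hα) U (hx α hα) (hy α hα) (AddSubgroup.subset_closure hγ) h1 h2 h3)
  have key2 : ∀ γ ∈ Δ, γ ∈ AddSubgroup.closure Φs → hwt H X (e γ) ≤ U := by
    intro γ h1 h2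
    obtain ⟨u, h3, h4, h5⟩ := key γ h1 h2
    exact (S.one γ h1 h2 u h4 h5).trans ((Submodule.span_singleton_le_iff_mem _ _).2 h3)
  refine sup_le (S.gen.trans (iSup₂_le ?_)) (iSup₂_le fun γ hγ => key2 γ hγ.1 hγ.2)
  rintro α hα _ ⟨u, hu, rfl⟩
  exact hy α hα u (key2 α (R.ΦsΔ hα) (AddSubgroup.subset_closure hα) hu)
end SM

section instances
variable {E : Type} [NormedAddCommGroup E] [InnerProductSpace ℝ E] [FiniteDimensional ℝ E]
    {Δ Δs Δl Δp Φ Φs : Set E} {ls ll : ℝ} {θs : E}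
    {L : Type} [LieRing L] [LieAlgebra ℂ L] [FiniteDimensional ℂ L] {H : LieSubalgebra ℂ L}
    [LieRing.IsNilpotent H]
    {e : E →+ (H → ℂ)} {hv : E → H} {xv yv : E → L} (I : LI Δ H e hv xv yv)
    (R : RSys Δ Δs Δl Δp Φ Φs ls ll θs)
    {X : Type} [AddCommGroup X] [Module ℂ X] [LieRingModule L X] [LieModule ℂ L X]
    [FiniteDimensional ℂ X]
include I R

lemma SM_M (hs : ∀ N : LieSubmodule ℂ L X, N = ⊥ ∨ N = ⊤) {v : X} (hv0 : v ≠ 0)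
    (hvθ : v ∈ hwt H X (e θs)) (hvk : ∀ α ∈ Φ, ⁅xv α, v⁆ = 0) :
    SM Δ Φs H e xv yv X (hwt H X (e 0)) where
  le0 := le_rfl
  ne μ h1 h2 := (I.wt_one R hs hv0 hvθ hvk (R.D_short h1 h2)).1
  one μ h1 h2 := (I.wt_one R hs hv0 hvθ hvk (R.D_short h1 h2)).2
  none μ _ h2 h3 := I.wt_none R hs hv0 hvθ hvk h2 (fun h => h3 (R.ΔsΔ h))
  gen := I.zero_le R hs hv0 hvθ hvk
  x0 α hα u hu := hwt_lie' (I.xmem (R.ΦsΔ hα)) hu (by abel)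
  y0 α hα u hu := hwt_lie' (I.ymem (R.ΦsΔ hα)) hu (by abel)
  kill u hu hk := I.zero_kill R hs hv0 hvθ hvk hu hk

omit [FiniteDimensional ℂ L] [LieRing.IsNilpotent H] in
lemma SM_L : SM Δ Φs H e xv yv L (Submodule.span ℂ (Set.range fun a : Φs => (hv (a : E) : L))) where
  le0 := by
    rw [Submodule.span_le]
    rintro _ ⟨a, rfl⟩ x
    rw [map_zero, Pi.zero_apply, zero_smul]; exact I.abel _ _
  ne μ h1 h2 := by
    intro h
    have := I.xmem h1
    rw [h] at this
    exact (I.sl2 μ h1).e_ne_zero this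
  one μ h1 h2 u hu hu0 := by
    rw [I.hx μ h1] at hu ⊢
    obtain ⟨c, rfl⟩ := Submodule.mem_span_singleton.1 hu
    have hc : c ≠ 0 := fun h => hu0 (by rw [h, zero_smul])
    rw [Submodule.span_singleton_smul_eq (IsUnit.mk0 c hc)]
  none μ _ h2 h3 := I.none μ h2 h3
  gen := by
    rw [Submodule.span_le]
    rintro _ ⟨a, rfl⟩
    refine (le_iSup₂_of_le (f := fun α (_ : α ∈ Φs) => (hwt H L (e α)).map (adm L L (yv α)))
                (a : E) a.2 le_rfl) ⟨-xv a, Submodule.neg_mem _ (I.xmem (R.ΦsΔ a.2)), ?_⟩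
    change ⁅yv a, -xv a⁆ = _
    rw [lie_neg, lie_skew, (I.sl2 a (R.ΦsΔ a.2)).lie_e_f]
  x0 α hα u hu := by
    rw [I.hy α (R.ΦsΔ hα)] at hu
    obtain ⟨c, rfl⟩ := Submodule.mem_span_singleton.1 hu
    rw [lie_smul, (I.sl2 α (R.ΦsΔ hα)).lie_e_f]
    exact Submodule.smul_mem _ _ (Submodule.subset_span ⟨⟨α, hα⟩, rfl⟩)
  y0 α hα u hu := by
    rw [I.hx α (R.ΦsΔ hα)] at hu
    obtain ⟨c, rfl⟩ := Submodule.mem_span_singleton.1 hu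
    rw [lie_smul, ← lie_skew, (I.sl2 α (R.ΦsΔ hα)).lie_e_f]
    exact Submodule.smul_mem _ _ (Submodule.neg_mem _ (Submodule.subset_span ⟨⟨α, hα⟩, rfl⟩))
  kill u hu hk := by
    have : Finite Φs := (R.fin.subset R.ΦsΔ).to_subtype
    have := Fintype.ofFinite Φs
    obtain ⟨c, rfl⟩ := (Submodule.mem_span_range_iff_exists_fun ℂ).1 hu
    have h1 : ∀ β ∈ Φs, ∑ a : Φs, c a * ((crn β a : ℝ) : ℂ) = 0 := by
      intro β hβ
      have h2 := hk β hβ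
      have hβΔ := R.ΦsΔ hβ
      rw [← lie_skew, neg_eq_zero, sum_lie] at h2
      have h3 : ∑ a : Φs, ⁅c a • (hv (a : E) : L), xv β⁆ =
          (∑ a : Φs, c a * ((crn β a : ℝ) : ℂ)) • xv β := by
        rw [Finset.sum_smul]
        refine Finset.sum_congr rfl fun a _ => ?_
        rw [smul_lie, I.hact (R.ΦsΔ a.2) (AddSubgroup.subset_closure hβΔ) (I.xmem hβΔ), smul_smul]
      rw [h3] at h2
      exact (smul_eq_zero.1 h2).resolve_right (I.sl2 β hβΔ).e_ne_zero
    have ind : LinearIndependent ℝ (fun a : Φs => (a : E)) :=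
      R.ind.comp (Set.inclusion R.ΦsΦ) (Set.inclusion_injective _)
    have real : ∀ r : Φs → ℝ, (∀ β ∈ Φs, ∑ a : Φs, r a * crn β a = 0) → ∀ a, r a = 0 := by
      intro r hr a
      have h0 : ∑ a : Φs, (r a * (2 / ⟪(a : E), (a : E)⟫)) • (a : E) = 0 := by
        refine SM.orth R (Submodule.sum_mem _ fun a _ => Submodule.smul_mem _ _
          (Submodule.subset_span a.2)) fun β hβ => ?_
        rw [← hr β hβ, sum_inner]
        refine Finset.sum_congr rfl fun a _ => ?_
        rw [real_inner_smul_left, real_inner_comm β (a : E)]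
        unfold crn; ring
      have := Fintype.linearIndependent_iff.1 ind _ h0 a
      have h2 := inner_pos (R.ne0 (R.ΦsΔ a.2))
      rcases mul_eq_zero.1 this with h | h
      · exact h
      · exact absurd h (by positivity)
    have hre := real (fun a => (c a).re) (fun β hβ => by
      have := congrArg Complex.re (h1 β hβ)
      simpa using this)
    have him := real (fun a => (c a).im) (fun β hβ => by
      have := congrArg Complex.im (h1 β hβ)
      simpa using this)
    refine Finset.sum_eq_zero fun a _ => ?_
    have hca : c a = 0 := Complex.ext (hre a) (him a)
    rw [hca, zero_smul]
end instances


section prodmod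
variable {L : Type} [LieRing L] [LieAlgebra ℂ L]
    {X : Type} [AddCommGroup X] [Module ℂ X] [LieRingModule L X] [LieModule ℂ L X]
    {Y : Type} [AddCommGroup Y] [Module ℂ Y] [LieRingModule L Y] [LieModule ℂ L Y]

instance prodLRM : LieRingModule L (X × Y) where
  bracket x p := (⁅x, p.1⁆, ⁅x, p.2⁆)
  add_lie x y p := Prod.ext (add_lie x y p.1) (add_lie x y p.2)
  lie_add x p q := Prod.ext (lie_add x p.1 q.1) (lie_add x p.2 q.2)
  leibniz_lie x y p := Prod.ext (leibniz_lie x y p.1) (leibniz_lie x y p.2)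

lemma prod_lie (x : L) (p : X × Y) : ⁅x, p⁆ = (⁅x, p.1⁆, ⁅x, p.2⁆) := rfl

instance prodLM : LieModule ℂ L (X × Y) where
  smul_lie c x p := Prod.ext (smul_lie c x p.1) (smul_lie c x p.2)
  lie_smul c x p := Prod.ext (lie_smul c x p.1) (lie_smul c x p.2)
end prodmod

section iso
variable {E : Type} [NormedAddCommGroup E] [InnerProductSpace ℝ E] [FiniteDimensional ℝ E]
    {Δ Δs Δl Δp Φ Φs : Set E} {ls ll : ℝ} {θs : E}
    {L : Type} [LieRing L] [LieAlgebra ℂ L] {H : LieSubalgebra ℂ L}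
    [LieRing.IsNilpotent H]
    {e : E →+ (H → ℂ)} {hv : E → H} {xv yv : E → L} (I : LI Δ H e hv xv yv)
    (R : RSys Δ Δs Δl Δp Φ Φs ls ll θs)
    {X : Type} [AddCommGroup X] [Module ℂ X] [LieRingModule L X] [LieModule ℂ L X]
    [FiniteDimensional ℂ X]
    {Y : Type} [AddCommGroup Y] [Module ℂ Y] [LieRingModule L Y] [LieModule ℂ L Y]
    [FiniteDimensional ℂ Y] {X0 : Submodule ℂ X} {Y0 : Submodule ℂ Y}
include R

omit [LieRing.IsNilpotent H] in
lemma Φs_ne : Φs.Nonempty := by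
  by_contra hc
  rw [Set.not_nonempty_iff_eq_empty] at hc
  have key := R.link subset_rfl (fun γ => ‖γ‖ = ll) (fun α hα => by
    have h1 := R.ΦΔ hα
    rw [R.cover] at h1
    rcases h1 with h1 | h1
    · have : α ∈ Φs := by rw [R.hΦs]; exact ⟨hα, h1⟩
      rw [hc] at this; exact absurd this (Set.notMem_empty _)
    · rw [R.hΔl] at h1; exact h1.2)
    (fun α hα γ _ _ h => by rw [norm_srf (R.ne0 (R.ΦΔ hα))]; exact h) θs R.θΔ (R.mem_closure R.θΔ)
  have h2 := R.short_norm R.θmem.1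
  have := R.hlsll
  linarith

lemma top_root : ∃ μ ∈ Δ, μ ∈ AddSubgroup.closure Φs ∧
    ∀ α ∈ Φs, α + μ ≠ 0 ∧ α + μ ∉ Δ := by
  have fin : {γ ∈ Δ | γ ∈ AddSubgroup.closure Φs}.Finite := R.fin.subset fun x hx => hx.1
  obtain ⟨α0, h0⟩ := Φs_ne R
  obtain ⟨μ, ⟨h1, h2⟩, h3⟩ := Set.exists_max_image _ R.ht fin
    ⟨α0, R.ΦsΔ h0, AddSubgroup.subset_closure h0⟩
  refine ⟨μ, h1, h2, fun α hα => ⟨fun h => ?_, fun h => ?_⟩⟩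
  · have h4 := h3 α ⟨R.ΦsΔ hα, AddSubgroup.subset_closure hα⟩
    have h5 := congrArg R.ht h
    rw [map_add, map_zero] at h5
    rw [R.ht_simple (R.ΦsΦ hα)] at h4 h5
    linarith
  · have h4 := h3 _ ⟨h, AddSubgroup.add_mem _ (AddSubgroup.subset_closure hα) h2⟩
    rw [map_add, R.ht_simple (R.ΦsΦ hα)] at h4
    linarith

include I
lemma top_kill (S : SM Δ Φs H e xv yv X X0) {μ : E} (hc : μ ∈ AddSubgroup.closure Φs)
    (hm : ∀ α ∈ Φs, α + μ ≠ 0 ∧ α + μ ∉ Δ) {u : X} (hu : u ∈ hwt H X (e μ)) {α : E}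
    (hα : α ∈ Φs) : ⁅xv α, u⁆ = 0 := by
  have := hwt_lie' (I.xmem (R.ΦsΔ hα)) hu rfl
  rw [S.none _ (AddSubgroup.add_mem _ (AddSubgroup.subset_closure hα) hc) (hm α hα).1
    (hm α hα).2] at this
  exact this

lemma iso_main (S : SM Δ Φs H e xv yv X X0) (T : SM Δ Φs H e xv yv Y Y0)
    (gs : LieSubalgebra ℂ L)
    (hgs : ∀ K : LieSubalgebra ℂ L, (∀ α ∈ Φs, xv α ∈ K) → (∀ α ∈ Φs, yv α ∈ K) → gs ≤ K) :
    ∃ f : spc Δ Φs e X0 →ₗ[ℂ] Y, Function.Injective f ∧ LinearMap.range f = spc Δ Φs e Y0 ∧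
      ∀ x ∈ gs, ∀ v w : spc Δ Φs e X0, (w : X) = ⁅x, (v : X)⁆ → f w = ⁅x, f v⁆ := by
  obtain ⟨μ, hμ, hμc, hmax⟩ := top_root R
  obtain ⟨a, ha, ha0⟩ := Submodule.exists_mem_ne_zero_of_ne_bot (S.ne μ hμ hμc)
  obtain ⟨b, hb, hb0⟩ := Submodule.exists_mem_ne_zero_of_ne_bot (T.ne μ hμ hμc)
  have hw : (a, b) ∈ hwt H (X × Y) (e μ) := fun h => Prod.ext (ha h) (hb h)
  have hk : ∀ α ∈ Φs, ⁅xv α, (a, b)⁆ = 0 := fun α hα =>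
    Prod.ext (top_kill I R S hμc hmax ha hα) (top_kill I R T hμc hmax hb hα)
  set N : Submodule ℂ (X × Y) := wsp yv Φs (a, b) with hN
  have Nx : ∀ α ∈ Φs, xv α ∈ stab L N := fun α hα => I.wsp_x R R.ΦsΦ hw hk hα
  have Ny : ∀ α ∈ Φs, yv α ∈ stab L N := fun α hα u hu => wsp_y hα hu
  have Ng : gs ≤ stab L N := hgs _ Nx Ny
  have hself : (a, b) ∈ N := wsp_self
  have Nle : N ≤ (spc Δ Φs e X0).prod (spc Δ Φs e Y0) := by
    apply wsp_le
    · exact ⟨SM.le_spc hμ hμc ha, SM.le_spc hμ hμc hb⟩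
    · intro α hα u hu
      exact ⟨SM.y_stab I R S hα _ hu.1, SM.y_stab I R T hα _ hu.2⟩
  have Nwt : ∀ u ∈ N, u ∈ hwt H (X × Y) (e μ) → ∃ c : ℂ, c • (a, b) = u := by
    intro u huN hu
    have h1 := I.wsp_wt R R.ΦsΦ hw
    obtain ⟨a', ha', r, hr, hh⟩ := Submodule.mem_sup.1 (h1 huN)
    obtain ⟨c, rfl⟩ := Submodule.mem_span_singleton.1 ha'
    have hr2 : r ∈ hwt H (X × Y) (e μ) := by
      rw [← eq_sub_iff_add_eq'] at hh
      rw [hh]; exact Submodule.sub_mem _ hu (Submodule.smul_mem _ _ hw)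
    have : r = 0 := by
      refine indep_zero hr2 hr (iSup₂_le ?_)
      rintro ν ⟨δ, h1, h2, rfl⟩
      refine le_iSup₂_of_le (f := fun ψ (_ : ψ ≠ e μ) => hwt H (X × Y) ψ) _ (fun h => h2 ?_) le_rfl
      simpa using I.inj h
    exact ⟨c, by rw [← hh, this, add_zero]⟩
  -- first kernel
  have k1 : N.comap (LinearMap.inl ℂ X Y) = ⊥ := by
    by_contra hne
    have := SM.simple I R S (N.comap (LinearMap.inl ℂ X Y)) (fun u hu => (Nle hu).1)
      (fun α hα u hu => by
        have := Nx α hα _ hu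
        simpa [prod_lie] using this)
      (fun α hα u hu => by
        have := Ny α hα _ hu
        simpa [prod_lie] using this) hne
    have h2 : (a, (0 : Y)) ∈ N := by
      have h3 : a ∈ spc Δ Φs e X0 := SM.le_spc hμ hμc ha
      rw [← this] at h3; exact h3
    obtain ⟨c, hc⟩ := Nwt _ h2 (fun h => Prod.ext (ha h) (by simp [prod_lie]))
    have e1 : c • a = a := congrArg Prod.fst hc
    have e2 : c • b = 0 := congrArg Prod.snd hc
    have e3 := (smul_eq_zero.1 e2).resolve_right hb0
    rw [e3, zero_smul] at e1
    exact ha0 e1.symm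
  have k2 : N.comap (LinearMap.inr ℂ X Y) = ⊥ := by
    by_contra hne
    have := SM.simple I R T (N.comap (LinearMap.inr ℂ X Y)) (fun u hu => (Nle hu).2)
      (fun α hα u hu => by
        have := Nx α hα _ hu
        simpa [prod_lie] using this)
      (fun α hα u hu => by
        have := Ny α hα _ hu
        simpa [prod_lie] using this) hne
    have h2 : ((0 : X), b) ∈ N := by
      have h3 : b ∈ spc Δ Φs e Y0 := SM.le_spc hμ hμc hb
      rw [← this] at h3; exact h3
    obtain ⟨c, hc⟩ := Nwt _ h2 (fun h => Prod.ext (by simp [prod_lie]) (hb h))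
    have e1 : c • a = 0 := congrArg Prod.fst hc
    have e2 : c • b = b := congrArg Prod.snd hc
    have e3 := (smul_eq_zero.1 e1).resolve_right ha0
    rw [e3, zero_smul] at e2
    exact hb0 e2.symm
  have p1 : N.map (LinearMap.fst ℂ X Y) = spc Δ Φs e X0 := by
    refine SM.simple I R S _ ?_ ?_ ?_ ?_
    · rintro _ ⟨u, hu, rfl⟩; exact (Nle hu).1
    · rintro α hα _ ⟨u, hu, rfl⟩; exact ⟨_, Nx α hα u hu, rfl⟩
    · rintro α hα _ ⟨u, hu, rfl⟩; exact ⟨_, Ny α hα u hu, rfl⟩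
    · intro h
      have : a ∈ N.map (LinearMap.fst ℂ X Y) := ⟨_, hself, rfl⟩
      rw [h] at this; exact ha0 this
  have p2 : N.map (LinearMap.snd ℂ X Y) = spc Δ Φs e Y0 := by
    refine SM.simple I R T _ ?_ ?_ ?_ ?_
    · rintro _ ⟨u, hu, rfl⟩; exact (Nle hu).2
    · rintro α hα _ ⟨u, hu, rfl⟩; exact ⟨_, Nx α hα u hu, rfl⟩
    · rintro α hα _ ⟨u, hu, rfl⟩; exact ⟨_, Ny α hα u hu, rfl⟩
    · intro h
      have : b ∈ N.map (LinearMap.snd ℂ X Y) := ⟨_, hself, rfl⟩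
      rw [h] at this; exact hb0 this
  have u2 : ∀ m y y', (m, y) ∈ N → (m, y') ∈ N → y = y' := by
    intro m y y' h1 h2
    have h3 : y - y' ∈ N.comap (LinearMap.inr ℂ X Y) := by
      have := N.sub_mem h1 h2
      simpa using this
    rw [k2] at h3
    exact sub_eq_zero.1 h3
  have ex : ∀ m : spc Δ Φs e X0, ∃ y, ((m : X), y) ∈ N := by
    rintro ⟨m, hm⟩
    rw [← p1] at hm
    obtain ⟨⟨m', y⟩, hu, rfl⟩ := hm
    exact ⟨y, hu⟩
  choose f hf using ex
  refine ⟨{ toFun := f, map_add' := fun m m' => ?_, map_smul' := fun c m => ?_ }, ?_, ?_, ?_⟩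
  · exact u2 _ _ _ (hf _) (N.add_mem (hf m) (hf m'))
  · exact u2 _ _ _ (hf _) (N.smul_mem c (hf m))
  · intro m m' h
    change f m = f m' at h
    have h1 := hf m
    rw [h] at h1
    have h3 : (m : X) - m' ∈ N.comap (LinearMap.inl ℂ X Y) := by
      have := N.sub_mem h1 (hf m')
      simpa using this
    rw [k1] at h3
    exact Subtype.ext (sub_eq_zero.1 h3)
  · ext y
    constructor
    · rintro ⟨m, rfl⟩
      exact (Nle (hf m)).2
    · intro hy
      rw [← p2] at hy
      obtain ⟨⟨m, y'⟩, hu, rfl⟩ := hy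
      exact ⟨⟨m, (Nle hu).1⟩, u2 _ _ _ (hf _) hu⟩
  · intro x hx v w hwv
    refine u2 _ _ _ (hf w) ?_
    rw [hwv]
    exact Ng hx _ (hf v)

omit [FiniteDimensional ℂ X] [FiniteDimensional ℂ Y] [LieRing.IsNilpotent H] in
lemma gs_eq [FiniteDimensional ℂ L] {Y0 : Submodule ℂ L} (S : SM Δ Φs H e xv yv L Y0)
    (gs : LieSubalgebra ℂ L) (hx : ∀ α ∈ Φs, xv α ∈ gs) (hy : ∀ α ∈ Φs, yv α ∈ gs)
    (hgs : ∀ K : LieSubalgebra ℂ L, (∀ α ∈ Φs, xv α ∈ K) → (∀ α ∈ Φs, yv α ∈ K) → gs ≤ K) :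
    gs.toSubmodule = spc Δ Φs e Y0 := by
  let K : LieSubalgebra ℂ L :=
    { spc Δ Φs e Y0 ⊓ (stab L (spc Δ Φs e Y0)).toSubmodule with
      lie_mem' := fun {a b} ha hb => ⟨ha.2 _ hb.1, (stab L (spc Δ Φs e Y0)).lie_mem ha.2 hb.2⟩ }
  have hK : gs ≤ K := hgs K
    (fun α hα => ⟨SM.le_spc (R.ΦsΔ hα) (AddSubgroup.subset_closure hα) (I.xmem (R.ΦsΔ hα)),
      SM.x_stab I R S hα⟩)
    (fun α hα => ⟨SM.le_spc (R.neg (R.ΦsΔ hα))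
      (AddSubgroup.neg_mem _ (AddSubgroup.subset_closure hα)) (I.ymem (R.ΦsΔ hα)),
      SM.y_stab I R S hα⟩)
  refine SM.simple I R S _ (fun u hu => (hK hu).1) (fun α hα u hu => gs.lie_mem (hx α hα) hu)
    (fun α hα u hu => gs.lie_mem (hy α hα) hu) ?_
  intro h
  obtain ⟨α, hα⟩ := Φs_ne R
  have : xv α ∈ gs.toSubmodule := hx α hα
  rw [h] at this
  exact (I.sl2 α (R.ΦsΔ hα)).e_ne_zero this
end iso

lemma finsupp_clos {E : Type} [AddCommGroup E] (Φs : Set E) (γ : E) :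
    (∃ c : E →₀ ℤ, ↑c.support ⊆ Φs ∧ γ = c.sum fun α n => n • α) ↔ γ ∈ AddSubgroup.closure Φs := by
  constructor
  · rintro ⟨c, h1, rfl⟩
    exact AddSubgroup.sum_mem _ fun α hα => AddSubgroup.zsmul_mem _
      (AddSubgroup.subset_closure (h1 hα)) _
  · intro h
    have h2 : γ ∈ Submodule.span ℤ (id '' Φs) := by
      rw [Set.image_id, ← Submodule.mem_toAddSubgroup, Submodule.span_int_eq_addSubgroupClosure]; exact h
    rw [Finsupp.mem_span_image_iff_linearCombination] at h2
    obtain ⟨c, h3, h4⟩ := h2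
    exact ⟨c, h3, h4.symm⟩

/-- The subspace `V⁰ ⊕ (⊕_{μ ∈ Δ(Πs)} V^μ)` of the little adjoint module
is a `𝔤(Πs)`-submodule isomorphic to the adjoint module of `𝔤(Πs)` (the subalgebra generated
by the root spaces `𝔤^{±α}`, `α ∈ Πs`); moreover, any other simple `𝔤(Πs)`-submodule of
`V_{θs}` intersects `V⁰` trivially. -/
theorem statement15
    {E : Type} [NormedAddCommGroup E] [InnerProductSpace ℝ E] [FiniteDimensional ℝ E]
    (Δ Δs Δl Δp Φ Φs : Set E)
    -- `Δ` is a reduced crystallographic root system in `E`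
    (hfin : Δ.Finite) (h0 : (0 : E) ∉ Δ)
    (hspan : Submodule.span ℝ Δ = ⊤)
    (hrefl : ∀ α ∈ Δ, ∀ β ∈ Δ, rrefl α β ∈ Δ)
    (hcrys : ∀ α ∈ Δ, ∀ β ∈ Δ, ∃ n : ℤ, 2 * ⟪β, α⟫ / ⟪α, α⟫ = (n : ℝ))
    (hred : ∀ α ∈ Δ, ∀ t : ℝ, t • α ∈ Δ → t = 1 ∨ t = -1)
    -- irreducible
    (hirr : ∀ A B : Set E, A ∪ B = Δ → (∀ a ∈ A, ∀ b ∈ B, ⟪a, b⟫ = 0) → A = ∅ ∨ B = ∅)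
    -- two root lengths: `Δs` are the short roots, `Δl` the long ones
    (ls ll : ℝ) (h0ls : 0 < ls) (hlsll : ls < ll)
    (hΔs : Δs = {α ∈ Δ | ‖α‖ = ls}) (hΔl : Δl = {α ∈ Δ | ‖α‖ = ll})
    (hcover : Δ = Δs ∪ Δl) (hsne : Δs.Nonempty) (hlne : Δl.Nonempty)
    -- `Δp` is a positive system with simple roots `Φ`; `Φs = Φ ∩ Δs`
    (hΔpΔ : Δp ⊆ Δ) (hpm : ∀ α ∈ Δ, α ∈ Δp ↔ -α ∉ Δp)
    (hΦp : Φ ⊆ Δp)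
    (hΦind : LinearIndependent ℝ (fun a : Φ => (a : E)))
    (hΦdec : ∀ γ ∈ Δp, ∃ c : E →₀ ℕ, ↑c.support ⊆ Φ ∧ γ = c.sum fun α n => (n : ℝ) • α)
    (hΦs : Φs = Φ ∩ Δs)
    -- `θs` is the highest short root
    (θs : E) (hθsmem : θs ∈ Δs ∩ Δp)
    (hθshigh : ∀ γ ∈ Δs, ∃ c : E →₀ ℝ, ↑c.support ⊆ Φ ∧ (∀ α, 0 ≤ c α) ∧
      θs - γ = c.sum fun α t => t • α)
    -- `L` is a complex simple Lie algebra with Cartan subalgebra `H`, whose root system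
    -- is identified with `Δ` via `e`
    (L : Type) [LieRing L] [LieAlgebra ℂ L] [FiniteDimensional ℂ L]
    [LieAlgebra.IsSimple ℂ L]
    (H : LieSubalgebra ℂ L) [H.IsCartanSubalgebra]
    (e : E → H → ℂ)
    (headd : ∀ a b : E, e (a + b) = e a + e b)
    (heinj : Function.Injective e)
    (hroots1 : ∀ μ ∈ Δ, hwt H L (e μ) ≠ ⊥)
    (hroots2 : ∀ χ : H → ℂ, χ ≠ 0 → hwt H L χ ≠ ⊥ → ∃ μ ∈ Δ, χ = e μ)
    -- `M` is the little adjoint module `V_{θs}`: the (finite-dimensional) simple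
    -- `L`-module with highest weight `θs`
    (M : Type) [AddCommGroup M] [Module ℂ M] [LieRingModule L M] [LieModule ℂ L M]
    [FiniteDimensional ℂ M] [Nontrivial M]
    (hMsimple : ∀ N : LieSubmodule ℂ L M, N = ⊥ ∨ N = ⊤)
    (hhw : ∃ v : M, v ≠ 0 ∧ v ∈ hwt H M (e θs) ∧
      ∀ γ ∈ Δp, ∀ x ∈ hwt H L (e γ), ⁅x, v⁆ = 0)
 :
    ∀ gs : LieSubalgebra ℂ L,
      gs = LieSubalgebra.lieSpan ℂ L
        (⋃ α ∈ Φs, ((hwt H L (e α) : Set L) ∪ (hwt H L (e (-α)) : Set L))) →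
    ∀ M₀ : Submodule ℂ M,
      M₀ = hwt H M (0 : H → ℂ) ⊔
        (⨆ μ ∈ {γ ∈ Δ | ∃ c : E →₀ ℤ, ↑c.support ⊆ Φs ∧ γ = c.sum fun α n => n • α},
          hwt H M (e μ)) →
      -- `M₀` is a `𝔤(Πs)`-submodule of `V_{θs}` ...
      (∀ x ∈ gs, ∀ v ∈ M₀, ⁅x, v⁆ ∈ M₀) ∧
      -- ... isomorphic, equivariantly, to the adjoint module of `𝔤(Πs)` ...
      (∃ f : M₀ →ₗ[ℂ] L, Function.Injective f ∧ LinearMap.range f = gs.toSubmodule ∧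
        ∀ x ∈ gs, ∀ v w : M₀, (w : M) = ⁅x, (v : M)⁆ → f w = ⁅x, f v⁆) ∧
      -- ... and any other simple `𝔤(Πs)`-submodule of `V_{θs}` meets `V⁰` trivially
      (∀ W : Submodule ℂ M, (∀ x ∈ gs, ∀ v ∈ W, ⁅x, v⁆ ∈ W) → W ≠ ⊥ →
        (∀ U : Submodule ℂ M, U ≤ W → (∀ x ∈ gs, ∀ v ∈ U, ⁅x, v⁆ ∈ U) → U = ⊥ ∨ U = W) →
        W ≠ M₀ → W ⊓ hwt H M (0 : H → ℂ) = ⊥) := by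
  have R : RSys Δ Δs Δl Δp Φ Φs ls ll θs :=
    { fin := hfin, h0 := h0, span := hspan
      refl := fun α hα β hβ => by
        rw [← rrefl_eq_srf]; exact hrefl α hα β hβ
      crys := hcrys, red := hred, irr := hirr, h0ls := h0ls, hlsll := hlsll
      hΔs := hΔs, hΔl := hΔl, cover := hcover, ΔpΔ := hΔpΔ, pm := hpm, Φp := hΦp
      ind := hΦind, dec := hΦdec, hΦs := hΦs, θmem := hθsmem, θhigh := hθshigh }
  obtain ⟨e', he'⟩ : ∃ e' : E →+ (H → ℂ), (e' : E → H → ℂ) = e :=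
    ⟨AddMonoidHom.mk' e headd, rfl⟩
  subst he'
  obtain ⟨hv, xv, yv, I⟩ := exists_LI H R e' heinj hroots1 hroots2
  obtain ⟨v, hv0, hvθ, hvk⟩ := hhw
  have SMM := SM_M I R hMsimple hv0 hvθ
    (fun α hα => hvk α (hΦp hα) _ (I.xmem (R.ΦΔ hα)))
  have SML := SM_L I R
  intro gs hgs M₀ hM₀
  have hM : M₀ = spc Δ Φs e' (hwt H M (e' 0)) := by
    rw [hM₀, spc, map_zero]
    simp only [finsupp_clos]
  have gx : ∀ α ∈ Φs, xv α ∈ gs := by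
    intro α hα
    rw [hgs]
    exact LieSubalgebra.subset_lieSpan (Set.mem_iUnion₂.2 ⟨α, hα, Or.inl (I.xmem (R.ΦsΔ hα))⟩)
  have gy : ∀ α ∈ Φs, yv α ∈ gs := by
    intro α hα
    rw [hgs]
    exact LieSubalgebra.subset_lieSpan (Set.mem_iUnion₂.2 ⟨α, hα, Or.inr (I.ymem (R.ΦsΔ hα))⟩)
  have gle : ∀ K : LieSubalgebra ℂ L, (∀ α ∈ Φs, xv α ∈ K) → (∀ α ∈ Φs, yv α ∈ K) → gs ≤ K := by
    intro K h1 h2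
    rw [hgs, LieSubalgebra.lieSpan_le]
    intro x hx
    obtain ⟨α, hα, hx⟩ := Set.mem_iUnion₂.1 hx
    rcases hx with hx | hx
    · rw [I.hx α (R.ΦsΔ hα)] at hx
      obtain ⟨c, rfl⟩ := Submodule.mem_span_singleton.1 hx
      exact K.smul_mem c (h1 α hα)
    · rw [I.hy α (R.ΦsΔ hα)] at hx
      obtain ⟨c, rfl⟩ := Submodule.mem_span_singleton.1 hx
      exact K.smul_mem c (h2 α hα)
  have hst : ∀ x ∈ gs, ∀ v ∈ M₀, ⁅x, v⁆ ∈ M₀ := by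
    have h1 : gs ≤ stab L (spc Δ Φs e' (hwt H M (e' 0))) :=
      gle _ (fun α hα => SM.x_stab I R SMM hα) (fun α hα => SM.y_stab I R SMM hα)
    rw [hM]
    exact fun x hx => h1 hx
  refine ⟨hst, ?_, ?_⟩
  · subst hM
    rw [gs_eq I R SML gs gx gy gle]
    exact iso_main I R SMM SML gs gle
  · intro W hW hW0 hWs hWM
    have h1 := hWs (W ⊓ M₀) inf_le_left
      (fun x hx v hv => ⟨hW x hx v hv.1, hst x hx v hv.2⟩)
    rcases h1 with h1 | h1
    · rw [eq_bot_iff, ← h1]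
      refine inf_le_inf_left W ?_
      rw [hM₀]; exact le_sup_left
    · have h2 : W ≤ M₀ := inf_eq_left.1 h1
      rw [hM] at h2
      exact absurd ((SM.simple I R SMM W h2 (fun α hα => hW _ (gx α hα))
        (fun α hα => hW _ (gy α hα)) hW0).trans hM.symm) hWM
end
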